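/- Let F/K be a finite Galois extension of number fields with Galois group G, let d be the degree of K over ℚ, and let S be a finite G-stable set of places of F containing all archimedean places. Then the equality [Ãr_F] = d·[ℤ[G]] − [ℤ[S]] + σ[O×_{F,S}] − σ[Cl_{F,S}] holds in G₀(ℤ[G]), where O×_{F,S} is the group of S-units of F and Cl_{F,S} is the class group of the ring of S-integers of F. -/

import Mathlib

/-- A bundled finitely generated module over a ring `R`. -/
structure FGMod (R : Type) [Ring R] : Type 1 where
  carrier : Type
  [isAddCommGroup : AddCommGroup carrier]
  [isModule : Module R carrier]
  [isFinite : Module.Finite R carrier]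

attribute [instance] FGMod.isAddCommGroup FGMod.isModule FGMod.isFinite

/-- The subgroup of relations defining the Grothendieck group `G₀(R)`:
one relation `[M] = [L] + [N]` for each short exact sequence `0 → L → M → N → 0`
of finitely generated `R`-modules. -/
def G0Rel (R : Type) [Ring R] : AddSubgroup (FreeAbelianGroup (FGMod R)) :=
  AddSubgroup.closure
    { x | ∃ (L M N : FGMod R) (f : L.carrier →ₗ[R] M.carrier)
            (g : M.carrier →ₗ[R] N.carrier),
        Function.Injective f ∧ Function.Surjective g ∧ Function.Exact f g ∧
        x = FreeAbelianGroup.of M - FreeAbelianGroup.of L - FreeAbelianGroup.of N }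

/-- The Grothendieck group `G₀(R)` of the category of finitely generated `R`-modules. -/
def G0 (R : Type) [Ring R] : Type 1 :=
  FreeAbelianGroup (FGMod R) ⧸ G0Rel R

instance (R : Type) [Ring R] : AddCommGroup (G0 R) :=
  QuotientAddGroup.Quotient.addCommGroup _

/-- The class `[M] ∈ G₀(R)` of a finitely generated `R`-module `M` (junk value `0` if `M` is
not finitely generated). -/
noncomputable def G0.cls (R : Type) [Ring R] (M : Type) [AddCommGroup M] [Module R M] :
    G0 R := by
  classical
  exact
    if h : Module.Finite R M then
      QuotientAddGroup.mk (FreeAbelianGroup.of (@FGMod.mk R _ M _ _ h))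
    else 0

open NumberField
open scoped nonZeroDivisors TensorProduct

noncomputable section

variable (F : Type) [Field F] [NumberField F]

/-- The étale ℝ-algebra F_ℝ = F ⊗_ℚ ℝ. -/
abbrev FReal := ℝ ⊗[ℚ] F

/-- The canonical (finite-dimensional real vector space) topology on F_ℝ. -/
instance : TopologicalSpace (FReal F) :=
  TopologicalSpace.induced (Module.finBasis ℝ (FReal F)).equivFun inferInstance

/-- The group of fractional ideals of F. -/
abbrev IdealGroup := (FractionalIdeal (𝓞 F)⁰ F)ˣ

/-- The group of fractional ideals carries the discrete topology. -/
instance : TopologicalSpace (IdealGroup F) := ⊥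

/-- The ideal norm, as a group homomorphism to ℝˣ. -/
def idealNormHom : IdealGroup F →* ℝˣ :=
  (Units.map (Rat.castHom ℝ).toMonoidHom).comp
    (Units.map (FractionalIdeal.absNorm (R := 𝓞 F) (K := F)).toMonoidHom)

/-- The absolute value of the algebra norm on F_ℝˣ, as a group homomorphism to ℝˣ. -/
def absNormFR : (FReal F)ˣ →* ℝˣ :=
  (Units.map (absHom (α := ℝ)).toMonoidHom).comp (Units.map (Algebra.norm ℝ (S := FReal F)))

/-- The fibre product Id_F ×_{ℝ>0} F_ℝˣ, i.e. the subgroup of pairs (I, b) with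
N(I) = |Nm(b)|, formalized as the kernel of the quotient of the two norm maps. -/
def picDom : Subgroup (IdealGroup F × (FReal F)ˣ) :=
  MonoidHom.ker (((idealNormHom F).comp (MonoidHom.fst _ _)) /
    ((absNormFR F).comp (MonoidHom.snd _ _)))

/-- The map F^× → Id_F ×_{ℝ>0} F_ℝˣ, α ↦ (αO_F, α ⊗ 1). -/
def principalHom : Fˣ →* IdealGroup F × (FReal F)ˣ :=
  (toPrincipalIdeal (𝓞 F) F).prod
    (Units.map (Algebra.TensorProduct.includeRight : F →ₐ[ℚ] FReal F).toMonoidHom)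

/-- The subgroup of the fibre product coming from principal oriented Arakelov divisors. -/
def principalSub : Subgroup (picDom F) :=
  Subgroup.comap (picDom F).subtype (MonoidHom.range (principalHom F))

/-- The oriented Arakelov class group of F: the cokernel of F^× → Id_F ×_{ℝ>0} F_ℝˣ. -/
def PicTilde := picDom F ⧸ principalSub F

instance : CommGroup (PicTilde F) := QuotientGroup.Quotient.commGroup _
instance : TopologicalSpace (PicTilde F) := instTopologicalSpaceQuotient

/-- The class of an oriented Arakelov divisor in the oriented Arakelov class group. -/
def PicTilde.mk : picDom F → PicTilde F := QuotientGroup.mk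

/-- The maximal compact subgroup comp(F_ℝˣ) of F_ℝˣ: the subgroup generated by all
compact subgroups. -/
def maxCompact : Subgroup (FReal F)ˣ :=
  sSup { H : Subgroup (FReal F)ˣ | IsCompact (H : Set (FReal F)ˣ) }

/-- The image of {1} × comp(F_ℝˣ) in the oriented Arakelov class group. -/
def compImage : Subgroup (PicTilde F) :=
  Subgroup.map (QuotientGroup.mk' (principalSub F))
    (Subgroup.comap (picDom F).subtype ((⊥ : Subgroup (IdealGroup F)).prod (maxCompact F)))

/-- The Arakelov class group of F: the quotient of the oriented Arakelov class group by
the image of {1} × comp(F_ℝˣ). -/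
def PicZero := PicTilde F ⧸ compImage F

instance : CommGroup (PicZero F) := QuotientGroup.Quotient.commGroup _
instance : TopologicalSpace (PicZero F) := instTopologicalSpaceQuotient

/-- The class of an oriented Arakelov divisor in the Arakelov class group. -/
def PicZero.mk : picDom F → PicZero F := fun x => QuotientGroup.mk (PicTilde.mk F x)

/-- ℝ/ℤ. -/
abbrev RmodZ := AddCircle (1 : ℝ)

/-- The Pontryagin dual Ãr_F of the oriented Arakelov class group: the group of
continuous homomorphisms to ℝ/ℤ. -/
def ArTilde := ContinuousAddMonoidHom (Additive (PicTilde F)) RmodZ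

instance : AddCommGroup (ArTilde F) := by unfold ArTilde; infer_instance
instance : FunLike (ArTilde F) (Additive (PicTilde F)) RmodZ := by unfold ArTilde; infer_instance

/-- The Pontryagin dual Ar_F of the Arakelov class group. -/
def ArF := ContinuousAddMonoidHom (Additive (PicZero F)) RmodZ

instance : AddCommGroup (ArF F) := by unfold ArF; infer_instance
instance : FunLike (ArF F) (Additive (PicZero F)) RmodZ := by unfold ArF; infer_instance

/-- ℚ/ℤ as a ℤ-module. -/
abbrev QmodZ := ℚ ⧸ (Submodule.span ℤ {(1 : ℚ)})

variable {F} in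
/-- The automorphism of F_ℝ = ℝ ⊗_ℚ F induced by an automorphism of F over a subfield K. -/
def galFReal (K : Type) [Field K] [CharZero K] [Algebra K F] (g : F ≃ₐ[K] F) : FReal F ≃ₐ[ℚ] FReal F :=
  Algebra.TensorProduct.congr AlgEquiv.refl (g.restrictScalars ℚ)

end

section

namespace GRep

variable {G : Type} [Group G]

/-- The `ℤ[G]`-module attached to an action of `G` on an abelian group. -/
@[reducible]
noncomputable def toModule {A : Type} [AddCommGroup A] (ρ : G →* AddMonoid.End A) :
    Module (MonoidAlgebra ℤ G) A :=
  Module.compHom A (MonoidAlgebra.lift ℤ (AddMonoid.End A) G ρ).toRingHom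

theorem toModule_single_smul {A : Type} [AddCommGroup A] (ρ : G →* AddMonoid.End A)
    (g : G) (x : A) :
    letI := toModule ρ
    (MonoidAlgebra.single g (1 : ℤ) : MonoidAlgebra ℤ G) • x = ρ g x := by
  letI := toModule ρ
  change (MonoidAlgebra.lift ℤ (AddMonoid.End A) G ρ) (MonoidAlgebra.single g (1 : ℤ)) • x = ρ g x
  rw [MonoidAlgebra.lift_single, one_smul]
  rfl

/-- An additive map commuting with the action of group elements is `ℤ[G]`-linear. -/
def toLinearMap {A B : Type} [AddCommGroup A] [AddCommGroup B] [Module (MonoidAlgebra ℤ G) A]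
    [Module (MonoidAlgebra ℤ G) B] (f : A →+ B)
    (h : ∀ (g : G) (x : A), f ((MonoidAlgebra.single g (1 : ℤ) : MonoidAlgebra ℤ G) • x) =
      (MonoidAlgebra.single g (1 : ℤ) : MonoidAlgebra ℤ G) • f x) :
    A →ₗ[MonoidAlgebra ℤ G] B where
  toFun := f
  map_add' := map_add f
  map_smul' r x := by
    change f (r • x) = r • f x
    induction r using MonoidAlgebra.induction_linear with
    | zero => simp
    | add a b ha hb => rw [add_smul, add_smul, map_add, ha, hb]
    | single g n =>
      have : (MonoidAlgebra.single g n : MonoidAlgebra ℤ G) =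
          n • MonoidAlgebra.single g (1 : ℤ) := by
        rw [MonoidAlgebra.smul_single, smul_eq_mul, mul_one]
      rw [this, smul_assoc, smul_assoc, map_zsmul, h]

/-- The class in `G₀(ℤ[G])` of an abelian group with an action of `G`. -/
noncomputable def cls {A : Type} [AddCommGroup A] (ρ : G →* AddMonoid.End A) :
    G0 (MonoidAlgebra ℤ G) :=
  letI := toModule ρ
  G0.cls (MonoidAlgebra ℤ G) A

theorem finite_of_int (A : Type) [AddCommGroup A] [Module (MonoidAlgebra ℤ G) A]
    [Module.Finite ℤ A] : Module.Finite (MonoidAlgebra ℤ G) A :=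
  Module.Finite.of_restrictScalars_finite ℤ _ _

theorem module_ext {A : Type} [AddCommGroup A] (m₁ m₂ : Module (MonoidAlgebra ℤ G) A)
    (h : ∀ (g : G) (x : A),
      (letI := m₁; (MonoidAlgebra.single g (1 : ℤ) : MonoidAlgebra ℤ G) • x) =
      (letI := m₂; (MonoidAlgebra.single g (1 : ℤ) : MonoidAlgebra ℤ G) • x)) : m₁ = m₂ := by
  refine Module.ext' _ _ fun r x => ?_
  exact @LinearMap.map_smul' _ _ _ _ _ _ _ _ _ m₁ m₂ (@toLinearMap G _ A A _ _ m₁ m₂ (AddMonoidHom.id A) h) r x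

theorem cls_eq {A : Type} [AddCommGroup A] [m : Module (MonoidAlgebra ℤ G) A]
    (ρ : G →* AddMonoid.End A)
    (h : ∀ (g : G) (x : A),
      (MonoidAlgebra.single g (1 : ℤ) : MonoidAlgebra ℤ G) • x = ρ g x) :
    G0.cls (MonoidAlgebra ℤ G) A = cls ρ := by
  have : m = toModule ρ := module_ext _ _ fun g x => (h g x).trans (toModule_single_smul ρ g x).symm
  subst this
  rfl

/-- The action of `G` underlying a `ℤ[G]`-module. -/
noncomputable def ofModule (A : Type) [AddCommGroup A] [Module (MonoidAlgebra ℤ G) A] :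
    G →* AddMonoid.End A where
  toFun g := DistribSMul.toAddMonoidHom A (MonoidAlgebra.single g (1 : ℤ) : MonoidAlgebra ℤ G)
  map_one' := by
    ext x
    exact one_smul (MonoidAlgebra ℤ G) x
  map_mul' g h := by
    ext x
    change (MonoidAlgebra.single (g * h) (1 : ℤ) : MonoidAlgebra ℤ G) • x =
      (MonoidAlgebra.single g (1 : ℤ) : MonoidAlgebra ℤ G) •
        (MonoidAlgebra.single h (1 : ℤ) : MonoidAlgebra ℤ G) • x
    rw [smul_smul, MonoidAlgebra.single_mul_single, one_mul]

theorem cls_ofModule (A : Type) [AddCommGroup A] [Module (MonoidAlgebra ℤ G) A] :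
    cls (ofModule (G := G) A) = G0.cls (MonoidAlgebra ℤ G) A :=
  (cls_eq _ fun _ _ => rfl).symm

/-- The quotient map onto the Grothendieck group. -/
noncomputable def G0mk (R : Type) [Ring R] : FreeAbelianGroup (FGMod R) →+ G0 R :=
  QuotientAddGroup.mk' (G0Rel R)

theorem G0_cls_of_finite (R : Type) [Ring R] (M : Type) [AddCommGroup M] [Module R M]
    [h : Module.Finite R M] :
    G0.cls R M = G0mk R (FreeAbelianGroup.of (FGMod.mk (R := R) M)) :=
  dif_pos h

theorem G0_cls_exact {R : Type} [Ring R] {L M N : Type} [AddCommGroup L] [AddCommGroup M]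
    [AddCommGroup N] [Module R L] [Module R M] [Module R N] [Module.Finite R L]
    [Module.Finite R M] [Module.Finite R N] (f : L →ₗ[R] M) (g : M →ₗ[R] N)
    (hf : Function.Injective f) (hg : Function.Surjective g) (h : Function.Exact f g) :
    G0.cls R M = G0.cls R L + G0.cls R N := by
  have hM : Module.Finite R M := inferInstance
  have hL : Module.Finite R L := inferInstance
  have hN : Module.Finite R N := inferInstance
  rw [G0_cls_of_finite R M, G0_cls_of_finite R L, G0_cls_of_finite R N, ← sub_eq_zero, ← sub_sub,
    ← map_sub, ← map_sub]
  have : (FreeAbelianGroup.of (FGMod.mk (R := R) M) - FreeAbelianGroup.of (FGMod.mk (R := R) L) -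
      FreeAbelianGroup.of (FGMod.mk (R := R) N)) ∈ G0Rel R :=
    AddSubgroup.subset_closure ⟨⟨L⟩, ⟨M⟩, ⟨N⟩, f, g, hf, hg, h, rfl⟩
  exact (QuotientAddGroup.eq_zero_iff _).2 this

/-- Additivity of classes in short exact sequences. -/
theorem cls_exact {L M N : Type} [AddCommGroup L] [AddCommGroup M] [AddCommGroup N]
    [Module.Finite ℤ L] [Module.Finite ℤ M] [Module.Finite ℤ N]
    (ρL : G →* AddMonoid.End L) (ρM : G →* AddMonoid.End M) (ρN : G →* AddMonoid.End N)
    (f : L →+ M) (g : M →+ N)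
    (hf : Function.Injective f) (hg : Function.Surjective g) (h : Function.Exact f g)
    (ef : ∀ s x, f (ρL s x) = ρM s (f x)) (eg : ∀ s x, g (ρM s x) = ρN s (g x)) :
    cls ρM = cls ρL + cls ρN := by
  letI := toModule ρL
  letI := toModule ρM
  letI := toModule ρN
  haveI := finite_of_int (G := G) L
  haveI := finite_of_int (G := G) M
  haveI := finite_of_int (G := G) N
  exact G0_cls_exact
    (toLinearMap f fun s x => by rw [toModule_single_smul, toModule_single_smul, ef])
    (toLinearMap g fun s x => by rw [toModule_single_smul, toModule_single_smul, eg]) hf hg h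

theorem cls_subsingleton {A : Type} [AddCommGroup A] [Subsingleton A]
    (ρ : G →* AddMonoid.End A) : cls ρ = 0 := by
  haveI : Module.Finite ℤ A := Module.Finite.of_finite
  have := cls_exact ρ ρ ρ (AddMonoidHom.id A) (AddMonoidHom.id A) (fun _ _ h => h)
    (fun x => ⟨x, rfl⟩) (fun x => ⟨fun _ => ⟨0, Subsingleton.elim _ _⟩,
      fun _ => Subsingleton.elim _ _⟩) (fun _ _ => rfl) (fun _ _ => rfl)
  simpa using this

theorem cls_congr {A B : Type} [AddCommGroup A] [AddCommGroup B] [Module.Finite ℤ A]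
    (ρA : G →* AddMonoid.End A) (ρB : G →* AddMonoid.End B) (f : A →+ B)
    (hf : Function.Bijective f) (ef : ∀ s x, f (ρA s x) = ρB s (f x)) : cls ρA = cls ρB := by
  haveI : Module.Finite ℤ B := Module.Finite.of_surjective f.toIntLinearMap hf.2
  have := cls_exact (L := PUnit) 1 ρA ρB (0 : PUnit →+ A) f (fun _ _ _ => rfl) hf.2
    (fun x => ⟨fun h => ⟨0, by simpa using (hf.1 (h.trans (map_zero f).symm)).symm⟩, by
      rintro ⟨y, rfl⟩; simp⟩) (fun s x => by simp) ef
  rw [this, cls_subsingleton, zero_add]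

/-- The restriction of an action to a stable subgroup. -/
def restrict {A : Type} [AddCommGroup A] (ρ : G →* AddMonoid.End A) (B : AddSubgroup A)
    (hB : ∀ g, ∀ x ∈ B, ρ g x ∈ B) : G →* AddMonoid.End B where
  toFun g := (((ρ g : A →+ A).comp B.subtype).codRestrict B fun x => hB g x x.2 : B →+ B)
  map_one' := by
    ext x
    change (ρ 1) (x : A) = x
    rw [map_one]; rfl
  map_mul' g h := by
    ext x
    change (ρ (g * h)) (x : A) = ρ g (ρ h x)
    rw [map_mul]; rfl

/-- The action induced on the quotient by a stable subgroup. -/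
def quotient {A : Type} [AddCommGroup A] (ρ : G →* AddMonoid.End A) (B : AddSubgroup A)
    (hB : ∀ g, ∀ x ∈ B, ρ g x ∈ B) : G →* AddMonoid.End (A ⧸ B) where
  toFun g := QuotientAddGroup.map B B (ρ g) (fun x hx => hB g x hx)
  map_one' := by
    refine AddMonoidHom.ext fun y => QuotientAddGroup.induction_on y fun x => ?_
    change ((ρ 1 x : A) : A ⧸ B) = x
    rw [map_one]; rfl
  map_mul' g h := by
    refine AddMonoidHom.ext fun y => QuotientAddGroup.induction_on y fun x => ?_
    change ((ρ (g * h) x : A) : A ⧸ B) = ((ρ g (ρ h x) : A) : A ⧸ B)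
    rw [map_mul]; rfl

/-- The contragredient action on homomorphisms to a fixed abelian group. -/
def dual {A : Type} [AddCommGroup A] (ρ : G →* AddMonoid.End A) (T : Type) [AddCommGroup T] :
    G →* AddMonoid.End (A →+ T) where
  toFun g := (AddMonoidHom.compHom' (ρ g⁻¹ : A →+ A) : (A →+ T) →+ (A →+ T))
  map_one' := by
    ext φ x
    change φ (ρ 1⁻¹ x) = φ x
    rw [inv_one, map_one]; rfl
  map_mul' g h := by
    ext φ x
    change φ (ρ (g * h)⁻¹ x) = φ (ρ h⁻¹ (ρ g⁻¹ x))
    rw [mul_inv_rev, map_mul]; rfl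

@[simp]
theorem dual_apply {A : Type} [AddCommGroup A] (ρ : G →* AddMonoid.End A) (T : Type)
    [AddCommGroup T] (g : G) (φ : A →+ T) (x : A) : dual ρ T g φ x = φ (ρ g⁻¹ x) := rfl

theorem finite_of_exact {L M N : Type} [AddCommGroup L] [AddCommGroup M] [AddCommGroup N]
    [Module.Finite ℤ L] [Module.Finite ℤ N] (f : L →+ M) (g : M →+ N)
    (h : ∀ x, g x = 0 → ∃ y, f y = x) : Module.Finite ℤ M := by
  have h1 : Module.Finite ℤ (LinearMap.range g.toIntLinearMap) := inferInstance
  have h3 : Module.Finite ℤ (LinearMap.ker g.toIntLinearMap) := by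
    have h2 : LinearMap.ker g.toIntLinearMap ≤ LinearMap.range f.toIntLinearMap := by
      intro x hx
      exact h x hx
    exact Module.Finite.of_injective (Submodule.inclusion h2) (Submodule.inclusion_injective h2)
  have h4 : Module.Finite ℤ (M ⧸ LinearMap.ker g.toIntLinearMap) :=
    Module.Finite.equiv (LinearMap.quotKerEquivRange g.toIntLinearMap).symm
  exact Module.Finite.of_submodule_quotient (LinearMap.ker g.toIntLinearMap)

/-- In a four-term exact sequence `0 → A → B → C → D → 0` one has `[A] - [B] + [C] - [D] = 0`. -/
theorem cls_exact_four {A B C D : Type} [AddCommGroup A] [AddCommGroup B] [AddCommGroup C]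
    [AddCommGroup D] [Module.Finite ℤ A] [Module.Finite ℤ B] [Module.Finite ℤ C]
    [Module.Finite ℤ D]
    (ρA : G →* AddMonoid.End A) (ρB : G →* AddMonoid.End B) (ρC : G →* AddMonoid.End C)
    (ρD : G →* AddMonoid.End D) (f : A →+ B) (g : B →+ C) (k : C →+ D)
    (hf : Function.Injective f) (hk : Function.Surjective k) (h : Function.Exact f g)
    (h' : Function.Exact g k)
    (ef : ∀ s x, f (ρA s x) = ρB s (f x)) (eg : ∀ s x, g (ρB s x) = ρC s (g x))
    (ek : ∀ s x, k (ρC s x) = ρD s (k x)) :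
    cls ρA + cls ρC = cls ρB + cls ρD := by
  have hst : ∀ s, ∀ x ∈ g.range, ρC s x ∈ g.range := by
    rintro s _ ⟨y, rfl⟩
    exact ⟨ρB s y, eg s y⟩
  haveI : Module.Finite ℤ g.range :=
    Module.Finite.of_surjective g.rangeRestrict.toIntLinearMap g.rangeRestrict_surjective
  have h1 := cls_exact ρA ρB (restrict ρC g.range hst) f g.rangeRestrict hf
    g.rangeRestrict_surjective (fun x => by rw [← h x, Subtype.ext_iff]; rfl) ef
    (fun s x => Subtype.ext (eg s x))
  have h2 := cls_exact (restrict ρC g.range hst) ρC ρD g.range.subtype k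
    Subtype.coe_injective hk (fun x => by rw [h' x]; simp) (fun s x => rfl) ek
  rw [h1, h2, add_assoc]

/-- The permutation action of `G` on finitely supported integral functions on a `G`-set. -/
noncomputable def perm (T : Type) [MulAction G T] : G →* AddMonoid.End (T →₀ ℤ) where
  toFun g := (Finsupp.mapDomain.addMonoidHom (g • · : T → T) : (T →₀ ℤ) →+ (T →₀ ℤ))
  map_one' := by
    refine AddMonoidHom.ext fun x => ?_
    change Finsupp.mapDomain ((1 : G) • · : T → T) x = x
    simp only [one_smul]
    exact Finsupp.mapDomain_id
  map_mul' g h := by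
    refine AddMonoidHom.ext fun x => ?_
    change Finsupp.mapDomain ((g * h) • · : T → T) x =
      Finsupp.mapDomain (g • ·) (Finsupp.mapDomain (h • ·) x)
    rw [← Finsupp.mapDomain_comp]
    congr 1
    ext t
    exact mul_smul g h t

theorem perm_apply {T : Type} [MulAction G T] (g : G) (x : T →₀ ℤ) :
    perm T g x = Finsupp.mapDomain (g • ·) x := rfl

theorem perm_apply_apply {T : Type} [MulAction G T] (g : G) (x : T →₀ ℤ) (t : T) :
    perm T g x t = x (g⁻¹ • t) := by
  have := Finsupp.mapDomain_apply (MulAction.injective g) x (g⁻¹ • t)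
  rwa [smul_inv_smul] at this

end GRep

end

section

namespace GRep

variable {G : Type} [Group G]

/-- The contragredient action on `ℤ`-linear maps. -/
def dualLinear {A : Type} [AddCommGroup A] (ρ : G →* AddMonoid.End A) (T : Type) [AddCommGroup T]
    [Module ℤ T] : G →* AddMonoid.End (A →ₗ[ℤ] T) where
  toFun g := (AddMonoidHom.mk' (fun φ => φ.comp (AddMonoidHom.toIntLinearMap (ρ g⁻¹ : A →+ A)))
    fun _ _ => rfl : (A →ₗ[ℤ] T) →+ (A →ₗ[ℤ] T))
  map_one' := by
    refine AddMonoidHom.ext fun φ => LinearMap.ext fun x => ?_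
    change φ (ρ 1⁻¹ x) = φ x
    rw [inv_one, map_one]; rfl
  map_mul' g h := by
    refine AddMonoidHom.ext fun φ => LinearMap.ext fun x => ?_
    change φ (ρ (g * h)⁻¹ x) = φ (ρ h⁻¹ (ρ g⁻¹ x))
    rw [mul_inv_rev, map_mul]; rfl

theorem dualLinear_apply {A : Type} [AddCommGroup A] (ρ : G →* AddMonoid.End A) (T : Type)
    [AddCommGroup T] [Module ℤ T] (g : G) (φ : A →ₗ[ℤ] T) (x : A) :
    dualLinear ρ T g φ x = φ (ρ g⁻¹ x) := rfl

theorem map_cls_of_free (σ : G0 (MonoidAlgebra ℤ G) →+ G0 (MonoidAlgebra ℤ G))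
    (hσlat : ∀ (M : Type) [AddCommGroup M] [Module (MonoidAlgebra ℤ G) M]
        [Module.Finite (MonoidAlgebra ℤ G) M] [Module.Projective ℤ M]
        [Module (MonoidAlgebra ℤ G) (M →ₗ[ℤ] ℤ)],
      (∀ (g : G) (φ : M →ₗ[ℤ] ℤ) (x : M),
        ((MonoidAlgebra.single g (1 : ℤ) : MonoidAlgebra ℤ G) • φ) x =
          φ ((MonoidAlgebra.single g⁻¹ (1 : ℤ) : MonoidAlgebra ℤ G) • x)) →
      σ (G0.cls (MonoidAlgebra ℤ G) M) = G0.cls (MonoidAlgebra ℤ G) (M →ₗ[ℤ] ℤ))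
    {A : Type} [AddCommGroup A] [Module.Finite ℤ A] [Module.Free ℤ A]
    (ρ : G →* AddMonoid.End A) : σ (cls ρ) = cls (dual ρ ℤ) := by
  let m := toModule ρ
  let m' := toModule (dualLinear ρ ℤ)
  have := finite_of_int (G := G) A
  have h1 : cls (dualLinear ρ ℤ) = cls (dual ρ ℤ) := by
    refine cls_congr _ _ (AddMonoidHom.mk' (fun φ : A →ₗ[ℤ] ℤ => φ.toAddMonoidHom)
      fun _ _ => rfl) ⟨fun φ ψ h => ?_, fun φ => ⟨φ.toIntLinearMap, rfl⟩⟩ fun s x => rfl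
    ext x
    exact DFunLike.congr_fun h x
  rw [← h1]
  refine hσlat A fun g φ x => ?_
  rw [toModule_single_smul, toModule_single_smul, dualLinear_apply]

/-- The embedding of `ℚ/ℤ` into `ℝ/ℤ`. -/
noncomputable def ratCircle : QmodZ →ₗ[ℤ] RmodZ :=
  Submodule.liftQ _ (((QuotientAddGroup.mk' (AddSubgroup.zmultiples (1 : ℝ))).comp
    (Rat.castHom ℝ).toAddMonoidHom).toIntLinearMap : ℚ →ₗ[ℤ] RmodZ) (by
      rw [Submodule.span_singleton_le_iff_mem, LinearMap.mem_ker]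
      change (((1 : ℚ) : ℝ) : RmodZ) = 0
      rw [Rat.cast_one]
      exact AddCircle.coe_period 1)

theorem ratCircle_mk (q : ℚ) : ratCircle (Submodule.Quotient.mk q) = ((q : ℝ) : RmodZ) := rfl

theorem ratCircle_injective : Function.Injective ratCircle := by
  rw [injective_iff_map_eq_zero]
  intro x hx
  obtain ⟨q, rfl⟩ := Submodule.Quotient.mk_surjective _ x
  rw [ratCircle_mk, AddCircle.coe_eq_zero_iff] at hx
  obtain ⟨n, hn⟩ := hx
  rw [Submodule.Quotient.mk_eq_zero, Submodule.mem_span_singleton]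
  refine ⟨n, ?_⟩
  have : ((n • (1 : ℚ) : ℚ) : ℝ) = (q : ℝ) := by
    rw [← hn]; push_cast [zsmul_eq_mul]; ring
  exact_mod_cast this

theorem exists_ratCircle_eq {x : RmodZ} {n : ℕ} (hn : n ≠ 0) (hx : n • x = 0) :
    ∃ y, ratCircle y = x := by
  obtain ⟨r, rfl⟩ := QuotientAddGroup.mk_surjective x
  have h1 : ((n • r : ℝ) : RmodZ) = 0 := hx
  rw [AddCircle.coe_eq_zero_iff] at h1
  obtain ⟨m, hm⟩ := h1
  refine ⟨Submodule.Quotient.mk ((m : ℚ) / n), ?_⟩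
  rw [ratCircle_mk]
  have : ((((m : ℚ) / n : ℚ)) : ℝ) = r := by
    have hn' : (n : ℝ) ≠ 0 := by exact_mod_cast hn
    push_cast
    rw [div_eq_iff hn']
    simp only [zsmul_eq_mul, mul_one, nsmul_eq_mul] at hm
    rw [hm, mul_comm]
  rw [this]

theorem finite_hom_circle (A : Type) [AddCommGroup A] [Finite A] : Finite (A →+ RmodZ) := by
  have hn : 0 < Nat.card A := Nat.card_pos
  have hfin : Finite {x : RmodZ // (Nat.card A) • x = 0} := by
    have := (AddCircle.finite_torsion (p := (1 : ℝ)) hn)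
    exact this.to_subtype
  refine Finite.of_injective (fun (φ : A →+ RmodZ) (a : A) =>
    (⟨φ a, by rw [← map_nsmul, card_nsmul_eq_zero', map_zero]⟩ :
      {x : RmodZ // (Nat.card A) • x = 0})) fun φ ψ h => ?_
  ext a
  exact congrArg Subtype.val (congrFun h a)

theorem map_cls_of_finite (σ : G0 (MonoidAlgebra ℤ G) →+ G0 (MonoidAlgebra ℤ G))
    (hσtor : ∀ (N : Type) [AddCommGroup N] [Module (MonoidAlgebra ℤ G) N]
        [Module (MonoidAlgebra ℤ G) (N →ₗ[ℤ] QmodZ)], Finite N →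
      (∀ (g : G) (φ : N →ₗ[ℤ] QmodZ) (x : N),
        ((MonoidAlgebra.single g (1 : ℤ) : MonoidAlgebra ℤ G) • φ) x =
          φ ((MonoidAlgebra.single g⁻¹ (1 : ℤ) : MonoidAlgebra ℤ G) • x)) →
      σ (G0.cls (MonoidAlgebra ℤ G) N) = - G0.cls (MonoidAlgebra ℤ G) (N →ₗ[ℤ] QmodZ))
    {A : Type} [AddCommGroup A] [Finite A]
    (ρ : G →* AddMonoid.End A) : σ (cls ρ) = - cls (dual ρ RmodZ) := by
  let m := toModule ρ
  let m' := toModule (dualLinear ρ QmodZ)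
  let F : (A →ₗ[ℤ] QmodZ) →+ (A →+ RmodZ) :=
    AddMonoidHom.mk' (fun φ => (ratCircle ∘ₗ φ).toAddMonoidHom) fun φ ψ => by
      ext x
      exact map_add ratCircle _ _
  have hF : Function.Bijective F := by
    refine ⟨fun φ ψ h => ?_, fun φ => ?_⟩
    · ext x
      exact ratCircle_injective (DFunLike.congr_fun h x)
    · have hx : ∀ x, ∃ y, ratCircle y = φ x := fun x =>
        exists_ratCircle_eq (n := Nat.card A) Nat.card_pos.ne'
          (by rw [← map_nsmul, card_nsmul_eq_zero', map_zero])
      choose y hy using hx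
      refine ⟨(AddMonoidHom.mk' y fun a b => ratCircle_injective ?_).toIntLinearMap, ?_⟩
      · rw [map_add, hy, hy, hy, map_add]
      · ext x
        exact hy x
  have hfin := finite_hom_circle A
  have hfin' : Finite (A →ₗ[ℤ] QmodZ) := Finite.of_injective F hF.1
  have h1 : cls (dualLinear ρ QmodZ) = cls (dual ρ RmodZ) :=
    cls_congr _ _ F hF fun s x => rfl
  rw [← h1]
  refine hσtor A inferInstance fun g φ x => ?_
  rw [toModule_single_smul, toModule_single_smul, dualLinear_apply]

theorem cls_dual_perm (T : Type) [Finite T] [MulAction G T] :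
    cls (dual (perm (G := G) T) ℤ) = cls (perm (G := G) T) := by
  classical
  let e : (T →₀ ℤ) →+ ((T →₀ ℤ) →+ ℤ) := AddMonoidHom.mk'
    (fun x => Finsupp.liftAddHom fun t => AddMonoidHom.mulLeft (x t)) fun x y => by
      ext t
      simp
  have he : ∀ x t, e x (Finsupp.single t 1) = x t := fun x t => by
    change Finsupp.liftAddHom _ _ = _
    simp
  refine (cls_congr _ _ e ⟨fun x y h => ?_, fun φ => ?_⟩ fun s x => ?_).symm
  · ext t
    rw [← he, ← he, h]
  · refine ⟨Finsupp.equivFunOnFinite.symm fun t => φ (Finsupp.single t 1), ?_⟩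
    refine Finsupp.addHom_ext' fun t => AddMonoidHom.ext_int ?_
    change e _ (Finsupp.single t 1) = φ (Finsupp.single t 1)
    rw [he]
    rfl
  · refine Finsupp.addHom_ext' fun t => AddMonoidHom.ext_int ?_
    change e _ (Finsupp.single t 1) = dual (perm T) ℤ s (e x) (Finsupp.single t 1)
    rw [he, perm_apply_apply, dual_apply, perm_apply, Finsupp.mapDomain_single, he]

/-- The diagonal action on `n`-tuples. -/
def tuple {A : Type} [AddCommGroup A] (ρ : G →* AddMonoid.End A) (n : ℕ) :
    G →* AddMonoid.End (Fin n → A) where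
  toFun g := ((ρ g : A →+ A).compLeft (Fin n) : (Fin n → A) →+ (Fin n → A))
  map_one' := by
    refine AddMonoidHom.ext fun x => funext fun i => ?_
    change ρ 1 (x i) = x i
    rw [map_one]; rfl
  map_mul' g h := by
    refine AddMonoidHom.ext fun x => funext fun i => ?_
    change ρ (g * h) (x i) = ρ g (ρ h (x i))
    rw [map_mul]; rfl

theorem cls_tuple {A : Type} [AddCommGroup A] [Module.Finite ℤ A] (ρ : G →* AddMonoid.End A)
    (n : ℕ) : cls (tuple ρ n) = n • cls ρ := by
  induction n with
  | zero => rw [zero_smul, cls_subsingleton]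
  | succ n ih =>
    rw [succ_nsmul, ← ih]
    refine cls_exact (tuple ρ n) (tuple ρ (n + 1)) ρ
      (AddMonoidHom.mk' (fun x => (Fin.cons 0 x : Fin (n + 1) → A)) fun x y => ?_)
      (Pi.evalAddMonoidHom (fun _ => A) 0) (fun x y h => ?_) (fun a => ⟨fun _ => a, rfl⟩)
      (fun x => ⟨fun h => ⟨Fin.tail x, ?_⟩, ?_⟩) (fun s x => ?_) (fun s x => rfl)
    · refine funext fun i => ?_
      refine Fin.cases ?_ (fun j => ?_) i
      · simp
      · simp
    · exact (Fin.cons_injective2 (α := fun _ => A) h).2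
    · refine funext fun i => ?_
      refine Fin.cases ?_ (fun j => ?_) i
      · exact h.symm
      · rfl
    · rintro ⟨y, rfl⟩
      rfl
    · refine funext fun i => ?_
      refine Fin.cases ?_ (fun j => ?_) i
      · exact (map_zero (ρ s)).symm
      · rfl

theorem cls_regular [Finite G] :
    G0.cls (MonoidAlgebra ℤ G) (MonoidAlgebra ℤ G) = cls (perm (G := G) G) := by
  rw [← cls_ofModule]
  refine (cls_congr _ _ (MonoidAlgebra.coeffAddEquiv (R := ℤ) (M := G)).symm.toAddMonoidHom
    (MonoidAlgebra.coeffAddEquiv (R := ℤ) (M := G)).symm.bijective fun s x => ?_).symm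
  let e := (MonoidAlgebra.coeffAddEquiv (R := ℤ) (M := G)).symm.toAddMonoidHom
  suffices h : e.comp (perm G s) = (ofModule (MonoidAlgebra ℤ G) s).comp e from
    DFunLike.congr_fun h x
  refine Finsupp.addHom_ext' fun t => AddMonoidHom.ext_int ?_
  change e (perm G s (Finsupp.single t 1)) =
    MonoidAlgebra.single s (1 : ℤ) * MonoidAlgebra.single t (1 : ℤ)
  rw [perm_apply, Finsupp.mapDomain_single, MonoidAlgebra.single_mul_single, one_mul]
  rfl

/-- A free `G`-set with `n` orbits gives `n` copies of the regular module. -/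
theorem cls_perm_of_equiv [Finite G] {T : Type} [Finite T] [MulAction G T] {n : ℕ}
    (e : Fin n × G ≃ T) (he : ∀ i g h, e (i, g * h) = g • e (i, h)) :
    cls (perm (G := G) T) = n • G0.cls (MonoidAlgebra ℤ G) (MonoidAlgebra ℤ G) := by
  rw [cls_regular, ← cls_tuple]
  refine cls_congr _ _ (AddMonoidHom.mk' (fun x : T →₀ ℤ => fun i =>
    Finsupp.equivFunOnFinite.symm fun g => x (e (i, g))) fun x y => ?_)
    ⟨fun x y h => ?_, fun y => ⟨Finsupp.equivFunOnFinite.symm fun t =>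
      y (e.symm t).1 (e.symm t).2, ?_⟩⟩ fun s x => ?_
  · ext i g; rfl
  · ext t
    obtain ⟨⟨i, g⟩, rfl⟩ := e.surjective t
    exact DFunLike.congr_fun (congrFun h i) g
  · ext i g
    change y (e.symm (e (i, g))).1 (e.symm (e (i, g))).2 = _
    rw [Equiv.symm_apply_apply]
  · ext i g
    change perm T s x (e (i, g)) = perm G s (Finsupp.equivFunOnFinite.symm fun g => x (e (i, g))) g
    rw [perm_apply_apply, perm_apply_apply, smul_eq_mul, ← he]
    rfl

end GRep

end

section

open NumberField ComplexConjugate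
open scoped nonZeroDivisors TensorProduct

namespace ArClass

variable (F : Type) [Field F] [NumberField F]

/-- The map `F_ℝ → ∏_φ ℂ` given by all complex embeddings of `F`. -/
noncomputable def ev : FReal F →ₐ[ℝ] ((F →+* ℂ) → ℂ) :=
  AlgHom.pi fun φ => Algebra.TensorProduct.lift (Algebra.ofId ℝ ℂ) φ.toRatAlgHom
    fun _ _ => Commute.all _ _

variable {F}

@[simp]
theorem ev_tmul (r : ℝ) (x : F) (φ : F →+* ℂ) : ev F (r ⊗ₜ x) φ = r * φ x := rfl

variable (F) in
/-- The real basis of `F_ℝ` given by an integral basis of `F`. -/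
noncomputable def realBasis :
    Module.Basis (Module.Free.ChooseBasisIndex ℤ (𝓞 F)) ℝ (FReal F) :=
  (integralBasis F).baseChange ℝ

theorem ev_realBasis (i : Module.Free.ChooseBasisIndex ℤ (𝓞 F)) :
    ev F (realBasis F i) = canonicalEmbedding.latticeBasis F i := by
  rw [canonicalEmbedding.latticeBasis_apply, realBasis, Module.Basis.baseChange_apply]
  ext φ
  rw [ev_tmul, Complex.ofReal_one, one_mul, canonicalEmbedding.apply_at]

theorem latticeBasis_repr_ev (b : FReal F) (i : Module.Free.ChooseBasisIndex ℤ (𝓞 F)) :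
    (canonicalEmbedding.latticeBasis F).repr (ev F b) i = ((realBasis F).repr b i : ℂ) := by
  have h : ev F b = ∑ i, ((realBasis F).repr b i : ℂ) • canonicalEmbedding.latticeBasis F i := by
    conv_lhs => rw [← (realBasis F).sum_repr b]
    rw [map_sum]
    refine Finset.sum_congr rfl fun j _ => ?_
    rw [map_smul, ev_realBasis]
    ext φ
    simp
  rw [h, Module.Basis.repr_sum_self]

theorem ev_injective : Function.Injective (ev F) := fun a b h => by
  refine (realBasis F).repr.injective (Finsupp.ext fun i => ?_)
  have := latticeBasis_repr_ev a i
  rw [h, latticeBasis_repr_ev] at this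
  exact_mod_cast this.symm

theorem ev_conjugate (b : FReal F) (φ : F →+* ℂ) :
    ev F b (ComplexEmbedding.conjugate φ) = conj (ev F b φ) := by
  induction b using TensorProduct.induction_on with
  | zero => simp
  | tmul r x => simp [ComplexEmbedding.conjugate_coe_eq]
  | add a b ha hb => simp [ha, hb]

theorem exists_ev_eq (w : (F →+* ℂ) → ℂ)
    (hw : ∀ φ, w (ComplexEmbedding.conjugate φ) = conj (w φ)) : ∃ b, ev F b = w := by
  set L := canonicalEmbedding.latticeBasis F
  have key : ∀ i, conj (L.repr w i) = L.repr w i := by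
    have h1 : w = ∑ i, conj (L.repr w i) • L i := by
      ext φ
      have h2 : w (ComplexEmbedding.conjugate φ) =
          (∑ i, L.repr w i • L i) (ComplexEmbedding.conjugate φ) := by rw [L.sum_repr]
      rw [hw] at h2
      apply (starRingEnd ℂ).injective
      rw [h2]
      simp only [Finset.sum_apply, Pi.smul_apply, smul_eq_mul, map_sum, map_mul, Complex.conj_conj]
      refine Finset.sum_congr rfl fun i _ => ?_
      rw [← ev_realBasis, ev_conjugate]
    intro i
    conv_rhs => rw [h1]
    rw [L.repr_sum_self]
  refine ⟨∑ i, (L.repr w i).re • realBasis F i, ?_⟩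
  rw [map_sum]
  conv_rhs => rw [← L.sum_repr w]
  refine Finset.sum_congr rfl fun i _ => ?_
  rw [map_smul, ev_realBasis]
  ext φ
  have := Complex.conj_eq_iff_re.1 (key i)
  rw [Pi.smul_apply, Pi.smul_apply, Complex.real_smul, this, smul_eq_mul]

theorem norm_pi {ι : Type} [Fintype ι] [DecidableEq ι] (w : ι → ℂ) :
    Algebra.norm ℂ w = ∏ i, w i := by
  rw [Algebra.norm_eq_matrix_det (Pi.basisFun ℂ ι)]
  have : Algebra.leftMulMatrix (Pi.basisFun ℂ ι) w = Matrix.diagonal w := by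
    ext i j
    rw [Algebra.leftMulMatrix_eq_repr_mul, Pi.basisFun_repr, Pi.basisFun_apply, Pi.mul_apply,
      Matrix.diagonal_apply, Pi.single_apply]
    simp
  rw [this, Matrix.det_diagonal]

theorem ofReal_norm (b : FReal F) : (Algebra.norm ℝ b : ℂ) = ∏ φ, ev F b φ := by
  classical
  rw [← norm_pi, Algebra.norm_eq_matrix_det (canonicalEmbedding.latticeBasis F),
    Algebra.norm_eq_matrix_det (realBasis F), ← Complex.ofRealHom_eq_coe, RingHom.map_det]
  congr 1
  ext i j
  rw [RingHom.mapMatrix_apply, Matrix.map_apply, Algebra.leftMulMatrix_eq_repr_mul,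
    Algebra.leftMulMatrix_eq_repr_mul, ← ev_realBasis, ← map_mul, latticeBasis_repr_ev]
  rfl

theorem ev_galFReal {K : Type} [Field K] [CharZero K] [Algebra K F] (g : F ≃ₐ[K] F) (b : FReal F)
    (φ : F →+* ℂ) : ev F (galFReal K g b) φ = ev F b (φ.comp (g : F →+* F)) := by
  induction b using TensorProduct.induction_on with
  | zero => simp
  | tmul r x => rfl
  | add a b ha hb => simp [ha, hb]

theorem isUnit_of_ev {b : FReal F} (h : ∀ φ, ev F b φ ≠ 0) : IsUnit b := by
  obtain ⟨c, hc⟩ := exists_ev_eq (F := F) (fun φ => (ev F b φ)⁻¹)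
    (fun φ => by rw [ev_conjugate, map_inv₀])
  refine IsUnit.of_mul_eq_one c (ev_injective ?_)
  rw [map_mul, hc, map_one]
  ext φ
  exact mul_inv_cancel₀ (h φ)

theorem ev_unit_ne_zero (b : (FReal F)ˣ) (φ : F →+* ℂ) : ev F (b : FReal F) φ ≠ 0 := by
  have h : IsUnit (ev F (b : FReal F)) := b.isUnit.map (ev F)
  exact (Pi.isUnit_iff.1 h φ).ne_zero

/-- The unit of `F_ℝ` with prescribed non-zero images under the complex embeddings. -/
theorem exists_unit_ev_eq (w : (F →+* ℂ) → ℂ) (h0 : ∀ φ, w φ ≠ 0)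
    (hw : ∀ φ, w (ComplexEmbedding.conjugate φ) = conj (w φ)) :
    ∃ b : (FReal F)ˣ, ev F (b : FReal F) = w := by
  obtain ⟨b, hb⟩ := exists_ev_eq w hw
  obtain ⟨u, rfl⟩ := isUnit_of_ev (b := b) (fun φ => by rw [hb]; exact h0 φ)
  exact ⟨u, hb⟩

theorem unit_ext {a b : (FReal F)ˣ} (h : ∀ φ, ev F (a : FReal F) φ = ev F (b : FReal F) φ) :
    a = b := Units.ext (ev_injective (funext h))

theorem mem_picDom {x : IdealGroup F × (FReal F)ˣ} :
    x ∈ picDom F ↔ (FractionalIdeal.absNorm (x.1 : FractionalIdeal (𝓞 F)⁰ F) : ℝ) =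
      ∏ φ, ‖ev F (x.2 : FReal F) φ‖ := by
  rw [picDom, MonoidHom.mem_ker, MonoidHom.div_apply, div_eq_one, Units.ext_iff]
  have : ((absNormFR F x.2 : ℝˣ) : ℝ) = ∏ φ, ‖ev F (x.2 : FReal F) φ‖ := by
    change |Algebra.norm ℝ (x.2 : FReal F)| = _
    rw [← norm_prod, ← ofReal_norm, Complex.norm_real, Real.norm_eq_abs]
  change ((FractionalIdeal.absNorm (x.1 : FractionalIdeal (𝓞 F)⁰ F) : ℚ) : ℝ) =
    ((absNormFR F x.2 : ℝˣ) : ℝ) ↔ _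
  rw [this]

theorem ev_principalHom (a : Fˣ) (φ : F →+* ℂ) :
    ev F ((principalHom F a).2 : FReal F) φ = φ a := by
  change ev F ((1 : ℝ) ⊗ₜ[ℚ] (a : F)) φ = φ a
  simp

theorem principalHom_mem (a : Fˣ) : principalHom F a ∈ picDom F := by
  rw [mem_picDom]
  simp only [ev_principalHom]
  have : ((principalHom F a).1 : FractionalIdeal (𝓞 F)⁰ F) =
      FractionalIdeal.spanSingleton _ (a : F) := coe_toPrincipalIdeal _
  rw [this, FractionalIdeal.absNorm_span_singleton, ← norm_prod]
  have h : (algebraMap ℚ ℂ (Algebra.norm ℚ (a : F))) = ∏ φ : F →+* ℂ, φ a := by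
    rw [Algebra.norm_eq_prod_embeddings ℚ ℂ]
    exact (Fintype.prod_equiv (RingHom.equivRatAlgHom F ℂ) (fun f => f (a : F))
      (fun φ => φ (a : F)) fun _ => by simp [RingHom.equivRatAlgHom_apply]).symm
  rw [← h, eq_ratCast, Complex.norm_ratCast, Rat.cast_abs]

end ArClass

end

section

open NumberField ComplexConjugate
open scoped nonZeroDivisors TensorProduct

namespace ArClass

variable {F : Type} [Field F] [NumberField F]

theorem continuous_ev : Continuous (ev F) := by
  have h : Continuous (((ev F).toLinearMap.comp
      (Module.finBasis ℝ (FReal F)).equivFun.symm.toLinearMap)) :=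
    LinearMap.continuous_of_finiteDimensional _
  have h2 : (ev F : FReal F → _) = ((ev F).toLinearMap.comp
      (Module.finBasis ℝ (FReal F)).equivFun.symm.toLinearMap) ∘
        (Module.finBasis ℝ (FReal F)).equivFun := by
    ext b
    simp
  rw [h2]
  exact h.comp continuous_induced_dom

theorem isInducing_ev : Topology.IsInducing (ev F) := by
  obtain ⟨r, hr⟩ := LinearMap.exists_leftInverse_of_injective (ev F).toLinearMap
    (LinearMap.ker_eq_bot.2 ev_injective)
  have h : Continuous r := by
    refine continuous_induced_rng.2 ?_
    exact LinearMap.continuous_of_finiteDimensional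
      ((Module.finBasis ℝ (FReal F)).equivFun.toLinearMap.comp r)
  exact Topology.IsInducing.of_comp continuous_ev h
    (by
      have : r ∘ (ev F) = id := funext fun b => LinearMap.congr_fun hr b
      rw [this]; exact Topology.IsInducing.id)

variable (F) in
/-- The Lie algebra of the norm one part of `F_ℝˣ`. -/
noncomputable def normZero : Submodule ℝ ((F →+* ℂ) → ℂ) where
  carrier := {v | (∀ φ, v (ComplexEmbedding.conjugate φ) = conj (v φ)) ∧ ∑ φ, v φ = 0}
  add_mem' {a b} ha hb := ⟨fun φ => by simp [ha.1 φ, hb.1 φ], by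
    simp [Finset.sum_add_distrib, ha.2, hb.2]⟩
  zero_mem' := ⟨fun φ => by simp, by simp⟩
  smul_mem' c a ha := ⟨fun φ => by simp [ha.1 φ], by
    simp only [Pi.smul_apply, ← Finset.smul_sum, ha.2, smul_zero]⟩

theorem exists_expDom (v : normZero F) : ∃ x : picDom F,
    (x : IdealGroup F × (FReal F)ˣ).1 = 1 ∧
    ∀ φ, ev F ((x : IdealGroup F × (FReal F)ˣ).2 : FReal F) φ = Complex.exp (v.1 φ) := by
  obtain ⟨b, hb⟩ := exists_unit_ev_eq (F := F) (fun φ => Complex.exp (v.1 φ))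
    (fun φ => Complex.exp_ne_zero _) (fun φ => by rw [v.2.1, Complex.exp_conj])
  refine ⟨⟨(1, b), ?_⟩, rfl, fun φ => congr_fun hb φ⟩
  rw [mem_picDom]
  simp only [hb]
  rw [← norm_prod, ← Complex.exp_sum, v.2.2]
  simp

theorem picDom_ext {x y : picDom F}
    (h1 : (x : IdealGroup F × (FReal F)ˣ).1 = (y : IdealGroup F × (FReal F)ˣ).1)
    (h2 : ∀ φ, ev F ((x : IdealGroup F × (FReal F)ˣ).2 : FReal F) φ =
      ev F ((y : IdealGroup F × (FReal F)ˣ).2 : FReal F) φ) : x = y :=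
  Subtype.ext (Prod.ext h1 (unit_ext h2))

variable (F) in
/-- The exponential map to the group of oriented Arakelov divisors. -/
noncomputable def expDom : normZero F →+ Additive (picDom F) where
  toFun v := Additive.ofMul (exists_expDom v).choose
  map_zero' := by
    refine congrArg Additive.ofMul (picDom_ext ?_ fun φ => ?_)
    · rw [(exists_expDom (0 : normZero F)).choose_spec.1]; rfl
    · rw [(exists_expDom (0 : normZero F)).choose_spec.2]
      simp
  map_add' v w := by
    refine congrArg Additive.ofMul (picDom_ext ?_ fun φ => ?_)
    · rw [(exists_expDom (v + w)).choose_spec.1]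
      simp [(exists_expDom v).choose_spec.1, (exists_expDom w).choose_spec.1]
    · rw [(exists_expDom (v + w)).choose_spec.2]
      simp [(exists_expDom v).choose_spec.2, (exists_expDom w).choose_spec.2, Complex.exp_add]

/-- The ideal of an oriented Arakelov divisor. -/
noncomputable def idl (x : Additive (picDom F)) : IdealGroup F :=
  (x.toMul : IdealGroup F × (FReal F)ˣ).1

/-- The complex components of an oriented Arakelov divisor. -/
noncomputable def cpt (x : Additive (picDom F)) : (F →+* ℂ) → ℂ :=
  ev F ((x.toMul : IdealGroup F × (FReal F)ˣ).2 : FReal F)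

theorem dom_ext {x y : Additive (picDom F)} (h1 : idl x = idl y) (h2 : ∀ φ, cpt x φ = cpt y φ) :
    x = y := picDom_ext (x := x.toMul) (y := y.toMul) h1 h2

@[simp] theorem idl_add (x y : Additive (picDom F)) : idl (x + y) = idl x * idl y := rfl
@[simp] theorem idl_zero : idl (0 : Additive (picDom F)) = 1 := rfl
@[simp] theorem idl_neg (x : Additive (picDom F)) : idl (-x) = (idl x)⁻¹ := rfl
@[simp] theorem idl_sub (x y : Additive (picDom F)) : idl (x - y) = idl x / idl y := rfl
@[simp] theorem cpt_add (x y : Additive (picDom F)) (φ : F →+* ℂ) :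
    cpt (x + y) φ = cpt x φ * cpt y φ := by
  simp [cpt]
@[simp] theorem cpt_zero (φ : F →+* ℂ) : cpt (0 : Additive (picDom F)) φ = 1 := by simp [cpt]

theorem cpt_ne_zero (x : Additive (picDom F)) (φ : F →+* ℂ) : cpt x φ ≠ 0 := ev_unit_ne_zero _ φ

@[simp] theorem cpt_neg (x : Additive (picDom F)) (φ : F →+* ℂ) :
    cpt (-x) φ = (cpt x φ)⁻¹ := by
  refine eq_inv_of_mul_eq_one_left ?_
  rw [← cpt_add, neg_add_cancel, cpt_zero]

@[simp] theorem cpt_sub (x y : Additive (picDom F)) (φ : F →+* ℂ) :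
    cpt (x - y) φ = cpt x φ / cpt y φ := by
  rw [sub_eq_add_neg, cpt_add, cpt_neg, div_eq_mul_inv]

theorem cpt_conjugate (x : Additive (picDom F)) (φ : F →+* ℂ) :
    cpt x (ComplexEmbedding.conjugate φ) = conj (cpt x φ) := ev_conjugate _ φ

theorem absNorm_idl (x : Additive (picDom F)) :
    (FractionalIdeal.absNorm (idl x : FractionalIdeal (𝓞 F)⁰ F) : ℝ) = ∏ φ, ‖cpt x φ‖ :=
  mem_picDom.1 x.toMul.2

@[simp] theorem idl_expDom (v : normZero F) : idl (expDom F v) = 1 := (exists_expDom v).choose_spec.1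

@[simp] theorem cpt_expDom (v : normZero F) (φ : F →+* ℂ) :
    cpt (expDom F v) φ = Complex.exp (v.1 φ) := (exists_expDom v).choose_spec.2 φ

/-- An oriented Arakelov divisor with prescribed ideal and components. -/
theorem exists_dom (I : IdealGroup F) (w : (F →+* ℂ) → ℂ) (h0 : ∀ φ, w φ ≠ 0)
    (hw : ∀ φ, w (ComplexEmbedding.conjugate φ) = conj (w φ))
    (hN : (FractionalIdeal.absNorm (I : FractionalIdeal (𝓞 F)⁰ F) : ℝ) = ∏ φ, ‖w φ‖) :
    ∃ x : Additive (picDom F), idl x = I ∧ ∀ φ, cpt x φ = w φ := by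
  obtain ⟨b, hb⟩ := exists_unit_ev_eq w h0 hw
  exact ⟨Additive.ofMul ⟨(I, b), by rw [mem_picDom]; simpa only [hb] using hN⟩, rfl, congr_fun hb⟩

variable (F) in
/-- Principal oriented Arakelov divisors. -/
noncomputable def prin : Additive Fˣ →+ Additive (picDom F) where
  toFun a := Additive.ofMul ⟨principalHom F a.toMul, principalHom_mem _⟩
  map_zero' := congrArg Additive.ofMul (Subtype.ext (map_one _))
  map_add' _ _ := congrArg Additive.ofMul (Subtype.ext (map_mul _ _ _))

@[simp] theorem idl_prin (a : Fˣ) : idl (prin F (Additive.ofMul a)) = toPrincipalIdeal (𝓞 F) F a := rfl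

@[simp] theorem cpt_prin (a : Fˣ) (φ : F →+* ℂ) : cpt (prin F (Additive.ofMul a)) φ = φ a :=
  ev_principalHom a φ

theorem mem_principalSub {x : Additive (picDom F)} :
    x.toMul ∈ principalSub F ↔ ∃ a : Fˣ, prin F (Additive.ofMul a) = x := by
  constructor
  · rintro ⟨a, ha⟩
    exact ⟨a, congrArg Additive.ofMul (Subtype.ext ha)⟩
  · rintro ⟨a, rfl⟩
    exact ⟨a, rfl⟩

theorem sum_eq_ofReal {v : (F →+* ℂ) → ℂ}
    (hc : ∀ φ, v (ComplexEmbedding.conjugate φ) = conj (v φ)) :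
    ∑ φ, v φ = ((∑ φ, (v φ).re : ℝ) : ℂ) := by
  have him : conj (∑ φ, v φ) = ∑ φ, v φ := by
    rw [map_sum]
    simp only [← hc]
    exact Equiv.sum_comp (ComplexEmbedding.involutive_conjugate F).toPerm v
  rw [← Complex.conj_eq_iff_re.1 him, Complex.re_sum]

/-- A divisor with trivial ideal is the exponential of any logarithm of its components. -/
theorem mem_normZero_of_exp {x : Additive (picDom F)} (h1 : idl x = 1) {v : (F →+* ℂ) → ℂ}
    (hc : ∀ φ, v (ComplexEmbedding.conjugate φ) = conj (v φ))
    (he : ∀ φ, Complex.exp (v φ) = cpt x φ) : v ∈ normZero F := by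
  refine ⟨hc, ?_⟩
  have hre : ∀ φ, (v φ).re = Real.log ‖cpt x φ‖ := fun φ => by
    rw [← he, Complex.norm_exp, Real.log_exp]
  rw [sum_eq_ofReal hc]
  simp only [hre]
  rw [← Real.log_prod (fun φ _ => norm_ne_zero_iff.2 (cpt_ne_zero x φ)), ← absNorm_idl, h1]
  simp

/-- The logarithm of a divisor with trivial ideal and components in the slit plane. -/
theorem exists_expDom_eq (x : Additive (picDom F)) (h1 : idl x = 1)
    (h : ∀ φ, cpt x φ ∈ Complex.slitPlane) :
    ∃ v : normZero F, expDom F v = x ∧ ∀ φ, v.1 φ = Complex.log (cpt x φ) := by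
  have he : ∀ φ, Complex.exp (Complex.log (cpt x φ)) = cpt x φ := fun φ =>
    Complex.exp_log (cpt_ne_zero x φ)
  refine ⟨⟨fun φ => Complex.log (cpt x φ), mem_normZero_of_exp h1 (fun φ => ?_) he⟩,
    dom_ext (by simp [h1]) fun φ => ?_, fun φ => rfl⟩
  · rw [cpt_conjugate, Complex.log_conj _ (Complex.slitPlane_arg_ne_pi (h φ))]
  · rw [cpt_expDom]
    exact he φ

end ArClass

end

section

open NumberField ComplexConjugate Filter Topology
open scoped nonZeroDivisors TensorProduct

namespace ArClass

variable {F : Type} [Field F] [NumberField F]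

theorem continuous_cpt : Continuous (cpt : Additive (picDom F) → (F →+* ℂ) → ℂ) :=
  continuous_ev.comp (Units.continuous_val.comp (continuous_snd.comp continuous_subtype_val))

theorem continuous_idl : Continuous (idl : Additive (picDom F) → IdealGroup F) :=
  continuous_fst.comp continuous_subtype_val

theorem continuous_expDom : Continuous (expDom F) := by
  have hpos : Continuous fun v : normZero F => cpt (expDom F v) := by
    refine continuous_pi fun φ => ?_
    simp only [cpt_expDom]
    exact Complex.continuous_exp.comp ((continuous_apply φ).comp continuous_subtype_val)
  have hneg : Continuous fun v : normZero F => cpt (expDom F (-v)) := hpos.comp continuous_neg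
  refine Continuous.subtype_mk (Continuous.prodMk ?_ ?_) _
  · have : (fun v : normZero F => idl (expDom F v)) = fun _ => 1 := funext idl_expDom
    exact (continuous_const (y := (1 : IdealGroup F))).congr fun v => (idl_expDom v).symm
  · refine Units.continuous_iff.2 ⟨isInducing_ev.continuous_iff.2 hpos,
      isInducing_ev.continuous_iff.2 ?_⟩
    refine hneg.congr fun v => ?_
    rw [map_neg]
    rfl

/-- The homomorphism on oriented Arakelov divisors underlying an element of the dual. -/
noncomputable def pull : ArTilde F →+ (Additive (picDom F) →+ RmodZ) where
  toFun φ := (ContinuousAddMonoidHom.toAddMonoidHom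
    (show ContinuousAddMonoidHom (Additive (PicTilde F)) RmodZ from φ)).comp
      (QuotientGroup.mk' (principalSub F)).toAdditive
  map_zero' := rfl
  map_add' _ _ := rfl

theorem pull_apply (φ : ArTilde F) (x : Additive (picDom F)) :
    pull φ x = φ (Additive.ofMul (PicTilde.mk F x.toMul)) := rfl

theorem pull_injective : Function.Injective (pull (F := F)) := fun φ ψ h => by
  refine ContinuousAddMonoidHom.ext fun z => ?_
  obtain ⟨x, hx⟩ := QuotientGroup.mk_surjective (s := principalSub F) z.toMul
  have := DFunLike.congr_fun h (Additive.ofMul x)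
  rw [pull_apply, pull_apply] at this
  have hz : Additive.ofMul (PicTilde.mk F x) = z := congrArg Additive.ofMul hx
  rw [toMul_ofMul, hz] at this
  exact this

theorem pull_prin (φ : ArTilde F) (a : Additive Fˣ) : pull φ (prin F a) = 0 := by
  rw [pull_apply]
  have : PicTilde.mk F (prin F a).toMul = 1 :=
    (QuotientGroup.eq_one_iff _).2 (mem_principalSub.2 ⟨a.toMul, rfl⟩)
  rw [this]
  exact map_zero (show ContinuousAddMonoidHom _ _ from φ)

theorem continuous_pull (φ : ArTilde F) : Continuous (pull φ) :=
  (ContinuousAddMonoidHom.continuous_toFun φ).comp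
    (continuous_ofMul.comp (continuous_quotient_mk'.comp continuous_toMul))

theorem continuous_of_exp (χ : Additive (picDom F) →+ RmodZ) (l : normZero F →ₗ[ℝ] ℝ)
    (hl : ∀ v, χ (expDom F v) = ((l v : ℝ) : RmodZ)) : Continuous χ := by
  obtain ⟨l', hl'⟩ := LinearMap.exists_extend l
  have hl'c : Continuous l' := LinearMap.continuous_of_finiteDimensional l'
  refine continuous_iff_continuousAt.2 fun x₀ => ?_
  have hone : ∀ φ, cpt x₀ φ / cpt x₀ φ ∈ Complex.slitPlane := fun φ => by
    rw [div_self (cpt_ne_zero _ _)]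
    exact Complex.one_mem_slitPlane
  have h1 : ∀ᶠ x in 𝓝 x₀, idl x = idl x₀ := by
    have : IsOpen ({idl x₀} : Set (IdealGroup F)) := trivial
    exact continuous_idl.continuousAt.eventually (this.mem_nhds rfl)
  have hc : ∀ φ, ContinuousAt (fun x => cpt x φ / cpt x₀ φ) x₀ := fun φ =>
    (((continuous_apply φ).comp continuous_cpt).continuousAt).div_const _
  have h2 : ∀ᶠ x in 𝓝 x₀, ∀ φ, cpt x φ / cpt x₀ φ ∈ Complex.slitPlane := by
    exact eventually_all.2 fun φ =>
      (hc φ).eventually (Complex.isOpen_slitPlane.mem_nhds (hone φ))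
  have h3 : ∀ᶠ x in 𝓝 x₀,
      χ x₀ + ((l' fun φ => Complex.log (cpt x φ / cpt x₀ φ) : ℝ) : RmodZ) = χ x := by
    filter_upwards [h1, h2] with x hx1 hx2
    obtain ⟨v, hv, hv'⟩ := exists_expDom_eq (x - x₀) (by rw [idl_sub, hx1, div_self'])
      (fun φ => by rw [cpt_sub]; exact hx2 φ)
    have : (fun φ => Complex.log (cpt x φ / cpt x₀ φ)) = v.1 := by
      ext φ
      rw [hv', cpt_sub]
    rw [this]
    have h4 : l' v.1 = l v := LinearMap.congr_fun hl' v
    rw [h4, ← hl, hv, ← map_add, add_sub_cancel]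
  refine ContinuousAt.congr ?_ h3
  refine continuousAt_const.add ?_
  refine ((AddCircle.continuous_mk' (1 : ℝ)).continuousAt).comp ?_
  exact hl'c.continuousAt.comp (continuousAt_pi.2 fun φ => (hc φ).clog (hone φ))

theorem exists_pull_eq (χ : Additive (picDom F) →+ RmodZ) (l : normZero F →ₗ[ℝ] ℝ)
    (hl : ∀ v, χ (expDom F v) = ((l v : ℝ) : RmodZ)) (hp : ∀ a, χ (prin F a) = 0) :
    ∃ φ : ArTilde F, pull φ = χ := by
  have hker : principalSub F ≤ (AddMonoidHom.toMultiplicativeRight χ).ker := by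
    intro x hx
    obtain ⟨a, ha⟩ := mem_principalSub (x := Additive.ofMul x) |>.1 hx
    change χ (Additive.ofMul x) = 0
    rw [← ha, hp]
  let f : PicTilde F →* Multiplicative RmodZ := QuotientGroup.lift _ _ hker
  have hf : Continuous f := by
    refine Continuous.quotient_lift (f := AddMonoidHom.toMultiplicativeRight χ) ?_ _
    exact continuous_of_exp χ l hl
  exact ⟨(⟨MonoidHom.toAdditiveLeft f, hf⟩ :
    ContinuousAddMonoidHom (Additive (PicTilde F)) RmodZ), rfl⟩

theorem exists_lift (χ : normZero F →+ RmodZ) (hχ : Continuous χ) :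
    ∃ l : normZero F →ₗ[ℝ] ℝ, ∀ v, χ v = ((l v : ℝ) : RmodZ) := by
  have hcov := AddCircle.isCoveringMap_coe (1 : ℝ)
  obtain ⟨f, ⟨hf0, hf⟩, -⟩ := hcov.existsUnique_continuousMap_lifts ⟨χ, hχ⟩ 0 0 (by simp)
  have hf' : ∀ v, ((f v : ℝ) : RmodZ) = χ v := congr_fun hf
  have hadd : (fun p : normZero F × normZero F => f (p.1 + p.2)) = fun p => f p.1 + f p.2 := by
    refine hcov.eq_of_comp_eq (by fun_prop) (by fun_prop) ?_ (0 : normZero F × normZero F)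
      (by simp [hf0])
    ext p
    simp [hf']
  let f' : normZero F →+ ℝ :=
    { toFun := f
      map_zero' := hf0
      map_add' := fun v w => congr_fun hadd (v, w) }
  exact ⟨(f'.toRealLinearMap f.continuous).toLinearMap, fun v => (hf' v).symm⟩

end ArClass

end

section

open NumberField ComplexConjugate Filter Topology
open scoped nonZeroDivisors TensorProduct

namespace ArClass

variable {F : Type} [Field F] [NumberField F]

theorem toPrincipalIdeal_eq_one_iff {a : Fˣ} :
    toPrincipalIdeal (𝓞 F) F a = 1 ↔ ∃ u : (𝓞 F)ˣ, ((u : 𝓞 F) : F) = a := by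
  rw [Units.ext_iff, coe_toPrincipalIdeal, Units.val_one]
  constructor
  · intro h
    have h1 : (a : F) ∈ (1 : FractionalIdeal (𝓞 F)⁰ F) := by
      rw [← h]; exact FractionalIdeal.mem_spanSingleton_self _ _
    have h2 : (1 : F) ∈ FractionalIdeal.spanSingleton (𝓞 F)⁰ (a : F) := by
      rw [h]; exact FractionalIdeal.one_mem_one _
    obtain ⟨x, hx⟩ := (FractionalIdeal.mem_one_iff _).1 h1
    obtain ⟨y, hy⟩ := (FractionalIdeal.mem_spanSingleton _).1 h2
    refine ⟨⟨x, y, ?_, ?_⟩, hx⟩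
    · refine RingOfIntegers.ext ?_
      simpa [Algebra.smul_def, hx, mul_comm] using hy
    · refine RingOfIntegers.ext ?_
      simpa [Algebra.smul_def, hx] using hy
  · rintro ⟨u, hu⟩
    rw [← hu]
    refine le_antisymm ?_ ?_
    · rw [FractionalIdeal.spanSingleton_le_iff_mem]
      exact FractionalIdeal.coe_mem_one _ (u : 𝓞 F)
    · refine FractionalIdeal.one_le.2 ?_
      refine (FractionalIdeal.mem_spanSingleton _).2 ⟨((u⁻¹ : (𝓞 F)ˣ) : 𝓞 F), ?_⟩
      rw [Algebra.smul_def, ← map_mul, Units.inv_mul, map_one]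

variable (F) in
/-- The logarithms of units: the lattice of elements whose exponential is principal. -/
noncomputable def logLattice : AddSubgroup (normZero F) :=
  (prin F).range.comap (expDom F)

theorem mem_logLattice {v : normZero F} :
    v ∈ logLattice F ↔ ∃ u : (𝓞 F)ˣ, ∀ φ : F →+* ℂ, φ (u : 𝓞 F) = Complex.exp (v.1 φ) := by
  constructor
  · rintro ⟨a, ha⟩
    have h1 := congrArg idl ha
    rw [idl_expDom, ← ofMul_toMul a, idl_prin] at h1
    obtain ⟨u, hu⟩ := toPrincipalIdeal_eq_one_iff.1 h1
    refine ⟨u, fun φ => ?_⟩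
    rw [← cpt_expDom, ← ha, ← ofMul_toMul a, cpt_prin, ← hu]
  · rintro ⟨u, hu⟩
    refine ⟨Additive.ofMul (Units.map (algebraMap (𝓞 F) F).toMonoidHom u), dom_ext ?_ fun φ => ?_⟩
    · rw [idl_expDom, idl_prin]
      exact toPrincipalIdeal_eq_one_iff.2 ⟨u, rfl⟩
    · rw [cpt_expDom, ← hu, cpt_prin]
      rfl

theorem logLattice_inter_ball_finite :
    ((logLattice F : Set (normZero F)) ∩ Metric.closedBall 0 1).Finite := by
  have hfin := Embeddings.finite_of_norm_le F ℂ (Real.exp 1)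
  have hb : ∀ v ∈ Metric.closedBall (0 : normZero F) 1, ∀ φ, ‖v.1 φ‖ ≤ 1 := by
    intro v hv φ
    rw [mem_closedBall_zero_iff] at hv
    exact (norm_le_pi_norm v.1 φ).trans hv
  choose! f hf using fun (v : normZero F) (hv : v ∈ logLattice F) => mem_logLattice.1 hv
  refine Set.Finite.of_finite_image (f := fun v => ((f v : 𝓞 F) : F)) (hfin.subset ?_) ?_
  · rintro _ ⟨v, ⟨hv, hv'⟩, rfl⟩
    refine ⟨RingOfIntegers.isIntegral_coe _, fun φ => ?_⟩
    rw [hf v hv, Complex.norm_exp]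
    exact Real.exp_le_exp.2 (((Complex.re_le_norm _).trans (hb v hv' φ)))
  · intro v ⟨hv, hv'⟩ w ⟨hw, hw'⟩ h
    refine Subtype.ext (funext fun φ => ?_)
    have h1 : Complex.exp (v.1 φ) = Complex.exp (w.1 φ) := by
      rw [← hf v hv, ← hf w hw]
      exact congrArg φ h
    have hpi := Real.pi_gt_three
    have hva := abs_le.1 ((Complex.abs_im_le_norm _).trans (hb v hv' φ))
    have hwa := abs_le.1 ((Complex.abs_im_le_norm _).trans (hb w hw' φ))
    exact Complex.exp_inj_of_neg_pi_lt_of_le_pi (by linarith) (by linarith) (by linarith)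
      (by linarith) h1

instance : DiscreteTopology (logLattice F).toIntSubmodule := by
  classical
  refine discreteTopology_of_isOpen_singleton_zero ?_
  refine isOpen_singleton_of_finite_mem_nhds 0 (s := Metric.closedBall 0 1) ?_ ?_
  · exact Metric.closedBall_mem_nhds _ (by simp)
  · refine Set.Finite.of_finite_image ?_ (Set.injOn_of_injective Subtype.val_injective)
    refine logLattice_inter_ball_finite.subset ?_
    rintro _ ⟨v, hv, rfl⟩
    exact ⟨v.2, by simpa using hv⟩

theorem exists_logLattice_of_unit (u : (𝓞 F)ˣ) :
    ∃ v ∈ logLattice F, ∀ φ : F →+* ℂ, (v.1 φ).re = 2 * Real.log ‖φ (u : 𝓞 F)‖ := by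
  set a : Additive Fˣ := Additive.ofMul (Units.map (algebraMap (𝓞 F) F).toMonoidHom u)
  have ha : ∀ φ, cpt (prin F a) φ = φ (u : 𝓞 F) := fun φ => cpt_prin _ φ
  have h1 : idl (prin F (a + a)) = 1 := by
    rw [map_add, idl_add, idl_prin, toPrincipalIdeal_eq_one_iff.2 ⟨u, rfl⟩, one_mul]
  let v : (F →+* ℂ) → ℂ := fun φ => Complex.log (φ (u : 𝓞 F)) +
    conj (Complex.log (ComplexEmbedding.conjugate φ (u : 𝓞 F)))
  have hc : ∀ φ, v (ComplexEmbedding.conjugate φ) = conj (v φ) := fun φ => by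
    simp only [v]
    rw [map_add, Complex.conj_conj, ComplexEmbedding.involutive_conjugate F φ, add_comm]
  have hne : ∀ φ : F →+* ℂ, φ (u : 𝓞 F) ≠ 0 := fun φ => ha φ ▸ cpt_ne_zero _ φ
  have he : ∀ φ, Complex.exp (v φ) = cpt (prin F (a + a)) φ := fun φ => by
    rw [map_add, cpt_add, ha]
    simp only [v]
    rw [Complex.exp_add, Complex.exp_conj, Complex.exp_log (hne _), Complex.exp_log (hne _),
      ComplexEmbedding.conjugate_coe_eq, Complex.conj_conj]
  refine ⟨⟨v, mem_normZero_of_exp h1 hc he⟩, ⟨a + a, dom_ext ?_ fun φ => ?_⟩, fun φ => ?_⟩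
  · rw [h1, idl_expDom]
  · rw [cpt_expDom, he]
  · simp only [v]
    rw [Complex.add_re, Complex.conj_re, Complex.log_re, Complex.log_re,
      ComplexEmbedding.conjugate_coe_eq, Complex.norm_conj]
    ring

/-- The purely imaginary periods of the exponential. -/
theorem exists_period (m : (F →+* ℂ) → ℤ) (hm : ∀ φ, m (ComplexEmbedding.conjugate φ) = - m φ) :
    ∃ v : normZero F, expDom F v = 0 ∧ ∀ φ, v.1 φ = 2 * Real.pi * Complex.I * m φ := by
  let v : (F →+* ℂ) → ℂ := fun φ => 2 * Real.pi * Complex.I * m φ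
  have hc : ∀ φ, v (ComplexEmbedding.conjugate φ) = conj (v φ) := fun φ => by
    simp only [v, hm]
    simp only [map_mul, Complex.conj_I, Complex.conj_ofReal, map_intCast, map_ofNat]
    push_cast
    ring
  have he : ∀ φ, Complex.exp (v φ) = cpt (0 : Additive (picDom F)) φ := fun φ => by
    rw [cpt_zero, Complex.exp_eq_one_iff]
    exact ⟨_, mul_comm _ _⟩
  refine ⟨⟨v, mem_normZero_of_exp idl_zero hc he⟩, dom_ext ?_ fun φ => ?_, fun φ => rfl⟩
  · simp
  · rw [cpt_expDom, he]

theorem ker_expDom_le : (expDom F).ker ≤ logLattice F := fun v hv =>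
  ⟨0, by rw [map_zero, (AddMonoidHom.mem_ker).1 hv]⟩

theorem mem_span_of_re_eq_zero {v : normZero F} (hv : ∀ φ, (v.1 φ).re = 0) :
    v ∈ Submodule.span ℝ (logLattice F : Set (normZero F)) := by
  classical
  have hinv := ComplexEmbedding.involutive_conjugate F
  choose p hp hp' using fun φ : F →+* ℂ => exists_period
    (fun ψ => Pi.single (M := fun _ => ℤ) φ 1 ψ -
      Pi.single (M := fun _ => ℤ) (ComplexEmbedding.conjugate φ) 1 ψ)
    (fun ψ => by
      simp only [Pi.single_apply, hinv.injective.eq_iff, hinv.eq_iff]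
      ring)
  have : v = ∑ φ, ((v.1 φ).im / (4 * Real.pi)) • p φ := by
    refine Subtype.ext (funext fun ψ => ?_)
    have h1 : (v.1 (ComplexEmbedding.conjugate ψ)).im = -(v.1 ψ).im := by
      rw [v.2.1, Complex.conj_im]
    have h2 : ∀ φ : F →+* ℂ, (ψ = ComplexEmbedding.conjugate φ) =
        (ComplexEmbedding.conjugate ψ = φ) := fun φ => propext
      (eq_comm.trans (hinv.eq_iff.trans eq_comm))
    rw [Submodule.coe_sum, Finset.sum_apply]
    simp only [Submodule.coe_smul, Pi.smul_apply, hp', Complex.real_smul, Int.cast_sub,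
      Pi.single_apply, mul_sub, Finset.sum_sub_distrib, h2]
    simp only [Int.cast_ite, Int.cast_one, Int.cast_zero, mul_ite, mul_one, mul_zero,
      Finset.sum_ite_eq, Finset.mem_univ, if_true, h1]
    have h3 : v.1 ψ = (v.1 ψ).im * Complex.I := Complex.ext (by simp [hv]) (by simp)
    have hpi : (Real.pi : ℂ) ≠ 0 := Complex.ofReal_ne_zero.2 Real.pi_ne_zero
    conv_lhs => rw [h3]
    push_cast
    field_simp
    ring
  rw [this]
  refine Submodule.sum_mem _ fun φ _ => Submodule.smul_mem _ _ (Submodule.subset_span ?_)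
  exact ker_expDom_le (hp φ)

theorem re_eq_of_mk_eq (v : normZero F) {φ ψ : F →+* ℂ}
    (h : InfinitePlace.mk φ = InfinitePlace.mk ψ) : (v.1 φ).re = (v.1 ψ).re := by
  rcases InfinitePlace.mk_eq_iff.1 h with rfl | h
  · rfl
  · rw [← h, v.2.1, Complex.conj_re]

open Units.dirichletUnitTheorem in
theorem span_logLattice : Submodule.span ℝ (logLattice F : Set (normZero F)) = ⊤ := by
  let R : normZero F →ₗ[ℝ] logSpace F :=
    { toFun := fun v w => w.1.mult * (v.1 w.1.embedding).re
      map_add' := fun v w => by ext; simp [mul_add]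
      map_smul' := fun c v => by ext; simp; ring }
  have hker : ∀ v, R v = 0 → ∀ φ, (v.1 φ).re = 0 := by
    intro v hv
    have h1 : ∀ φ : F →+* ℂ, InfinitePlace.mk φ ≠ w₀ → (v.1 φ).re = 0 := by
      intro φ hφ
      have := congr_fun hv ⟨_, hφ⟩
      simp only [R, LinearMap.coe_mk, AddHom.coe_mk, Pi.zero_apply, mul_eq_zero,
        InfinitePlace.mult_coe_ne_zero, false_or] at this
      rwa [re_eq_of_mk_eq v (InfinitePlace.mk_embedding _).symm.symm] at this
    have h2 : ∀ φ : F →+* ℂ, InfinitePlace.mk φ = w₀ →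
        (v.1 φ).re = (v.1 (w₀ : InfinitePlace F).embedding).re := fun φ hφ =>
      re_eq_of_mk_eq v (hφ.trans (InfinitePlace.mk_embedding _).symm)
    have h3 : (v.1 (w₀ : InfinitePlace F).embedding).re = 0 := by
      classical
      have h4 : ∑ φ, (v.1 φ).re = 0 := by
        rw [← Complex.re_sum, v.2.2, Complex.zero_re]
      rw [← Finset.sum_filter_add_sum_filter_not _ (fun φ => InfinitePlace.mk φ = w₀),
        Finset.sum_congr rfl (fun φ hφ => h2 φ (Finset.mem_filter.1 hφ).2),
        Finset.sum_congr (s₁ := Finset.filter (fun φ => ¬ InfinitePlace.mk φ = w₀) _) rfl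
          (fun φ hφ => h1 φ (Finset.mem_filter.1 hφ).2), Finset.sum_const_zero, add_zero,
        Finset.sum_const, nsmul_eq_mul, mul_eq_zero] at h4
      refine h4.resolve_left ?_
      rw [Nat.cast_eq_zero, Finset.card_eq_zero]
      exact Finset.ne_empty_of_mem (Finset.mem_filter.2
        ⟨Finset.mem_univ (w₀ : InfinitePlace F).embedding, InfinitePlace.mk_embedding _⟩)
    intro φ
    by_cases hφ : InfinitePlace.mk φ = w₀
    · rw [h2 φ hφ, h3]
    · exact h1 φ hφ
  have hR : Submodule.map R (Submodule.span ℝ (logLattice F : Set (normZero F))) = ⊤ := by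
    rw [eq_top_iff, ← unitLattice_span_eq_top, Submodule.span_le]
    rintro _ ⟨u, -, rfl⟩
    obtain ⟨v, hv, hv'⟩ := exists_logLattice_of_unit u.toMul
    refine ⟨(1 / 2 : ℝ) • v, Submodule.smul_mem _ _ (Submodule.subset_span hv), ?_⟩
    ext w
    rw [map_smul]
    change (1 / 2 : ℝ) * (w.1.mult * (v.1 w.1.embedding).re) = w.1.mult * Real.log (w.1 _)
    rw [hv', InfinitePlace.norm_embedding_eq]
    ring
  refine eq_top_iff.2 fun v _ => ?_
  obtain ⟨s, hs, hs'⟩ := hR.symm ▸ Submodule.mem_top (x := R v)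
  rw [← sub_add_cancel v s]
  refine Submodule.add_mem _ (mem_span_of_re_eq_zero (hker _ ?_)) hs
  rw [map_sub, hs', sub_self]

instance : IsZLattice ℝ (logLattice F).toIntSubmodule := ⟨span_logLattice⟩

instance : Module.Finite ℤ (logLattice F) :=
  inferInstanceAs (Module.Finite ℤ (logLattice F).toIntSubmodule)

instance : Module.Free ℤ (logLattice F) :=
  inferInstanceAs (Module.Free ℤ (logLattice F).toIntSubmodule)

/-- A homomorphism on the lattice of logarithms extends to a unique linear form. -/
theorem exists_extend_logLattice (h : logLattice F →+ ℤ) :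
    ∃ l : normZero F →ₗ[ℝ] ℝ, ∀ v : logLattice F, l v = h v := by
  let b := Module.Free.chooseBasis ℤ (logLattice F).toIntSubmodule
  let b' := b.ofZLatticeBasis ℝ (logLattice F).toIntSubmodule
  refine ⟨b'.constr ℝ fun i => (h (b i) : ℝ), fun v => ?_⟩
  have h1 : ∀ v : (logLattice F).toIntSubmodule, b'.constr ℝ (fun i => (h (b i) : ℝ)) v = h v := by
    intro v
    let f : (logLattice F).toIntSubmodule →ₗ[ℤ] ℝ :=
      ((b'.constr ℝ (fun i => (h (b i) : ℝ))).restrictScalars ℤ).comp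
        (logLattice F).toIntSubmodule.subtype
    let g : (logLattice F).toIntSubmodule →ₗ[ℤ] ℝ :=
      (((Int.castAddHom ℝ).comp h).toIntLinearMap)
    have : f = g := b.ext fun i => by
      change b'.constr ℝ (fun i => (h (b i) : ℝ)) (b i : normZero F) = (h (b i) : ℝ)
      rw [← Module.Basis.ofZLatticeBasis_apply ℝ _ b i, Module.Basis.constr_basis]
    exact LinearMap.congr_fun this v
  exact h1 v

theorem linear_ext_logLattice {l l' : normZero F →ₗ[ℝ] ℝ}
    (h : ∀ v ∈ logLattice F, l v = l' v) : l = l' :=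
  LinearMap.ext_on span_logLattice h

end ArClass

end

section

open NumberField ComplexConjugate
open scoped nonZeroDivisors TensorProduct

namespace ArClass

variable {F : Type} [Field F] [NumberField F] {G : Type} [Group G]

variable (F G) in
/-- An action of `G` on `F` together with the induced action on oriented Arakelov divisors. -/
structure GalAction where
  /-- the action on the field -/
  fld : G →* (F ≃+* F)
  /-- the action on oriented Arakelov divisors -/
  dom : G →* AddMonoid.End (Additive (picDom F))
  mem_idl (g : G) (x : Additive (picDom F)) (a : F) :
    fld g a ∈ (idl (dom g x) : FractionalIdeal (𝓞 F)⁰ F) ↔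
      a ∈ (idl x : FractionalIdeal (𝓞 F)⁰ F)
  cpt_dom (g : G) (x : Additive (picDom F)) (φ : F →+* ℂ) :
    cpt (dom g x) φ = cpt x (φ.comp (fld g : F →+* F))

/-- Multiplication of fractional ideals is compatible with semilinear automorphisms. -/
theorem map_mem_mul {A : Type*} [CommRing A] [Algebra A F] {S : Submonoid A} (e : F ≃+* F)
    {I J I' J' : FractionalIdeal S F} (h : ∀ a ∈ I, e a ∈ I') (h' : ∀ a ∈ J, e a ∈ J') :
    ∀ a ∈ I * J, e a ∈ I' * J' := by
  intro a ha
  refine FractionalIdeal.mul_induction_on ha (fun i hi j hj => ?_) (fun x y hx hy => ?_)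
  · rw [map_mul]
    exact FractionalIdeal.mul_mem_mul (h i hi) (h' j hj)
  · rw [map_add]
    exact Submodule.add_mem _ hx hy

theorem mem_mul_iff {A : Type*} [CommRing A] [Algebra A F] {S : Submonoid A} (e : F ≃+* F)
    {I J I' J' : FractionalIdeal S F} (h : ∀ a, e a ∈ I' ↔ a ∈ I) (h' : ∀ a, e a ∈ J' ↔ a ∈ J)
    (a : F) : e a ∈ I' * J' ↔ a ∈ I * J := by
  refine ⟨fun ha => ?_, map_mem_mul e (fun a => (h a).2) (fun a => (h' a).2) a⟩
  have := map_mem_mul e.symm (I := I') (J := J') (I' := I) (J' := J)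
    (fun a ha => (h _).1 (by simpa using ha)) (fun a ha => (h' _).1 (by simpa using ha)) _ ha
  simpa using this

theorem ideal_ext_of_ringEquiv {A : Type*} [CommRing A] [Algebra A F] {S : Submonoid A}
    (e : F ≃+* F) {I J : FractionalIdeal S F} (h : ∀ a, e a ∈ I ↔ e a ∈ J) : I = J :=
  FractionalIdeal.ext fun a => by simpa using h (e.symm a)

theorem gal_dom_ext (e : F ≃+* F) {x y : Additive (picDom F)}
    (h1 : ∀ a, e a ∈ (idl x : FractionalIdeal (𝓞 F)⁰ F) ↔
      e a ∈ (idl y : FractionalIdeal (𝓞 F)⁰ F)) (h2 : ∀ φ, cpt x φ = cpt y φ) : x = y :=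
  dom_ext (Units.ext (ideal_ext_of_ringEquiv e h1)) h2

/-- The action on divisors is determined by existence of images. -/
theorem exists_galAction (s : G →* (F ≃+* F))
    (h : ∀ g (x : Additive (picDom F)), ∃ y : Additive (picDom F),
      (∀ a, s g a ∈ (idl y : FractionalIdeal (𝓞 F)⁰ F) ↔
        a ∈ (idl x : FractionalIdeal (𝓞 F)⁰ F)) ∧
      ∀ φ, cpt y φ = cpt x (φ.comp (s g : F →+* F))) :
    ∃ γ : GalAction F G, γ.fld = s := by
  choose d hd1 hd2 using h
  refine ⟨⟨s,
    { toFun g := 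
        { toFun := d g
          map_zero' := ?_
          map_add' := ?_ }
      map_one' := ?_
      map_mul' := ?_ }, hd1, hd2⟩, rfl⟩
  · refine gal_dom_ext (s g) (fun a => ?_) fun φ => ?_
    · rw [hd1]
      simp only [idl_zero, Units.val_one, FractionalIdeal.mem_one_iff]
      constructor
      · rintro ⟨x, rfl⟩
        exact ⟨RingOfIntegers.mapRingEquiv (s g) x, rfl⟩
      · rintro ⟨x, hx⟩
        refine ⟨RingOfIntegers.mapRingEquiv (s g).symm x, ?_⟩
        change (s g).symm (algebraMap (𝓞 F) F x) = a
        rw [hx, RingEquiv.symm_apply_apply]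
    · rw [hd2, cpt_zero, cpt_zero]
  · intro x y
    refine gal_dom_ext (s g) (fun a => ?_) fun φ => ?_
    · rw [hd1, idl_add, idl_add, Units.val_mul, Units.val_mul]
      exact (mem_mul_iff (s g) (hd1 g x) (hd1 g y) a).symm
    · rw [hd2, cpt_add, cpt_add, hd2, hd2]
  · refine AddMonoidHom.ext fun x => ?_
    refine gal_dom_ext (s 1) (fun a => ?_) fun φ => ?_
    · exact (hd1 1 x a).trans (by rw [map_one]; rfl)
    · refine (hd2 1 x φ).trans ?_
      rw [map_one]; rfl
  · intro g g'
    refine AddMonoidHom.ext fun x => ?_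
    refine gal_dom_ext (s (g * g')) (fun a => ?_) fun φ => ?_
    · refine (hd1 (g * g') x a).trans ?_
      rw [map_mul]
      exact ((hd1 g (d g' x) (s g' a)).trans (hd1 g' x a)).symm
    · refine (hd2 (g * g') x φ).trans ?_
      change _ = cpt (d g (d g' x)) φ
      rw [hd2, hd2, map_mul]
      rfl

namespace GalAction

variable (γ : GalAction F G)

theorem fld_inv_fld (g : G) (a : F) : γ.fld g⁻¹ (γ.fld g a) = a := by
  have : (γ.fld g⁻¹ * γ.fld g) a = a := by rw [← map_mul, inv_mul_cancel, map_one]; rfl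
  exact this

theorem fld_fld_inv (g : G) (a : F) : γ.fld g (γ.fld g⁻¹ a) = a := by
  simpa using γ.fld_inv_fld g⁻¹ a

/-- The action of `G` on complex embeddings. -/
@[reducible] def emb : MulAction G (F →+* ℂ) where
  smul g φ := φ.comp (γ.fld g⁻¹ : F →+* F)
  one_smul φ := by
    change φ.comp (γ.fld 1⁻¹ : F →+* F) = φ
    rw [inv_one, map_one]; rfl
  mul_smul g h φ := by
    change φ.comp (γ.fld (g * h)⁻¹ : F →+* F) = (φ.comp (γ.fld h⁻¹ : F →+* F)).comp (γ.fld g⁻¹ : F →+* F)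
    rw [mul_inv_rev, map_mul]; rfl

theorem sum_comp {M : Type*} [AddCommMonoid M] (g : G) (f : (F →+* ℂ) → M) :
    ∑ φ : F →+* ℂ, f (φ.comp (γ.fld g : F →+* F)) = ∑ φ, f φ := by
  letI := γ.emb
  refine Fintype.sum_equiv (MulAction.toPerm g⁻¹) _ _ fun φ => ?_
  change _ = f (φ.comp (γ.fld g⁻¹⁻¹ : F →+* F))
  rw [inv_inv]

/-- The action of `G` on the Lie algebra of the norm one torus. -/
noncomputable def lie : G →* AddMonoid.End (normZero F) where
  toFun g :=
    { toFun v := ⟨fun φ => v.1 (φ.comp (γ.fld g : F →+* F)), fun φ => v.2.1 (φ.comp (γ.fld g : F →+* F)), by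
        rw [γ.sum_comp g v.1]; exact v.2.2⟩
      map_zero' := rfl
      map_add' _ _ := rfl }
  map_one' := by
    ext v φ
    change v.1 (φ.comp (γ.fld 1 : F →+* F)) = v.1 φ
    rw [map_one]; rfl
  map_mul' g h := by
    ext v φ
    change v.1 (φ.comp (γ.fld (g * h) : F →+* F)) =
      v.1 ((φ.comp (γ.fld g : F →+* F)).comp (γ.fld h : F →+* F))
    rw [map_mul]; rfl

theorem lie_apply (g : G) (v : normZero F) (φ : F →+* ℂ) :
    (γ.lie g v).1 φ = v.1 (φ.comp (γ.fld g : F →+* F)) := rfl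

theorem expDom_lie (g : G) (v : normZero F) : expDom F (γ.lie g v) = γ.dom g (expDom F v) := by
  refine gal_dom_ext (γ.fld g) (fun a => ?_) fun φ => ?_
  · rw [γ.mem_idl]
    have := γ.mem_idl g 0 a
    rw [map_zero] at this
    rw [idl_expDom, idl_expDom]
    exact this
  · rw [γ.cpt_dom, cpt_expDom, cpt_expDom, lie_apply]

theorem dom_prin (g : G) (a : Fˣ) : γ.dom g (prin F (Additive.ofMul a)) =
    prin F (Additive.ofMul (Units.map (γ.fld g : F →* F) a)) := by
  refine gal_dom_ext (γ.fld g) (fun b => ?_) fun φ => ?_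
  · rw [γ.mem_idl, idl_prin, idl_prin, coe_toPrincipalIdeal, coe_toPrincipalIdeal,
      FractionalIdeal.mem_spanSingleton, FractionalIdeal.mem_spanSingleton]
    constructor
    · rintro ⟨z, rfl⟩
      refine ⟨RingOfIntegers.mapRingEquiv (γ.fld g) z, ?_⟩
      rw [Algebra.smul_def, Algebra.smul_def, map_mul]
      rfl
    · rintro ⟨z, hz⟩
      refine ⟨RingOfIntegers.mapRingEquiv (γ.fld g).symm z, ?_⟩
      apply (γ.fld g).injective
      rw [← hz, Algebra.smul_def, Algebra.smul_def, map_mul]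
      change γ.fld g ((γ.fld g).symm (z : F)) * _ = _
      rw [RingEquiv.apply_symm_apply]
      rfl
  · rw [γ.cpt_dom, cpt_prin, cpt_prin]
    rfl

theorem lie_mem_logLattice (g : G) (v : normZero F) (hv : v ∈ logLattice F) :
    γ.lie g v ∈ logLattice F := by
  obtain ⟨a, ha⟩ := hv
  exact ⟨Additive.ofMul (Units.map (γ.fld g : F →* F) a.toMul), by
    rw [expDom_lie, ← ha, ← dom_prin]; rfl⟩

theorem lie_mem_ker (g : G) (v : normZero F) (hv : v ∈ (expDom F).ker) :
    γ.lie g v ∈ (expDom F).ker := by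
  rw [AddMonoidHom.mem_ker] at hv ⊢
  rw [expDom_lie, hv, map_zero]

/-- The action of `G` on the lattice. -/
noncomputable def lat : G →* AddMonoid.End (logLattice F) :=
  GRep.restrict γ.lie _ γ.lie_mem_logLattice

theorem dom_mem_sup (g : G) (x : Additive (picDom F))
    (hx : x ∈ (expDom F).range ⊔ (prin F).range) :
    γ.dom g x ∈ (expDom F).range ⊔ (prin F).range := by
  obtain ⟨_, ⟨v, rfl⟩, _, ⟨a, rfl⟩, rfl⟩ := AddSubgroup.mem_sup.1 hx
  rw [map_add]
  refine AddSubgroup.mem_sup.2 ⟨_, ⟨γ.lie g v, γ.expDom_lie g v⟩, _,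
    ⟨Additive.ofMul (Units.map (γ.fld g : F →* F) a.toMul), (γ.dom_prin g a.toMul).symm⟩, rfl⟩

end GalAction

variable (F) in
/-- The component group of the oriented Arakelov class group. -/
abbrev CompGroup := Additive (picDom F) ⧸ ((expDom F).range ⊔ (prin F).range)

/-- The action of `G` on the component group. -/
noncomputable def GalAction.cg (γ : GalAction F G) :=
  GRep.quotient γ.dom _ γ.dom_mem_sup

theorem linear_lift_unique {l l' : normZero F →ₗ[ℝ] ℝ}
    (h : ∀ v, ((l v : ℝ) : RmodZ) = ((l' v : ℝ) : RmodZ)) : l = l' := by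
  have key : ∀ v, ∃ n : ℤ, l v - l' v = n := fun v => by
    have := h v
    rw [← sub_eq_zero, ← AddCircle.coe_sub, AddCircle.coe_eq_zero_iff] at this
    obtain ⟨n, hn⟩ := this
    exact ⟨n, by rw [← hn]; simp⟩
  ext v
  by_contra hv
  have hv' : l v - l' v ≠ 0 := sub_ne_zero.2 hv
  obtain ⟨n, hn⟩ := key ((2 * (l v - l' v))⁻¹ • v)
  rw [map_smul, map_smul, smul_eq_mul, smul_eq_mul, ← mul_sub, mul_inv, mul_assoc,
    inv_mul_cancel₀ hv', mul_one] at hn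
  have h2 : (1 : ℝ) = 2 * n := by rw [← hn]; norm_num
  have h3 : (1 : ℤ) = 2 * n := by exact_mod_cast h2
  omega

theorem exists_charLift (φ : ArTilde F) : ∃ l : normZero F →ₗ[ℝ] ℝ,
    ∀ v, pull φ (expDom F v) = ((l v : ℝ) : RmodZ) :=
  exists_lift ((pull φ).comp (expDom F)) ((continuous_pull φ).comp continuous_expDom)

/-- The linear functional on the Lie algebra lifting a character. -/
noncomputable def charLift (φ : ArTilde F) : normZero F →ₗ[ℝ] ℝ := (exists_charLift φ).choose

theorem charLift_spec (φ : ArTilde F) (v : normZero F) :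
    pull φ (expDom F v) = ((charLift φ v : ℝ) : RmodZ) := (exists_charLift φ).choose_spec v

theorem charLift_eq {φ : ArTilde F} {l : normZero F →ₗ[ℝ] ℝ}
    (h : ∀ v, pull φ (expDom F v) = ((l v : ℝ) : RmodZ)) : charLift φ = l :=
  linear_lift_unique fun v => by rw [← charLift_spec, h]

theorem charLift_int (φ : ArTilde F) (v : logLattice F) : ∃ n : ℤ, (n : ℝ) = charLift φ v := by
  obtain ⟨a, ha⟩ := v.2
  have h := charLift_spec φ v
  have ha' : expDom F (v : normZero F) = prin F a := ha.symm
  rw [ha', pull_prin] at h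
  obtain ⟨n, hn⟩ := (AddCircle.coe_eq_zero_iff _).1 h.symm
  exact ⟨n, by rw [← hn]; simp⟩

/-- The value of the derivative of a character on the lattice. -/
noncomputable def charVal (φ : ArTilde F) (v : logLattice F) : ℤ := (charLift_int φ v).choose

theorem charVal_spec (φ : ArTilde F) (v : logLattice F) : (charVal φ v : ℝ) = charLift φ v :=
  (charLift_int φ v).choose_spec

/-- Restriction of the derivative of a character to the lattice. -/
noncomputable def charLattice : ArTilde F →+ (logLattice F →+ ℤ) where
  toFun φ :=
    { toFun := charVal φ
      map_zero' := by
        have := charVal_spec φ 0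
        rw [ZeroMemClass.coe_zero, map_zero] at this
        exact_mod_cast this
      map_add' v w := by
        have h := charVal_spec φ (v + w)
        rw [AddSubgroup.coe_add, map_add, ← charVal_spec, ← charVal_spec] at h
        exact_mod_cast h }
  map_zero' := by
    ext v
    have h := charVal_spec (0 : ArTilde F) v
    rw [charLift_eq (l := 0) (fun v => by simp), LinearMap.zero_apply] at h
    exact_mod_cast h
  map_add' φ ψ := by
    ext v
    have h := charVal_spec (φ + ψ) v
    rw [charLift_eq (l := charLift φ + charLift ψ) (fun v => by
      rw [map_add, AddMonoidHom.add_apply, charLift_spec, charLift_spec]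
      simp), LinearMap.add_apply, ← charVal_spec, ← charVal_spec] at h
    exact_mod_cast h

theorem charLattice_spec (φ : ArTilde F) (v : logLattice F) :
    (charLattice φ v : ℝ) = charLift φ v := charVal_spec φ v

theorem exists_extension {A B : Type} [AddCommGroup A] [AddCommGroup B] (f : A →+ B) (g : A →+ RmodZ)
    (h : ∀ x, f x = 0 → g x = 0) : ∃ k : B →+ RmodZ, ∀ x, k (f x) = g x := by
  have hb : Module.Baer ℤ RmodZ := Module.Baer.of_divisible _
  obtain ⟨k, hk⟩ := hb.extension_property_addMonoidHom (QuotientAddGroup.kerLift f)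
    (QuotientAddGroup.kerLift_injective f) (QuotientAddGroup.lift f.ker g fun x hx => h x hx)
  exact ⟨k, fun x => DFunLike.congr_fun hk (x : A ⧸ f.ker)⟩

theorem charLattice_surjective : Function.Surjective (charLattice (F := F)) := by
  intro h
  obtain ⟨l, hl⟩ := exists_extend_logLattice h
  have hf : ∀ v, ((QuotientAddGroup.mk' (prin F).range).comp (expDom F)) v = 0 →
      ((QuotientAddGroup.mk' (AddSubgroup.zmultiples (1 : ℝ))).comp l.toAddMonoidHom) v = 0 := by
    intro v hv
    have h1 : expDom F v ∈ (prin F).range :=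
      (QuotientAddGroup.eq_zero_iff (N := (prin F).range) (expDom F v)).1 hv
    refine (AddCircle.coe_eq_zero_iff (1 : ℝ)).2 ⟨h ⟨v, h1⟩, ?_⟩
    have := hl ⟨v, h1⟩
    simp only at this
    simp [this]
  obtain ⟨k, hk⟩ := exists_extension
    (B := Additive (picDom F) ⧸ (prin F).range) _ _ hf
  obtain ⟨φ, hφ⟩ := exists_pull_eq (k.comp (QuotientAddGroup.mk' (prin F).range)) l hk
    (fun a => by
      have : (QuotientAddGroup.mk' (prin F).range) (prin F a) = 0 :=
        (QuotientAddGroup.eq_zero_iff _).2 ⟨a, rfl⟩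
      rw [AddMonoidHom.comp_apply, this, map_zero])
  refine ⟨φ, ?_⟩
  ext v
  have h1 := charLattice_spec φ v
  rw [charLift_eq (l := l) (fun v => by rw [hφ]; exact hk v), hl] at h1
  exact_mod_cast h1

theorem exists_inflate (χ : CompGroup F →+ RmodZ) : ∃ φ : ArTilde F,
    pull φ = χ.comp (QuotientAddGroup.mk' _) := by
  refine exists_pull_eq _ 0 (fun v => ?_) (fun a => ?_)
  · have : QuotientAddGroup.mk' ((expDom F).range ⊔ (prin F).range) (expDom F v) = 0 :=
      (QuotientAddGroup.eq_zero_iff _).2 (AddSubgroup.mem_sup_left ⟨v, rfl⟩)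
    rw [AddMonoidHom.comp_apply, this]; simp
  · have : QuotientAddGroup.mk' ((expDom F).range ⊔ (prin F).range) (prin F a) = 0 :=
      (QuotientAddGroup.eq_zero_iff _).2 (AddSubgroup.mem_sup_right ⟨a, rfl⟩)
    rw [AddMonoidHom.comp_apply, this, map_zero]

/-- Characters of the component group as characters of the oriented Arakelov class group. -/
noncomputable def inflate : (CompGroup F →+ RmodZ) →+ ArTilde F where
  toFun χ := (exists_inflate χ).choose
  map_zero' := pull_injective (by rw [(exists_inflate 0).choose_spec, map_zero]; rfl)
  map_add' χ ψ := pull_injective (by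
    rw [(exists_inflate (χ + ψ)).choose_spec, map_add, (exists_inflate χ).choose_spec,
      (exists_inflate ψ).choose_spec]; rfl)

theorem pull_inflate (χ : CompGroup F →+ RmodZ) :
    pull (inflate χ) = χ.comp (QuotientAddGroup.mk' _) := (exists_inflate χ).choose_spec

theorem inflate_injective : Function.Injective (inflate (F := F)) := by
  intro χ ψ h
  have := congrArg pull h
  rw [pull_inflate, pull_inflate] at this
  ext x
  exact DFunLike.congr_fun this x

theorem exact_inflate : Function.Exact (inflate (F := F)) charLattice := by
  intro φ
  constructor
  · intro h
    have h0 : charLift φ = 0 := linear_ext_logLattice fun v hv => by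
      have := charLattice_spec φ ⟨v, hv⟩
      rw [h] at this
      simpa using this.symm
    refine ⟨QuotientAddGroup.lift _ (pull φ) ?_, pull_injective ?_⟩
    · refine sup_le ?_ ?_
      · rintro _ ⟨v, rfl⟩
        rw [AddMonoidHom.mem_ker, charLift_spec, h0]
        simp
      · rintro _ ⟨a, rfl⟩
        rw [AddMonoidHom.mem_ker, pull_prin]
    · rw [pull_inflate]; rfl
  · rintro ⟨χ, rfl⟩
    ext v
    have h1 := charLattice_spec (inflate χ) v
    rw [charLift_eq (l := 0) (fun v => by
      have : QuotientAddGroup.mk' ((expDom F).range ⊔ (prin F).range) (expDom F v) = 0 :=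
        (QuotientAddGroup.eq_zero_iff _).2 (AddSubgroup.mem_sup_left ⟨v, rfl⟩)
      rw [pull_inflate, AddMonoidHom.comp_apply, this]; simp), LinearMap.zero_apply] at h1
    exact_mod_cast h1

theorem finite_arTilde [Finite (CompGroup F)] : Module.Finite ℤ (ArTilde F) := by
  have := GRep.finite_hom_circle (CompGroup F)
  have : Module.Finite ℤ (logLattice F →+ ℤ) :=
    Module.Finite.equiv (addMonoidHomLequivInt (A := logLattice F) (B := ℤ) ℤ).symm
  exact GRep.finite_of_exact inflate charLattice fun x hx => (exact_inflate x).1 hx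

/-- The class of the dual of the oriented Arakelov class group. -/
theorem cls_arTilde [Finite (CompGroup F)] (γ : GalAction F G)
    (ρ : G →* AddMonoid.End (ArTilde F))
    (hρ : ∀ g φ x, pull (ρ g φ) x = pull φ (γ.dom g⁻¹ x)) :
    GRep.cls ρ = GRep.cls (GRep.dual (A := CompGroup F) γ.cg RmodZ) + GRep.cls (GRep.dual γ.lat ℤ) := by
  have := finite_arTilde (F := F)
  have := GRep.finite_hom_circle (CompGroup F)
  have : Module.Finite ℤ (logLattice F →+ ℤ) :=
    Module.Finite.equiv (addMonoidHomLequivInt (A := logLattice F) (B := ℤ) ℤ).symm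
  refine GRep.cls_exact _ ρ _ inflate charLattice inflate_injective charLattice_surjective
    exact_inflate (fun g χ => ?_) (fun g φ => ?_)
  · apply pull_injective
    refine AddMonoidHom.ext fun x => ?_
    rw [hρ, pull_inflate, pull_inflate]
    rfl
  · ext v
    have h1 := charLattice_spec (ρ g φ) v
    let m : normZero F →ₗ[ℝ] normZero F :=
      { toFun := γ.lie g⁻¹
        map_add' := map_add _
        map_smul' c w := by ext; rfl }
    rw [charLift_eq (l := (charLift φ).comp m) (fun v => by
      rw [hρ, ← γ.expDom_lie, charLift_spec]; rfl)] at h1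
    have h2 := charLattice_spec φ (γ.lat g⁻¹ v)
    rw [GRep.dual_apply]
    exact_mod_cast h1.trans h2.symm

end ArClass

end

section

open NumberField IsDedekindDomain
open scoped nonZeroDivisors

namespace ArClass

variable {F : Type} [Field F] [NumberField F] (S : Set (HeightOneSpectrum (𝓞 F)))

instance : IsFractionRing (S.integer F) F := by
  refine IsFractionRing.of_field _ _ fun z => ?_
  obtain ⟨a, b, _, rfl⟩ := IsFractionRing.div_surjective (A := 𝓞 F) z
  exact ⟨algebraMap (𝓞 F) _ a, algebraMap (𝓞 F) _ b, rfl⟩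

theorem valuation_eq_exp_count (q : HeightOneSpectrum (𝓞 F)) {x : F} (hx : x ≠ 0) :
    q.valuation F x = WithZero.exp
      (-FractionalIdeal.count F q (FractionalIdeal.spanSingleton (𝓞 F)⁰ x)) := by
  classical
  have key : ∀ a : 𝓞 F, a ≠ 0 → q.valuation F (algebraMap (𝓞 F) F a) = WithZero.exp
      (-FractionalIdeal.count F q
        (FractionalIdeal.spanSingleton (𝓞 F)⁰ (algebraMap (𝓞 F) F a))) := by
    intro a ha
    have h0 : Ideal.span {a} ≠ 0 := by simpa using ha
    rw [HeightOneSpectrum.valuation_of_algebraMap, q.intValuation_if_neg ha,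
      ← FractionalIdeal.coeIdeal_span_singleton, FractionalIdeal.count_coe F q h0]
  obtain ⟨a, b, hb, rfl⟩ := IsFractionRing.div_surjective (A := 𝓞 F) x
  have hb0 : b ≠ 0 := nonZeroDivisors.ne_zero hb
  have ha0 : a ≠ 0 := by rintro rfl; simp at hx
  rw [map_div₀, key a ha0, key b hb0, div_eq_mul_inv (algebraMap (𝓞 F) F a),
    ← FractionalIdeal.spanSingleton_mul_spanSingleton, FractionalIdeal.count_mul,
    ← FractionalIdeal.spanSingleton_inv, FractionalIdeal.count_inv, ← WithZero.exp_sub]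
  · congr 1; ring
  · simpa [FractionalIdeal.spanSingleton_eq_zero_iff] using ha0
  · simpa [FractionalIdeal.spanSingleton_eq_zero_iff] using hb0

theorem valuation_le_of_mem (q : HeightOneSpectrum (𝓞 F)) {I : FractionalIdeal (𝓞 F)⁰ F} {x : F}
    (hx : x ∈ I) : q.valuation F x ≤ WithZero.exp (-FractionalIdeal.count F q I) := by
  by_cases h0 : x = 0
  · simp [h0]
  rw [valuation_eq_exp_count q h0, WithZero.exp_le_exp, neg_le_neg_iff]
  exact FractionalIdeal.count_mono F q (by simpa [FractionalIdeal.spanSingleton_eq_zero_iff] using h0)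
    ((FractionalIdeal.spanSingleton_le_iff_mem).2 hx)

/-- Extension of fractional ideals to the ring of `S`-integers. -/
noncomputable def ext : IdealGroup F →* (FractionalIdeal (S.integer F)⁰ F)ˣ :=
  Units.map (FractionalIdeal.extendedHom F (S.integer F) (A := 𝓞 F) (K := F)).toMonoidHom

theorem isLocalization_map_eq (h : (𝓞 F)⁰ ≤ Submonoid.comap (algebraMap (𝓞 F) (S.integer F))
    (S.integer F)⁰) :
    IsLocalization.map (S := F) F (algebraMap (𝓞 F) (S.integer F)) h = RingHom.id F :=
  IsLocalization.ringHom_ext (𝓞 F)⁰ (by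
    ext x
    simp only [RingHom.comp_apply, IsLocalization.map_eq]; rfl)

theorem mem_ext (I : IdealGroup F) (x : F) :
    x ∈ (ext S I : FractionalIdeal (S.integer F)⁰ F) ↔
      x ∈ Submodule.span (S.integer F) ((I : FractionalIdeal (𝓞 F)⁰ F) : Set F) := by
  change x ∈ FractionalIdeal.extended F _ _ ↔ _
  rw [FractionalIdeal.mem_extended_iff, isLocalization_map_eq]
  simp

theorem ext_principal (a : Fˣ) :
    ext S (toPrincipalIdeal (𝓞 F) F a) = toPrincipalIdeal (S.integer F) F a := by
  refine Units.ext (FractionalIdeal.ext fun x => ?_)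
  rw [mem_ext, coe_toPrincipalIdeal, coe_toPrincipalIdeal, FractionalIdeal.mem_spanSingleton]
  rw [← Submodule.mem_span_singleton (R := S.integer F)]
  have : Submodule.span (S.integer F)
      ((FractionalIdeal.spanSingleton (𝓞 F)⁰ (a : F) : FractionalIdeal (𝓞 F)⁰ F) : Set F) =
      Submodule.span (S.integer F) {(a : F)} := by
    apply le_antisymm
    · rw [Submodule.span_le]
      intro y hy
      obtain ⟨z, rfl⟩ := FractionalIdeal.mem_spanSingleton _ |>.1 hy
      exact Submodule.mem_span_singleton.2 ⟨algebraMap (𝓞 F) _ z, rfl⟩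
    · exact Submodule.span_mono (by
        simpa using FractionalIdeal.mem_spanSingleton_self (𝓞 F)⁰ (a : F))
  rw [this]

theorem principal_eq_one_iff (a : Fˣ) : toPrincipalIdeal (S.integer F) F a = 1 ↔ a ∈ S.unit F := by
  rw [toPrincipalIdeal_eq_iff]
  constructor
  · intro h q hq
    have h1 : (a : F) ∈ (1 : FractionalIdeal (S.integer F)⁰ F) := by
      rw [← Units.val_one, ← h]; exact FractionalIdeal.mem_spanSingleton_self _ _
    have h2 : (1 : F) ∈ FractionalIdeal.spanSingleton (S.integer F)⁰ (a : F) := by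
      rw [h]; exact FractionalIdeal.one_mem_one _
    obtain ⟨r, hr⟩ := (FractionalIdeal.mem_one_iff _).1 h1
    obtain ⟨s, hs⟩ := (FractionalIdeal.mem_spanSingleton _).1 h2
    have h3 := r.2 q hq
    have h4 := s.2 q hq
    refine le_antisymm (by rw [← hr]; exact h3) ?_
    have := congrArg (q.valuation F) hs
    rw [Algebra.smul_def, map_mul, map_one] at this
    rw [← this]
    exact mul_le_of_le_one_left' h4
  · intro h
    refine FractionalIdeal.ext fun x => ?_
    rw [FractionalIdeal.mem_spanSingleton, Units.val_one, FractionalIdeal.mem_one_iff]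
    constructor
    · rintro ⟨z, rfl⟩
      exact ⟨z * ((S.unitEquivUnitsInteger F ⟨a, h⟩ : (S.integer F)ˣ) : S.integer F), rfl⟩
    · rintro ⟨z, rfl⟩
      refine ⟨z * (((S.unitEquivUnitsInteger F ⟨a, h⟩)⁻¹ : (S.integer F)ˣ) : S.integer F), ?_⟩
      rw [Algebra.smul_def, map_mul, mul_assoc]
      have : algebraMap (S.integer F) F
        (((S.unitEquivUnitsInteger F ⟨a, h⟩)⁻¹ : (S.integer F)ˣ) : S.integer F) * (a : F) = 1 := by
        change ((a⁻¹ : Fˣ) : F) * (a : F) = 1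
        simp
      rw [this, mul_one]

/-- The fractional ideal of a prime. -/
noncomputable def primeIdl (p : HeightOneSpectrum (𝓞 F)) : IdealGroup F :=
  Units.mk0 (p.asIdeal : FractionalIdeal (𝓞 F)⁰ F) (by simpa using p.ne_bot)

theorem le_one_iff_of_span {I : IdealGroup F} (h : ∀ x ∈ (I : FractionalIdeal (𝓞 F)⁰ F),
    x ∈ S.integer F) : (ext S I : FractionalIdeal (S.integer F)⁰ F) ≤ 1 := by
  intro x hx
  have : Submodule.span (S.integer F) ((I : FractionalIdeal (𝓞 F)⁰ F) : Set F) ≤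
      Submodule.span (S.integer F) {(1 : F)} := by
    rw [Submodule.span_le]
    intro y hy
    exact Submodule.mem_span_singleton.2 ⟨⟨y, h y hy⟩, by
      rw [Algebra.smul_def, mul_one]; rfl⟩
  obtain ⟨z, rfl⟩ := Submodule.mem_span_singleton.1 (this ((mem_ext S I x).1 hx))
  exact (FractionalIdeal.mem_one_iff _).2 ⟨z, by rw [Algebra.smul_def, mul_one]⟩

theorem count_primeIdl (p q : HeightOneSpectrum (𝓞 F)) [Decidable (p = q)] :
    FractionalIdeal.count F q (primeIdl p : FractionalIdeal (𝓞 F)⁰ F) = if p = q then 1 else 0 :=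
  FractionalIdeal.count_maximal F q p

theorem ext_primeIdl {p : HeightOneSpectrum (𝓞 F)} (hp : p ∈ S) : ext S (primeIdl p) = 1 := by
  classical
  have h1 : (ext S (primeIdl p) : FractionalIdeal (S.integer F)⁰ F) ≤ 1 := by
    refine le_one_iff_of_span S fun x hx q hq => (valuation_le_of_mem q hx).trans ?_
    rw [count_primeIdl, if_neg (by rintro rfl; exact hq hp)]; simp
  have h2 : (ext S (primeIdl p)⁻¹ : FractionalIdeal (S.integer F)⁰ F) ≤ 1 := by
    refine le_one_iff_of_span S fun x hx q hq => (valuation_le_of_mem q hx).trans ?_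
    rw [Units.val_inv_eq_inv_val, FractionalIdeal.count_inv,
      count_primeIdl, if_neg (by rintro rfl; exact hq hp)]; simp
  refine Units.ext (le_antisymm h1 ?_)
  have : (ext S (primeIdl p) : FractionalIdeal (S.integer F)⁰ F) *
    (ext S (primeIdl p)⁻¹ : FractionalIdeal (S.integer F)⁰ F) = 1 := by
    rw [← Units.val_mul, ← map_mul, mul_inv_cancel, map_one, Units.val_one]
  rw [Units.val_one, ← this]
  exact mul_le_of_le_one_right' h2

theorem count_nonpos_of_ext_eq_one {I : IdealGroup F} (h : ext S I = 1)
    {q : HeightOneSpectrum (𝓞 F)} (hq : q ∉ S) :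
    FractionalIdeal.count F q (I : FractionalIdeal (𝓞 F)⁰ F) ≤ 0 := by
  have h1 : (1 : F) ∈ (ext S I : FractionalIdeal (S.integer F)⁰ F) := by
    rw [h]; exact FractionalIdeal.one_mem_one _
  rw [mem_ext] at h1
  have key : ∀ x ∈ Submodule.span (S.integer F) ((I : FractionalIdeal (𝓞 F)⁰ F) : Set F),
      q.valuation F x ≤ WithZero.exp
        (-FractionalIdeal.count F q (I : FractionalIdeal (𝓞 F)⁰ F)) := by
    intro x hx
    induction hx using Submodule.span_induction with
    | mem x hx => exact valuation_le_of_mem q hx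
    | zero => simp
    | add x y _ _ hx hy => exact (Valuation.map_add _ _ _).trans (max_le hx hy)
    | smul a x _ hx =>
      rw [Algebra.smul_def, map_mul]
      exact (mul_le_of_le_one_left' (a.2 q hq)).trans hx
  have := key 1 h1
  rw [map_one, ← WithZero.exp_zero, WithZero.exp_le_exp] at this
  linarith

theorem count_eq_zero_of_ext_eq_one {I : IdealGroup F} (h : ext S I = 1)
    {q : HeightOneSpectrum (𝓞 F)} (hq : q ∉ S) :
    FractionalIdeal.count F q (I : FractionalIdeal (𝓞 F)⁰ F) = 0 := by
  refine le_antisymm (count_nonpos_of_ext_eq_one S h hq) ?_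
  have := count_nonpos_of_ext_eq_one S (I := I⁻¹) (by rw [map_inv, h, inv_one]) hq
  rw [Units.val_inv_eq_inv_val, FractionalIdeal.count_inv] at this
  linarith

/-- Products of powers of the primes in `S`. -/
noncomputable def sIdl : ({v // v ∈ S} →₀ ℤ) →+ Additive (IdealGroup F) :=
  Finsupp.liftAddHom fun p => (zmultiplesHom _) (Additive.ofMul (primeIdl p.1))

theorem sIdl_single (p : {v // v ∈ S}) (n : ℤ) :
    sIdl S (Finsupp.single p n) = n • Additive.ofMul (primeIdl p.1) := by
  simp [sIdl]

theorem ext_sIdl (n : {v // v ∈ S} →₀ ℤ) : ext S (sIdl S n).toMul = 1 := by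
  induction n using Finsupp.induction_linear with
  | zero => simp
  | add f g hf hg => rw [map_add, toMul_add, map_mul, hf, hg, mul_one]
  | single p n => rw [sIdl_single, toMul_zsmul, map_zpow, toMul_ofMul, ext_primeIdl S p.2, one_zpow]

theorem count_sIdl (n : {v // v ∈ S} →₀ ℤ) (p : {v // v ∈ S}) :
    FractionalIdeal.count F p.1 ((sIdl S n).toMul : FractionalIdeal (𝓞 F)⁰ F) = n p := by
  classical
  induction n using Finsupp.induction_linear with
  | zero => simp [FractionalIdeal.count_one]
  | add f g hf hg =>
    rw [map_add, toMul_add, Units.val_mul, FractionalIdeal.count_mul F p.1 (Units.ne_zero _)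
      (Units.ne_zero _), hf, hg, Finsupp.add_apply]
  | single q n =>
    rw [sIdl_single, toMul_zsmul, Units.val_zpow_eq_zpow_val, FractionalIdeal.count_zpow,
      toMul_ofMul, count_primeIdl, Finsupp.single_apply]
    simp [Subtype.ext_iff]

theorem idl_ext_of_count {I J : IdealGroup F}
    (h : ∀ q, FractionalIdeal.count F q (I : FractionalIdeal (𝓞 F)⁰ F) =
      FractionalIdeal.count F q (J : FractionalIdeal (𝓞 F)⁰ F)) : I = J := by
  refine Units.ext ?_
  rw [← FractionalIdeal.finprod_heightOneSpectrum_factorization' F (Units.ne_zero I),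
    ← FractionalIdeal.finprod_heightOneSpectrum_factorization' F (Units.ne_zero J)]
  simp_rw [h]

theorem exists_sIdl (hS : S.Finite) {I : IdealGroup F} (h : ext S I = 1) :
    ∃ n, sIdl S n = Additive.ofMul I := by
  have := hS.to_subtype
  refine ⟨Finsupp.equivFunOnFinite.symm fun p =>
    FractionalIdeal.count F p.1 (I : FractionalIdeal (𝓞 F)⁰ F), ?_⟩
  refine Additive.toMul.injective (idl_ext_of_count fun q => ?_)
  by_cases hq : q ∈ S
  · rw [count_sIdl S _ ⟨q, hq⟩]; simp
  · rw [count_eq_zero_of_ext_eq_one S (ext_sIdl S _) hq, toMul_ofMul,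
      count_eq_zero_of_ext_eq_one S h hq]

end ArClass

end

section

open NumberField IsDedekindDomain
open scoped nonZeroDivisors

namespace ArClass

variable {F : Type} [Field F] [NumberField F] (S : Set (HeightOneSpectrum (𝓞 F)))

/-- The class of the extension of an ideal to the `S`-integers. -/
noncomputable def extCls : IdealGroup F →* ClassGroup (S.integer F) :=
  (ClassGroup.mk (K := F)).comp (ext S)

theorem extCls_principal (a : Fˣ) : extCls S (toPrincipalIdeal (𝓞 F) F a) = 1 := by
  rw [extCls, MonoidHom.comp_apply, ext_principal, ClassGroup.mk_eq_one_iff, coe_toPrincipalIdeal]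
  exact ⟨⟨a, by simp⟩⟩

theorem exists_of_extCls_eq_one {I : IdealGroup F} (h : extCls S I = 1) :
    ∃ a : Fˣ, ext S I = toPrincipalIdeal (S.integer F) F a := by
  rw [extCls, MonoidHom.comp_apply, ClassGroup.mk_eq_one_iff] at h
  obtain ⟨a, ha⟩ := h.1
  have ha0 : a ≠ 0 := by
    rintro rfl
    have : (ext S I : FractionalIdeal (S.integer F)⁰ F) = 0 :=
      FractionalIdeal.coeToSubmodule_injective (by beta_reduce; rw [ha]; simp)
    exact (ext S I).ne_zero this
  refine ⟨Units.mk0 a ha0, Units.ext (FractionalIdeal.coeToSubmodule_injective ?_)⟩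
  beta_reduce
  rw [ha, coe_toPrincipalIdeal, FractionalIdeal.coe_spanSingleton, Units.val_mk0]

theorem extCls_surjective [IsDedekindDomain (S.integer F)] : Function.Surjective (extCls S) := by
  intro c
  obtain ⟨J, rfl⟩ := ClassGroup.mk0_surjective c
  obtain ⟨s, hs⟩ := (isNoetherianRing_iff_ideal_fg _).1 inferInstance (J : Ideal (S.integer F))
  let I : FractionalIdeal (𝓞 F)⁰ F := FractionalIdeal.spanFinset (𝓞 F) s (fun x => (x : F))
  have hspan : Submodule.span (S.integer F) (I : Set F) =
      ((J : Ideal (S.integer F)) : FractionalIdeal (S.integer F)⁰ F) := by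
    rw [FractionalIdeal.coe_coeIdeal, IsLocalization.coeSubmodule, ← hs]
    apply le_antisymm
    · rw [Submodule.span_le]
      intro y hy
      change y ∈ Submodule.span _ _ at hy
      induction hy using Submodule.span_induction with
      | mem x hx =>
        obtain ⟨z, hz, rfl⟩ := hx
        exact ⟨z, Submodule.subset_span hz, rfl⟩
      | zero => exact Submodule.zero_mem _
      | add x y _ _ hx hy => exact Submodule.add_mem _ hx hy
      | smul a x _ hx => exact Submodule.smul_mem _ (algebraMap (𝓞 F) (S.integer F) a) hx
    · rw [Submodule.map_span_le]
      intro z hz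
      exact Submodule.subset_span (Submodule.subset_span ⟨z, hz, rfl⟩)
  have hJ : ((J : Ideal (S.integer F)) : FractionalIdeal (S.integer F)⁰ F) ≠ 0 := by
    simpa using nonZeroDivisors.ne_zero J.2
  have hI : I ≠ 0 := by
    intro h
    apply hJ
    apply FractionalIdeal.coeToSubmodule_injective
    beta_reduce
    rw [← hspan, h]; simp
  refine ⟨Units.mk0 I hI, ?_⟩
  rw [← ClassGroup.mk_mk0 F, extCls, MonoidHom.comp_apply]
  congr 1
  refine Units.ext (FractionalIdeal.ext fun x => ?_)
  rw [mem_ext, Units.val_mk0, hspan]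
  rfl

theorem exists_integral [IsDedekindDomain (S.integer F)] (e : F ≃+* F)
    (he : ∀ x, x ∈ S.integer F → e x ∈ S.integer F)
    {I J : (FractionalIdeal (S.integer F)⁰ F)ˣ}
    (h : ∀ a, e a ∈ (J : FractionalIdeal (S.integer F)⁰ F) ↔
      a ∈ (I : FractionalIdeal (S.integer F)⁰ F)) :
    ∃ I₀ J₀ : (Ideal (S.integer F))⁰, ClassGroup.mk0 I₀ = ClassGroup.mk (K := F) I ∧
      ClassGroup.mk0 J₀ = ClassGroup.mk (K := F) J ∧
      (fun x : S.integer F => (x : F)) '' ((J₀ : Ideal (S.integer F)) : Set (S.integer F)) =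
        e '' ((fun x : S.integer F => (x : F)) ''
          ((I₀ : Ideal (S.integer F)) : Set (S.integer F))) := by
  have clear : ∀ (I : (FractionalIdeal (S.integer F)⁰ F)ˣ) (a : Fˣ),
      (∀ b ∈ (I : FractionalIdeal (S.integer F)⁰ F), (a : F) * b ∈ S.integer F) →
      ∃ I₀ : (Ideal (S.integer F))⁰, ClassGroup.mk0 I₀ = ClassGroup.mk (K := F) I ∧
        ∀ x, x ∈ (fun x : S.integer F => (x : F)) ''
          ((I₀ : Ideal (S.integer F)) : Set (S.integer F)) ↔
          ∃ b ∈ (I : FractionalIdeal (S.integer F)⁰ F), (a : F) * b = x := by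
    intro I a ha
    let I' : (FractionalIdeal (S.integer F)⁰ F)ˣ := toPrincipalIdeal (S.integer F) F a * I
    have hI' : ∀ x, x ∈ (I' : FractionalIdeal (S.integer F)⁰ F) ↔
        ∃ b ∈ (I : FractionalIdeal (S.integer F)⁰ F), (a : F) * b = x := by
      intro x
      rw [Units.val_mul, coe_toPrincipalIdeal, FractionalIdeal.mem_singleton_mul]
      simp only [eq_comm]
    have hle : (I' : FractionalIdeal (S.integer F)⁰ F) ≤ 1 := by
      intro x hx
      obtain ⟨b, hb, rfl⟩ := (hI' x).1 hx
      exact (FractionalIdeal.mem_one_iff _).2 ⟨⟨_, ha b hb⟩, rfl⟩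
    obtain ⟨I₀, hI₀⟩ := FractionalIdeal.le_one_iff_exists_coeIdeal.1 hle
    have hI₀0 : I₀ ≠ 0 := by
      rintro rfl
      exact I'.ne_zero (by rw [← hI₀]; simp)
    refine ⟨⟨I₀, mem_nonZeroDivisors_of_ne_zero hI₀0⟩, ?_, fun x => ?_⟩
    · have h1 : ClassGroup.mk (K := F) (toPrincipalIdeal (S.integer F) F a) = 1 := by
        rw [ClassGroup.mk_eq_one_iff, coe_toPrincipalIdeal]
        exact ⟨⟨a, by simp⟩⟩
      have h2 : ClassGroup.mk (K := F) I' = ClassGroup.mk (K := F) I := by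
        rw [map_mul, h1, one_mul]
      rw [← h2, ← ClassGroup.mk_mk0 F]
      congr 1
      exact Units.ext hI₀
    · rw [← hI', ← hI₀, FractionalIdeal.mem_coeIdeal]
      rfl
  obtain ⟨a, ha, ha'⟩ := (I : FractionalIdeal (S.integer F)⁰ F).isFractional
  have ha0 : (a : F) ≠ 0 := by simpa using nonZeroDivisors.ne_zero ha
  obtain ⟨I₀, h1, h2⟩ := clear I (Units.mk0 (a : F) ha0) fun b hb => by
    obtain ⟨c, hc⟩ := ha' b hb
    rw [Units.val_mk0]
    change a • b ∈ _
    rw [← hc]; exact c.2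
  obtain ⟨J₀, h3, h4⟩ := clear J (Units.map (e : F →* F) (Units.mk0 (a : F) ha0)) fun b hb => by
    obtain ⟨b, rfl⟩ := e.surjective b
    obtain ⟨c, hc⟩ := ha' b ((h b).1 hb)
    have : e ((a : F) * b) ∈ S.integer F := he _ (by
      change a • b ∈ _
      rw [← hc]; exact c.2)
    rw [map_mul] at this
    exact this
  refine ⟨I₀, J₀, h1, h3, ?_⟩
  ext x
  rw [h4]
  constructor
  · rintro ⟨b, hb, rfl⟩
    obtain ⟨b, rfl⟩ := e.surjective b
    exact ⟨(a : F) * b, (h2 _).2 ⟨b, (h b).1 hb, rfl⟩, map_mul _ _ _⟩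
  · rintro ⟨y, hy, rfl⟩
    obtain ⟨b, hb, rfl⟩ := (h2 _).1 hy
    exact ⟨e b, (h b).2 hb, (map_mul e _ _).symm⟩

end ArClass

end

section

open NumberField IsDedekindDomain
open scoped nonZeroDivisors

theorem GRep.cls_exact_six {G : Type} [Group G] {A B C D E H : Type} [AddCommGroup A]
    [AddCommGroup B] [AddCommGroup C] [AddCommGroup D] [AddCommGroup E] [AddCommGroup H]
    [Module.Finite ℤ A] [Module.Finite ℤ B] [Module.Finite ℤ C]
    [Module.Finite ℤ D] [Module.Finite ℤ E] [Module.Finite ℤ H]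
    (ρA : G →* AddMonoid.End A) (ρB : G →* AddMonoid.End B) (ρC : G →* AddMonoid.End C)
    (ρD : G →* AddMonoid.End D) (ρE : G →* AddMonoid.End E) (ρH : G →* AddMonoid.End H)
    (f₁ : A →+ B) (f₂ : B →+ C) (f₃ : C →+ D) (f₄ : D →+ E) (f₅ : E →+ H)
    (hf : Function.Injective f₁) (hk : Function.Surjective f₅)
    (h₁ : Function.Exact f₁ f₂) (h₂ : Function.Exact f₂ f₃) (h₃ : Function.Exact f₃ f₄)
    (h₄ : Function.Exact f₄ f₅)
    (e₁ : ∀ s x, f₁ (ρA s x) = ρB s (f₁ x)) (e₂ : ∀ s x, f₂ (ρB s x) = ρC s (f₂ x))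
    (e₃ : ∀ s x, f₃ (ρC s x) = ρD s (f₃ x)) (e₄ : ∀ s x, f₄ (ρD s x) = ρE s (f₄ x))
    (e₅ : ∀ s x, f₅ (ρE s x) = ρH s (f₅ x)) :
    cls ρA + cls ρC + cls ρE = cls ρB + cls ρD + cls ρH := by
  have hst : ∀ s, ∀ x ∈ f₃.range, ρD s x ∈ f₃.range := by
    rintro s _ ⟨y, rfl⟩
    exact ⟨ρC s y, e₃ s y⟩
  have : Module.Finite ℤ f₃.range :=
    Module.Finite.of_surjective f₃.rangeRestrict.toIntLinearMap f₃.rangeRestrict_surjective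
  have h1 := cls_exact_four ρA ρB ρC (restrict ρD f₃.range hst) f₁ f₂ f₃.rangeRestrict hf
    f₃.rangeRestrict_surjective h₁ (fun x => by rw [← h₂ x, Subtype.ext_iff]; rfl) e₁ e₂
    (fun s x => Subtype.ext (e₃ s x))
  have h2 := cls_exact_four (restrict ρD f₃.range hst) ρD ρE ρH f₃.range.subtype f₄ f₅
    Subtype.coe_injective hk (fun x => by rw [h₃ x]; simp) h₄ (fun s x => rfl) e₄ e₅
  rw [h1, add_assoc, h2, add_assoc]

namespace ArClass

variable {F : Type} [Field F] [NumberField F] {G : Type} [Group G]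
  (S : Set (HeightOneSpectrum (𝓞 F))) (γ : GalAction F G)

theorem prin_injective : Function.Injective (prin F) := by
  intro a b h
  obtain ⟨φ⟩ : Nonempty (F →+* ℂ) := inferInstance
  have : φ (a.toMul : F) = φ (b.toMul : F) :=
    (cpt_prin a.toMul φ).symm.trans ((congrArg (fun x => cpt x φ) h).trans (cpt_prin b.toMul φ))
  exact Additive.toMul.injective (Units.ext (φ.injective this))

/-- The oriented Arakelov divisors supported on `S`. -/
noncomputable def sDom : AddSubgroup (Additive (picDom F)) where
  carrier := {x | ext S (idl x) = 1}
  zero_mem' := by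
    change ext S (idl 0) = 1
    rw [idl_zero, map_one]
  add_mem' {x y} (hx : ext S (idl x) = 1) (hy : ext S (idl y) = 1) := by
    change ext S (idl (x + y)) = 1
    rw [idl_add, map_mul, hx, hy, one_mul]
  neg_mem' {x} (hx : ext S (idl x) = 1) := by
    change ext S (idl (-x)) = 1
    rw [idl_neg, map_inv, hx, inv_one]

theorem mem_sDom {x : Additive (picDom F)} : x ∈ sDom S ↔ ext S (idl x) = 1 := Iff.rfl

theorem expDom_mem_sDom (v : normZero F) : expDom F v ∈ sDom S := by
  rw [mem_sDom, idl_expDom, map_one]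

theorem prin_mem_sDom {a : Fˣ} : prin F (Additive.ofMul a) ∈ sDom S ↔ a ∈ S.unit F := by
  rw [mem_sDom, idl_prin, ext_principal, principal_eq_one_iff]

/-- Stability of `S` under `G`, expressed through the `S`-integers. -/
def Stable : Prop := ∀ g, ∀ x ∈ S.integer F, γ.fld g x ∈ S.integer F

variable {S γ}

theorem Stable.mem_iff (h : Stable S γ) (g : G) (x : F) :
    γ.fld g x ∈ S.integer F ↔ x ∈ S.integer F :=
  ⟨fun hx => by simpa [γ.fld_inv_fld] using h g⁻¹ _ hx, h g x⟩

theorem Stable.map_mem_ext (h : Stable S γ) (g : G) {x y : Additive (picDom F)}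
    (hy : ∀ a ∈ (idl x : FractionalIdeal (𝓞 F)⁰ F), γ.fld g a ∈
      (idl y : FractionalIdeal (𝓞 F)⁰ F)) (a : F)
    (ha : a ∈ (ext S (idl x) : FractionalIdeal (S.integer F)⁰ F)) :
    γ.fld g a ∈ (ext S (idl y) : FractionalIdeal (S.integer F)⁰ F) := by
  rw [mem_ext] at ha ⊢
  induction ha using Submodule.span_induction with
  | mem x hx => exact Submodule.subset_span (hy x hx)
  | zero => simp
  | add x y _ _ hx hy => rw [map_add]; exact Submodule.add_mem _ hx hy
  | smul r x _ hx =>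
    rw [Algebra.smul_def, map_mul]
    exact Submodule.smul_mem _ (⟨γ.fld g (r : F), h g _ r.2⟩ : S.integer F) hx

theorem Stable.mem_ext_dom (h : Stable S γ) (g : G) (x : Additive (picDom F)) (a : F) :
    γ.fld g a ∈ (ext S (idl (γ.dom g x)) : FractionalIdeal (S.integer F)⁰ F) ↔
      a ∈ (ext S (idl x) : FractionalIdeal (S.integer F)⁰ F) := by
  refine ⟨fun ha => ?_, h.map_mem_ext g (fun a => (γ.mem_idl g x a).2) a⟩
  have := h.map_mem_ext g⁻¹ (x := γ.dom g x) (y := x) (fun b hb => by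
    rw [← γ.mem_idl g, γ.fld_fld_inv]; exact hb) _ ha
  rwa [γ.fld_inv_fld] at this

theorem Stable.dom_mem_sDom (h : Stable S γ) (g : G) (x : Additive (picDom F)) (hx : x ∈ sDom S) :
    γ.dom g x ∈ sDom S := by
  rw [mem_sDom] at hx ⊢
  refine Units.ext (ideal_ext_of_ringEquiv (γ.fld g) fun a => ?_)
  rw [h.mem_ext_dom, hx, Units.val_one, FractionalIdeal.mem_one_iff, FractionalIdeal.mem_one_iff]
  exact ⟨fun ⟨z, hz⟩ => ⟨⟨_, h g z z.2⟩, by rw [← hz]; rfl⟩,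
    fun ⟨z, hz⟩ => ⟨⟨a, (h.mem_iff g a).1 (by rw [← hz]; exact z.2)⟩, rfl⟩⟩

variable (S) in
/-- The trivial divisors, as a subgroup of the divisors supported on `S`. -/
noncomputable abbrev sExp : AddSubgroup (sDom (F := F) S) := (expDom F).range.addSubgroupOf (sDom S)

variable (S) in
/-- The component group of divisors supported on `S`. -/
abbrev SComp := sDom (F := F) S ⧸ sExp S

/-- The action on the divisors supported on `S`. -/
noncomputable def Stable.sdm (h : Stable S γ) : G →* AddMonoid.End (sDom (F := F) S) :=
  GRep.restrict γ.dom _ h.dom_mem_sDom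

theorem Stable.sdm_mem (h : Stable S γ) (g : G) (x : sDom (F := F) S) (hx : x ∈ sExp S) :
    h.sdm g x ∈ sExp S := by
  obtain ⟨v, hv⟩ := hx
  exact ⟨γ.lie g v, by rw [γ.expDom_lie, hv]; rfl⟩

/-- The action on the component group of divisors supported on `S`. -/
noncomputable def Stable.sc (h : Stable S γ) : G →* AddMonoid.End (SComp (F := F) S) :=
  GRep.quotient h.sdm _ h.sdm_mem

variable (γ) in
/-- The action on the kernel of the exponential. -/
noncomputable def GalAction.kerRep : G →* AddMonoid.End (expDom F).ker :=
  GRep.restrict γ.lie _ γ.lie_mem_ker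

variable (F) in
/-- The inclusion of the kernel of the exponential in the logarithmic lattice. -/
noncomputable def kerIncl : (expDom F).ker →+ logLattice F := AddSubgroup.inclusion ker_expDom_le

variable (S)

theorem exists_latUnit (v : logLattice F) :
    ∃ u : S.unit F, prin F (Additive.ofMul (u : Fˣ)) = expDom F v := by
  obtain ⟨a, ha⟩ := v.2
  exact ⟨⟨a.toMul, (prin_mem_sDom S).1 (by
    change prin F a ∈ _
    rw [ha]; exact expDom_mem_sDom S _)⟩, ha⟩

/-- The exponential of the logarithmic lattice. -/
noncomputable def latUnit : logLattice F →+ Additive (S.unit F) where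
  toFun v := Additive.ofMul (exists_latUnit S v).choose
  map_zero' := by
    refine congrArg Additive.ofMul (Subtype.ext (Additive.ofMul.injective (prin_injective ?_)))
    rw [(exists_latUnit S (0 : logLattice F)).choose_spec]
    exact (map_zero _).trans (map_zero _).symm
  map_add' v w := by
    refine congrArg Additive.ofMul (Subtype.ext (Additive.ofMul.injective (prin_injective ?_)))
    rw [(exists_latUnit S (v + w)).choose_spec]
    refine (map_add (expDom F) _ _).trans ?_
    refine ((congrArg₂ (· + ·) (exists_latUnit S v).choose_spec
      (exists_latUnit S w).choose_spec).symm.trans ?_)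
    rw [← map_add]
    rfl

theorem prin_latUnit (v : logLattice F) :
    prin F (Additive.ofMul (((latUnit S v).toMul : S.unit F) : Fˣ)) = expDom F v :=
  (exists_latUnit S v).choose_spec

theorem latUnit_eq {v : logLattice F} {u : Additive (S.unit F)}
    (h : prin F (Additive.ofMul ((u.toMul : S.unit F) : Fˣ)) = expDom F v) : latUnit S v = u :=
  Additive.toMul.injective (Subtype.ext (Additive.ofMul.injective (prin_injective
    ((prin_latUnit S v).trans h.symm))))

/-- Principal divisors of `S`-units. -/
noncomputable def unitDiv : Additive (S.unit F) →+ SComp (F := F) S :=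
  (QuotientAddGroup.mk' (sExp S)).comp
    (((prin F).comp (S.unit F).subtype.toAdditive).codRestrict (sDom S)
      fun u => (prin_mem_sDom S).2 u.toMul.2)

/-- From divisors supported on `S` to the component group. -/
noncomputable def compMap : SComp (F := F) S →+ CompGroup F :=
  QuotientAddGroup.map (sExp S) _ (sDom S).subtype fun _ hx => AddSubgroup.mem_sup_left hx

/-- The `S`-class of an oriented Arakelov divisor. -/
noncomputable def clsMap : CompGroup F →+ Additive (ClassGroup (S.integer F)) :=
  QuotientAddGroup.lift _
    ({ toFun := fun x => Additive.ofMul (extCls S (idl x))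
       map_zero' := by simp
       map_add' := fun x y => by simp } :
      Additive (picDom F) →+ Additive (ClassGroup (S.integer F))) (by
    refine sup_le ?_ ?_
    · rintro _ ⟨v, rfl⟩
      change Additive.ofMul (extCls S (idl (expDom F v))) = 0
      rw [idl_expDom, map_one]; rfl
    · rintro _ ⟨a, rfl⟩
      change Additive.ofMul (extCls S (idl (prin F (Additive.ofMul a.toMul)))) = 0
      rw [idl_prin, extCls_principal]; rfl)

theorem clsMap_mk (x : Additive (picDom F)) :
    clsMap S (x : CompGroup F) = Additive.ofMul (extCls S (idl x)) := rfl

theorem exact_kerIncl : Function.Exact (kerIncl F) (latUnit S) := by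
  intro v
  constructor
  · intro h
    have h1 := prin_latUnit S v
    rw [h] at h1
    exact ⟨⟨v, h1.symm.trans (map_zero _)⟩, rfl⟩
  · rintro ⟨w, rfl⟩
    exact latUnit_eq S ((map_zero _).trans w.2.symm)

theorem exact_latUnit : Function.Exact (latUnit S) (unitDiv (F := F) S) := by
  intro u
  constructor
  · intro h
    obtain ⟨v, hv⟩ := (QuotientAddGroup.eq_zero_iff _).1 h
    exact ⟨⟨v, ⟨_, hv.symm⟩⟩, latUnit_eq S hv.symm⟩
  · rintro ⟨v, rfl⟩
    exact (QuotientAddGroup.eq_zero_iff _).2 ⟨v, (prin_latUnit S v).symm⟩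

theorem exact_unitDiv : Function.Exact (unitDiv (F := F) S) (compMap S) := by
  intro y
  constructor
  · obtain ⟨⟨x, hx⟩, rfl⟩ := QuotientAddGroup.mk_surjective y
    intro h
    obtain ⟨_, ⟨v, rfl⟩, _, ⟨a, rfl⟩, h⟩ := AddSubgroup.mem_sup.1
      ((QuotientAddGroup.eq_zero_iff (N := (expDom F).range ⊔ (prin F).range) x).1 h)
    have ha : a.toMul ∈ S.unit F := (prin_mem_sDom S).1 (by
      have := (sDom S).sub_mem hx (expDom_mem_sDom S v)
      rw [← h, add_sub_cancel_left] at this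
      exact this)
    refine ⟨Additive.ofMul ⟨a.toMul, ha⟩, (QuotientAddGroup.eq_iff_sub_mem).2 ⟨-v, ?_⟩⟩
    change expDom F (-v) = prin F a - x
    rw [← h, map_neg]; abel
  · rintro ⟨u, rfl⟩
    exact (QuotientAddGroup.eq_zero_iff _).2 (AddSubgroup.mem_sup_right ⟨_, rfl⟩)

theorem exact_compMap : Function.Exact (compMap (F := F) S) (clsMap S) := by
  intro y
  constructor
  · obtain ⟨x, rfl⟩ := QuotientAddGroup.mk_surjective y
    intro h
    obtain ⟨a, ha⟩ := exists_of_extCls_eq_one S (I := idl x) h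
    have hx : x - prin F (Additive.ofMul a) ∈ sDom S := by
      rw [mem_sDom, idl_sub, idl_prin, map_div, ext_principal, ha, div_self']
    refine ⟨((⟨_, hx⟩ : sDom S) : SComp S), (QuotientAddGroup.eq_iff_sub_mem).2 
      (AddSubgroup.mem_sup_right ⟨-Additive.ofMul a, ?_⟩)⟩
    rw [map_neg]
    change _ = x - prin F (Additive.ofMul a) - x
    abel
  · rintro ⟨y, rfl⟩
    obtain ⟨⟨x, hx⟩, rfl⟩ := QuotientAddGroup.mk_surjective y
    change Additive.ofMul (ClassGroup.mk (K := F) (ext S (idl x))) = 0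
    rw [(mem_sDom S).1 hx, map_one]; rfl

theorem exists_dom_of_idl (I : IdealGroup F) (ε : (F →+* ℂ) → ℝ) (hε : ∀ φ, ε φ = 1 ∨ ε φ = -1)
    (hc : ∀ φ, ε (ComplexEmbedding.conjugate φ) = ε φ) :
    ∃ x : Additive (picDom F), idl x = I ∧ ∃ c : ℝ, 0 < c ∧ ∀ φ, cpt x φ = ((ε φ * c : ℝ) : ℂ) := by
  have hpos : (0 : ℝ) < ((FractionalIdeal.absNorm (I : FractionalIdeal (𝓞 F)⁰ F) : ℚ) : ℝ) := by
    have h1 := FractionalIdeal.absNorm_nonneg (I : FractionalIdeal (𝓞 F)⁰ F)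
    have h2 : FractionalIdeal.absNorm (I : FractionalIdeal (𝓞 F)⁰ F) ≠ 0 := fun h =>
      I.ne_zero (FractionalIdeal.absNorm_eq_zero_iff.1 h)
    exact_mod_cast lt_of_le_of_ne h1 h2.symm
  set N : ℝ := ((FractionalIdeal.absNorm (I : FractionalIdeal (𝓞 F)⁰ F) : ℚ) : ℝ) with hN
  set c : ℝ := N ^ ((Fintype.card (F →+* ℂ) : ℝ)⁻¹) with hcdef
  have hc0 : 0 < c := Real.rpow_pos_of_pos hpos _
  have hε0 : ∀ φ, |ε φ| = 1 := fun φ => by rcases hε φ with h | h <;> simp [h]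
  obtain ⟨x, h1, h2⟩ := exists_dom I (fun φ => ((ε φ * c : ℝ) : ℂ)) (fun φ => by
    have : ε φ ≠ 0 := fun h => by have := hε0 φ; simp [h] at this
    exact Complex.ofReal_ne_zero.2 (mul_ne_zero this hc0.ne')) (fun φ => by
    rw [hc, Complex.conj_ofReal]) (by
    rw [← hN]
    have : ∀ φ, ‖((ε φ * c : ℝ) : ℂ)‖ = c := fun φ => by
      rw [Complex.norm_real, Real.norm_eq_abs, abs_mul, hε0, one_mul, abs_of_pos hc0]
    simp only [this]
    rw [Finset.prod_const, Finset.card_univ, hcdef, ← Real.rpow_natCast, ← Real.rpow_mul hpos.le,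
      inv_mul_cancel₀, Real.rpow_one]
    exact_mod_cast Fintype.card_ne_zero)
  exact ⟨x, h1, c, hc0, h2⟩

theorem clsMap_surjective [IsDedekindDomain (S.integer F)] :
    Function.Surjective (clsMap (F := F) S) := by
  intro c
  obtain ⟨I, hI⟩ := extCls_surjective S c.toMul
  obtain ⟨x, hx, -⟩ := exists_dom_of_idl I (fun _ => 1) (fun _ => Or.inl rfl) (fun _ => rfl)
  exact ⟨x, by rw [clsMap_mk, hx, hI]; rfl⟩

end ArClass

end

section

open NumberField IsDedekindDomain
open scoped nonZeroDivisors

namespace ArClass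

variable {F : Type} [Field F] [NumberField F] {G : Type} [Group G]
  {S : Set (HeightOneSpectrum (𝓞 F))} {γ : GalAction F G}

theorem kerIncl_kerRep (g : G) (v : (expDom F).ker) :
    kerIncl F (γ.kerRep g v) = γ.lat g (kerIncl F v) := rfl

theorem latUnit_lat {ρU : G →* AddMonoid.End (Additive (S.unit F))}
    (hU : ∀ g u, (((ρU g u).toMul : S.unit F) : Fˣ) = Units.map (γ.fld g : F →* F)
      ((u.toMul : S.unit F) : Fˣ)) (g : G) (v : logLattice F) :
    latUnit S (γ.lat g v) = ρU g (latUnit S v) := by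
  refine latUnit_eq S ?_
  rw [hU, ← γ.dom_prin, prin_latUnit, ← γ.expDom_lie]
  rfl

theorem unitDiv_rep (h : Stable S γ) {ρU : G →* AddMonoid.End (Additive (S.unit F))}
    (hU : ∀ g u, (((ρU g u).toMul : S.unit F) : Fˣ) = Units.map (γ.fld g : F →* F)
      ((u.toMul : S.unit F) : Fˣ)) (g : G) (u : Additive (S.unit F)) :
    unitDiv S (ρU g u) = h.sc g (unitDiv S u) := by
  refine congrArg (QuotientAddGroup.mk' (sExp S)) (Subtype.ext ?_)
  change prin F (Additive.ofMul (((ρU g u).toMul : S.unit F) : Fˣ)) = _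
  rw [hU, ← γ.dom_prin]
  rfl

theorem compMap_sc (h : Stable S γ) (g : G) (x : SComp (F := F) S) :
    compMap S (h.sc g x) = γ.cg g (compMap S x) := by
  obtain ⟨x, rfl⟩ := QuotientAddGroup.mk_surjective x
  rfl

theorem clsMap_cg [IsDedekindDomain (S.integer F)] (h : Stable S γ)
    {ρC : G →* AddMonoid.End (Additive (ClassGroup (S.integer F)))}
    (hC : ∀ (g : G) (I J : (Ideal (S.integer F))⁰),
      ((fun x : S.integer F => (x : F)) ''
          ((J : Ideal (S.integer F)) : Set (S.integer F)) =
        γ.fld g '' ((fun x : S.integer F => (x : F)) ''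
          ((I : Ideal (S.integer F)) : Set (S.integer F)))) →
      ρC g (Additive.ofMul (ClassGroup.mk0 I)) = Additive.ofMul (ClassGroup.mk0 J))
    (g : G) (x : CompGroup F) : clsMap S (γ.cg g x) = ρC g (clsMap S x) := by
  obtain ⟨x, rfl⟩ := QuotientAddGroup.mk_surjective x
  obtain ⟨I, J, h1, h2, h3⟩ := exists_integral S (γ.fld g) (h g) (h.mem_ext_dom g x)
  have := hC g I J h3
  rw [h1, h2] at this
  exact this.symm

end ArClass

end

section

open NumberField IsDedekindDomain
open scoped nonZeroDivisors

namespace ArClass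

variable {F : Type} [Field F] [NumberField F] {G : Type} [Group G]

/-- All components of the divisor are real of the same absolute value, with signs `ε`. -/
def HasSign (x : Additive (picDom F)) (ε : (F →+* ℂ) → ℝ) : Prop :=
  ∃ c : ℝ, 0 < c ∧ ∀ φ, cpt x φ = ((ε φ * c : ℝ) : ℂ)

theorem HasSign.prod_norm {x : Additive (picDom F)} {ε : (F →+* ℂ) → ℝ} (hε : ∀ φ, |ε φ| = 1)
    {c : ℝ} (hc : 0 < c) (h : ∀ φ, cpt x φ = ((ε φ * c : ℝ) : ℂ)) :
    ∏ φ, ‖cpt x φ‖ = c ^ Fintype.card (F →+* ℂ) := by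
  have : ∀ φ, ‖cpt x φ‖ = c := fun φ => by
    rw [h, Complex.norm_real, Real.norm_eq_abs, abs_mul, hε, one_mul, abs_of_pos hc]
  simp only [this, Finset.prod_const, Finset.card_univ]

theorem HasSign.eq {x y : Additive (picDom F)} {ε : (F →+* ℂ) → ℝ} (hε : ∀ φ, |ε φ| = 1)
    (hx : HasSign x ε) (hy : HasSign y ε) (h : idl x = idl y) : x = y := by
  obtain ⟨c, hc, hx⟩ := hx
  obtain ⟨d, hd, hy⟩ := hy
  have h1 : c ^ Fintype.card (F →+* ℂ) = d ^ Fintype.card (F →+* ℂ) := by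
    rw [← HasSign.prod_norm hε hc hx, ← HasSign.prod_norm hε hd hy, ← absNorm_idl,
      ← absNorm_idl, h]
  have h2 : c = d := (pow_left_inj₀ hc.le hd.le Fintype.card_ne_zero).1 h1
  exact dom_ext h fun φ => by rw [hx, hy, h2]

theorem HasSign.cpt_eq {x : Additive (picDom F)} {ε : (F →+* ℂ) → ℝ} (hε : ∀ φ, |ε φ| = 1)
    (hx : HasSign x ε) (h : idl x = 1) (φ : F →+* ℂ) : cpt x φ = (ε φ : ℂ) := by
  obtain ⟨c, hc, hx⟩ := hx
  have h1 : c ^ Fintype.card (F →+* ℂ) = 1 ^ Fintype.card (F →+* ℂ) := by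
    rw [← HasSign.prod_norm hε hc hx, ← absNorm_idl, h]; simp
  have h2 : c = 1 := (pow_left_inj₀ hc.le zero_le_one Fintype.card_ne_zero).1 h1
  rw [hx, h2, mul_one]

theorem HasSign.add {x y : Additive (picDom F)} {ε η : (F →+* ℂ) → ℝ}
    (hx : HasSign x ε) (hy : HasSign y η) : HasSign (x + y) (fun φ => ε φ * η φ) := by
  obtain ⟨c, hc, hx⟩ := hx
  obtain ⟨d, hd, hy⟩ := hy
  refine ⟨c * d, mul_pos hc hd, fun φ => ?_⟩
  rw [cpt_add, hx, hy, ← Complex.ofReal_mul]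
  congr 1
  ring

/-- Every divisor has components in the slit plane up to signs. -/
theorem exists_sign (x : Additive (picDom F)) : ∃ ε : (F →+* ℂ) → ℝ, (∀ φ, ε φ = 1 ∨ ε φ = -1) ∧
    (∀ φ, ε (ComplexEmbedding.conjugate φ) = ε φ) ∧
    ∀ φ (c : ℝ), 0 < c → cpt x φ * (((ε φ * c : ℝ) : ℂ))⁻¹ ∈ Complex.slitPlane := by
  classical
  refine ⟨fun φ => if cpt x φ ∈ Complex.slitPlane then 1 else -1, fun φ => ?_, fun φ => ?_,
    fun φ c hc => ?_⟩
  · beta_reduce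
    split_ifs <;> simp
  · beta_reduce
    rw [cpt_conjugate]
    have : (starRingEnd ℂ) (cpt x φ) ∈ Complex.slitPlane ↔ cpt x φ ∈ Complex.slitPlane := by
      simp [Complex.mem_slitPlane_iff]
    simp only [this]
  · rw [← Complex.ofReal_inv, mul_comm, Complex.mem_slitPlane_iff, Complex.re_ofReal_mul,
      Complex.im_ofReal_mul]
    beta_reduce
    split_ifs with h
    · rw [one_mul]
      have := inv_pos.2 hc
      exact ((Complex.mem_slitPlane_iff).1 h).imp (mul_pos this) (mul_ne_zero this.ne')
    · rw [Complex.mem_slitPlane_iff, not_or, not_lt, not_not] at h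
      left
      have h0 : (cpt x φ).re ≠ 0 := fun h0 => cpt_ne_zero x φ (Complex.ext h0 h.2)
      have h1 : (cpt x φ).re < 0 := lt_of_le_of_ne h.1 h0
      refine mul_pos_of_neg_of_neg ?_ h1
      rw [neg_one_mul, inv_neg]
      exact neg_neg_of_pos (inv_pos.2 hc)

theorem HasSign.sub_mem {x y : Additive (picDom F)} {ε : (F →+* ℂ) → ℝ} (hy : HasSign y ε)
    (h : ∀ φ (c : ℝ), 0 < c → cpt x φ * (((ε φ * c : ℝ) : ℂ))⁻¹ ∈ Complex.slitPlane)
    (hi : idl x = idl y) : ∃ v, expDom F v = x - y := by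
  obtain ⟨c, hc, hy⟩ := hy
  obtain ⟨v, hv, -⟩ := exists_expDom_eq (x - y) (by rw [idl_sub, hi, div_self']) (fun φ => by
    rw [cpt_sub, hy, div_eq_mul_inv]
    exact h φ c hc)
  exact ⟨v, hv⟩

variable (S : Set (HeightOneSpectrum (𝓞 F)))

/-- The archimedean places together with the places in `S`. -/
abbrev Places := InfinitePlace F ⊕ {v // v ∈ S}

/-- The signs attached to an integral function on the places. -/
noncomputable def sgn (n : Places S →₀ ℤ) (φ : F →+* ℂ) : ℝ :=
  (-1) ^ n (Sum.inl (InfinitePlace.mk φ))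

variable {S} in
theorem sgn_eq (n : Places S →₀ ℤ) (φ : F →+* ℂ) : sgn S n φ = 1 ∨ sgn S n φ = -1 := by
  rcases Int.even_or_odd (n (Sum.inl (InfinitePlace.mk φ))) with h | h
  · exact Or.inl h.neg_one_zpow
  · exact Or.inr h.neg_one_zpow

variable {S} in
theorem abs_sgn (n : Places S →₀ ℤ) (φ : F →+* ℂ) : |sgn S n φ| = 1 := by
  rcases sgn_eq n φ with h | h <;> simp [h]

variable {S} in
theorem sgn_add (m n : Places S →₀ ℤ) (φ : F →+* ℂ) : sgn S (m + n) φ = sgn S m φ * sgn S n φ :=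
  zpow_add₀ (by norm_num) _ _

/-- The finite part of an integral function on the places. -/
noncomputable def fin : (Places S →₀ ℤ) →+ ({v // v ∈ S} →₀ ℤ) :=
  (AddMonoidHom.snd _ _).comp
    (Finsupp.sumFinsuppAddEquivProdFinsupp (M := ℤ) (α := InfinitePlace F)).toAddMonoidHom

variable {S} in
theorem fin_apply (n : Places S →₀ ℤ) (p : {v // v ∈ S}) : fin S n p = n (Sum.inr p) :=
  Finsupp.snd_sumFinsuppAddEquivProdFinsupp _ _

theorem exists_placeDiv (n : Places S →₀ ℤ) : ∃ x : Additive (picDom F),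
    idl x = (sIdl S (fin S n)).toMul ∧ HasSign x (sgn S n) :=
  exists_dom_of_idl _ _ (sgn_eq n) fun φ => by
    rw [sgn, InfinitePlace.mk_conjugate_eq]; rfl

/-- The divisor attached to an integral function on the places. -/
noncomputable def placeDiv : (Places S →₀ ℤ) →+ Additive (picDom F) where
  toFun n := (exists_placeDiv S n).choose
  map_zero' := by
    have h := (exists_placeDiv S 0).choose_spec
    refine h.2.eq (abs_sgn _) ⟨1, one_pos, fun φ => by simp [sgn]⟩ ?_
    rw [h.1]; simp
  map_add' m n := by
    have h := (exists_placeDiv S (m + n)).choose_spec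
    have hm := (exists_placeDiv S m).choose_spec
    have hn := (exists_placeDiv S n).choose_spec
    refine h.2.eq (abs_sgn _) ?_ ?_
    · have := hm.2.add hn.2
      simp only [← sgn_add] at this
      exact this
    · rw [h.1, idl_add, hm.1, hn.1, map_add, map_add]; rfl

variable {S}

theorem idl_placeDiv (n : Places S →₀ ℤ) : idl (placeDiv S n) = (sIdl S (fin S n)).toMul :=
  (exists_placeDiv S n).choose_spec.1

theorem hasSign_placeDiv (n : Places S →₀ ℤ) : HasSign (placeDiv S n) (sgn S n) :=
  (exists_placeDiv S n).choose_spec.2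

theorem placeDiv_mem (n : Places S →₀ ℤ) : placeDiv S n ∈ sDom S := by
  rw [mem_sDom, idl_placeDiv, ext_sIdl]

theorem eq_placeDiv {x : Additive (picDom F)} {n : Places S →₀ ℤ}
    (h1 : idl x = (sIdl S (fin S n)).toMul) (h2 : HasSign x (sgn S n)) : placeDiv S n = x :=
  (hasSign_placeDiv n).eq (abs_sgn _) h2 ((idl_placeDiv n).trans h1.symm)

variable (S) in
/-- The component of the divisor attached to an integral function on the places. -/
noncomputable def placeComp : (Places S →₀ ℤ) →+ SComp (F := F) S :=
  (QuotientAddGroup.mk' (sExp S)).comp ((placeDiv S).codRestrict (sDom S) placeDiv_mem)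

theorem fin_symm (a : InfinitePlace F →₀ ℤ) (b : {v // v ∈ S} →₀ ℤ) :
    fin S (Finsupp.sumFinsuppAddEquivProdFinsupp.symm (a, b)) = b := by
  simp [fin]

theorem placeComp_surjective (hS : S.Finite) : Function.Surjective (placeComp (F := F) S) := by
  intro y
  obtain ⟨⟨x, hx⟩, rfl⟩ := QuotientAddGroup.mk_surjective y
  obtain ⟨n, hn⟩ := exists_sIdl S hS hx
  obtain ⟨ε, h1, h2, h3⟩ := exists_sign x
  classical
  let a : InfinitePlace F →₀ ℤ := Finsupp.equivFunOnFinite.symm fun w =>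
    if ε w.embedding = 1 then 0 else 1
  let m : Places S →₀ ℤ := Finsupp.sumFinsuppAddEquivProdFinsupp.symm (a, n)
  have hm : sgn S m = ε := by
    funext φ
    have : m (Sum.inl (InfinitePlace.mk φ)) =
        if ε (InfinitePlace.mk φ).embedding = 1 then 0 else 1 :=
      Finsupp.sumFinsuppAddEquivProdFinsupp_symm_inl _ _
    have he : ε (InfinitePlace.mk φ).embedding = ε φ := by
      rcases InfinitePlace.mk_eq_iff.1 (InfinitePlace.mk_embedding (InfinitePlace.mk φ)) with h | h
      · rw [h]
      · rw [← h2, h]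
    rw [sgn, this, he]
    rcases h1 φ with h | h <;> rw [h] <;> norm_num
  have hs := hasSign_placeDiv m
  rw [hm] at hs
  obtain ⟨v, hv⟩ := hs.sub_mem h3 (by rw [idl_placeDiv, fin_symm, hn]; rfl)
  refine ⟨m, QuotientAddGroup.eq_iff_sub_mem.2 ⟨-v, ?_⟩⟩
  change expDom F (-v) = placeDiv S m - x
  rw [map_neg, hv, neg_sub]

theorem conjugate_conjugate (φ : F →+* ℂ) :
    ComplexEmbedding.conjugate (ComplexEmbedding.conjugate φ) = φ := star_star φ

theorem conj_pi_mul_I : (starRingEnd ℂ) (Real.pi * Complex.I) = -(Real.pi * Complex.I) := by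
  simp

theorem conj_two_pi_mul_I :
    (starRingEnd ℂ) (2 * Real.pi * Complex.I) = -(2 * Real.pi * Complex.I) := by
  rw [mul_assoc, map_mul, conj_pi_mul_I, Complex.conj_ofNat, mul_neg]

theorem exists_kerIdx (v : (expDom F).ker) : ∃ k : (F →+* ℂ) → ℤ,
    ∀ φ, v.1.1 φ = k φ * (2 * Real.pi * Complex.I) := by
  have : ∀ φ, ∃ k : ℤ, v.1.1 φ = k * (2 * Real.pi * Complex.I) := fun φ => by
    rw [← Complex.exp_eq_one_iff, ← cpt_expDom, show expDom F v.1 = 0 from v.2, cpt_zero]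
  choose k hk using this
  exact ⟨k, hk⟩

variable (F) in
/-- The kernel of the exponential, in integral coordinates. -/
noncomputable def kerIdx : (expDom F).ker →+ ((F →+* ℂ) →₀ ℤ) where
  toFun v := Finsupp.equivFunOnFinite.symm (exists_kerIdx v).choose
  map_zero' := by
    ext φ
    have := (exists_kerIdx (0 : (expDom F).ker)).choose_spec φ
    exact Int.cast_eq_zero.1 ((mul_eq_zero.1 this.symm).resolve_right Complex.two_pi_I_ne_zero)
  map_add' v w := by
    ext φ
    have h := (exists_kerIdx (v + w)).choose_spec φ
    have hv := (exists_kerIdx v).choose_spec φ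
    have hw := (exists_kerIdx w).choose_spec φ
    have : (v + w).1.1 φ = v.1.1 φ + w.1.1 φ := rfl
    rw [h, hv, hw, ← add_mul] at this
    have := mul_right_cancel₀ Complex.two_pi_I_ne_zero this
    rw [← Int.cast_add] at this
    exact Int.cast_injective this

theorem kerIdx_spec (v : (expDom F).ker) (φ : F →+* ℂ) :
    v.1.1 φ = kerIdx F v φ * (2 * Real.pi * Complex.I) := (exists_kerIdx v).choose_spec φ

theorem kerIdx_injective : Function.Injective (kerIdx F) := fun v w h =>
  Subtype.ext (Subtype.ext (funext fun φ => by rw [kerIdx_spec, kerIdx_spec, h]))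

variable (S) in
/-- Summation over conjugate embeddings. -/
noncomputable def conjSum : ((F →+* ℂ) →₀ ℤ) →+ (Places S →₀ ℤ) where
  toFun k := Finsupp.sumFinsuppAddEquivProdFinsupp.symm
    (Finsupp.equivFunOnFinite.symm fun w : InfinitePlace F =>
      k w.embedding + k (ComplexEmbedding.conjugate w.embedding), 0)
  map_zero' := by
    ext x
    rcases x with w | p <;> simp
  map_add' k l := by
    ext x
    rcases x with w | p
    · simp; ring
    · simp

theorem conjSum_inl (k : (F →+* ℂ) →₀ ℤ) (φ : F →+* ℂ) :
    conjSum S k (Sum.inl (InfinitePlace.mk φ)) = k φ + k (ComplexEmbedding.conjugate φ) := by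
  refine (Finsupp.sumFinsuppAddEquivProdFinsupp_symm_inl _ _).trans ?_
  change k _ + k _ = _
  rcases InfinitePlace.mk_eq_iff.1 (InfinitePlace.mk_embedding (InfinitePlace.mk φ)) with h | h
  · rw [h]
  · have h' : ComplexEmbedding.conjugate φ = (InfinitePlace.mk φ).embedding := by
      have := congrArg ComplexEmbedding.conjugate h
      rwa [conjugate_conjugate, eq_comm] at this
    rw [h, h', add_comm]

theorem conjSum_inr (k : (F →+* ℂ) →₀ ℤ) (p : {v // v ∈ S}) : conjSum S k (Sum.inr p) = 0 :=
  Finsupp.sumFinsuppAddEquivProdFinsupp_symm_inr _ _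

theorem places_ext {m n : Places S →₀ ℤ} (h1 : ∀ φ, m (Sum.inl (InfinitePlace.mk φ)) =
    n (Sum.inl (InfinitePlace.mk φ))) (h2 : ∀ p, m (Sum.inr p) = n (Sum.inr p)) : m = n := by
  ext (w | p)
  · rw [← InfinitePlace.mk_embedding w]; exact h1 _
  · exact h2 p

theorem exact_kerIdx : Function.Exact (kerIdx F) (conjSum S) := by
  intro k
  constructor
  · intro h
    have hk : ∀ φ, k (ComplexEmbedding.conjugate φ) = - k φ := fun φ => by
      have := conjSum_inl (S := S) k φ
      rw [h, Finsupp.zero_apply] at this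
      linarith
    have hv : (fun φ => (k φ : ℂ) * (2 * Real.pi * Complex.I)) ∈ normZero F := by
      refine mem_normZero_of_exp (x := 0) idl_zero (fun φ => ?_) (fun φ => ?_)
      · rw [hk, map_mul, conj_two_pi_mul_I, map_intCast, Int.cast_neg, neg_mul, mul_neg]
      · rw [cpt_zero, Complex.exp_int_mul_two_pi_mul_I]
    have hker : (⟨_, hv⟩ : normZero F) ∈ (expDom F).ker := by
      refine dom_ext (by simp) fun φ => ?_
      rw [cpt_expDom, cpt_zero, Complex.exp_int_mul_two_pi_mul_I]
    refine ⟨⟨_, hker⟩, Finsupp.ext fun φ => ?_⟩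
    have := mul_right_cancel₀ Complex.two_pi_I_ne_zero (kerIdx_spec ⟨_, hker⟩ φ)
    exact (Int.cast_injective this).symm
  · rintro ⟨v, rfl⟩
    refine places_ext (fun φ => ?_) fun p => conjSum_inr _ p
    rw [conjSum_inl]
    have h := v.1.2.1 φ
    rw [kerIdx_spec, kerIdx_spec] at h
    rw [map_mul, conj_two_pi_mul_I, map_intCast] at h
    have h' : ((kerIdx F v φ + kerIdx F v (ComplexEmbedding.conjugate φ) : ℤ) : ℂ) *
        (2 * Real.pi * Complex.I) = 0 := by
      push_cast
      linear_combination h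
    exact Int.cast_eq_zero.1 ((mul_eq_zero.1 h').resolve_right Complex.two_pi_I_ne_zero)

theorem exact_conjSum : Function.Exact (conjSum S) (placeComp (F := F) S) := by
  intro n
  constructor
  · intro h
    obtain ⟨v, hv⟩ := (QuotientAddGroup.eq_zero_iff _).1 h
    replace hv : expDom F v = placeDiv S n := hv
    have h1 : idl (placeDiv S n) = 1 := by rw [← hv, idl_expDom]
    have hfin : ∀ p, n (Sum.inr p) = 0 := fun p => by
      rw [← fin_apply, ← count_sIdl, ← idl_placeDiv, h1, Units.val_one, FractionalIdeal.count_one]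
    have h2 : ∀ φ, ∃ j : ℤ, v.1 φ = n (Sum.inl (InfinitePlace.mk φ)) * (Real.pi * Complex.I) +
        j * (2 * Real.pi * Complex.I) := fun φ => by
      rw [← Complex.exp_eq_exp_iff_exists_int, ← cpt_expDom, hv,
        (hasSign_placeDiv n).cpt_eq (abs_sgn _) h1, Complex.exp_int_mul, Complex.exp_pi_mul_I, sgn]
      push_cast
      rfl
    choose j hj using h2
    refine ⟨-Finsupp.equivFunOnFinite.symm j, places_ext (fun φ => ?_) fun p => by
      rw [conjSum_inr, hfin]⟩
    rw [conjSum_inl]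
    change -j φ + -j (ComplexEmbedding.conjugate φ) = _
    have h := v.2.1 φ
    rw [hj, hj, InfinitePlace.mk_conjugate_eq] at h
    rw [map_add, map_mul, conj_pi_mul_I, map_mul, conj_two_pi_mul_I, map_intCast, map_intCast] at h
    have h' : ((n (Sum.inl (InfinitePlace.mk φ)) + j φ + j (ComplexEmbedding.conjugate φ) : ℤ) : ℂ) *
        (2 * Real.pi * Complex.I) = 0 := by
      push_cast
      linear_combination h
    have := Int.cast_eq_zero.1 ((mul_eq_zero.1 h').resolve_right Complex.two_pi_I_ne_zero)
    linarith
  · rintro ⟨k, rfl⟩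
    have h1 : idl (placeDiv S (conjSum S k)) = 1 := by
      rw [idl_placeDiv, show fin S (conjSum S k) = 0 from fin_symm _ _, map_zero]; rfl
    have he : ∀ φ, Complex.exp (((k φ - k (ComplexEmbedding.conjugate φ) : ℤ) : ℂ) *
        (Real.pi * Complex.I)) = cpt (placeDiv S (conjSum S k)) φ := fun φ => by
      rw [(hasSign_placeDiv _).cpt_eq (abs_sgn _) h1, Complex.exp_int_mul, Complex.exp_pi_mul_I,
        sgn, conjSum_inl]
      push_cast
      rw [zpow_sub₀ (by norm_num), zpow_add₀ (by norm_num), div_eq_mul_inv]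
      congr 1
      rw [← inv_zpow]
      norm_num
    have hv := mem_normZero_of_exp h1 (v := fun φ =>
      ((k φ - k (ComplexEmbedding.conjugate φ) : ℤ) : ℂ) * (Real.pi * Complex.I)) (fun φ => by
        rw [conjugate_conjugate, map_mul, conj_pi_mul_I, map_intCast]
        push_cast
        ring) he
    refine (QuotientAddGroup.eq_zero_iff _).2 ⟨⟨_, hv⟩, ?_⟩
    refine dom_ext (by rw [idl_expDom]; exact h1.symm) fun φ => ?_
    rw [cpt_expDom]
    exact he φ

end ArClass

end

section

open NumberField IsDedekindDomain
open scoped nonZeroDivisors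

namespace ArClass

variable {F : Type} [Field F] [NumberField F] {G : Type} [Group G]
  {S : Set (HeightOneSpectrum (𝓞 F))} (γ : GalAction F G)

/-- The permutation module on the complex embeddings. -/
noncomputable def GalAction.embRep : G →* AddMonoid.End ((F →+* ℂ) →₀ ℤ) :=
  letI := γ.emb
  GRep.perm (F →+* ℂ)

theorem GalAction.embRep_apply (g : G) (k : (F →+* ℂ) →₀ ℤ) (φ : F →+* ℂ) :
    γ.embRep g k φ = k (φ.comp (γ.fld g : F →+* F)) := by
  letI := γ.emb
  refine (GRep.perm_apply_apply g k φ).trans ?_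
  change k (φ.comp (γ.fld g⁻¹⁻¹ : F →+* F)) = _
  rw [inv_inv]

variable (S) in
/-- Compatibility of an action on the set of places with the action on the field. -/
structure PlaceAction [MulAction G (Places S)] : Prop where
  inl (g : G) (φ : F →+* ℂ) : g • (Sum.inl (InfinitePlace.mk φ) : Places S) =
    Sum.inl (InfinitePlace.mk (φ.comp (γ.fld g⁻¹ : F →+* F)))
  inr (g : G) (p : {v // v ∈ S}) : ∃ q : {v // v ∈ S}, g • (Sum.inr p : Places S) = Sum.inr q ∧
    ∀ a, γ.fld g a ∈ (primeIdl q.1 : FractionalIdeal (𝓞 F)⁰ F) ↔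
      a ∈ (primeIdl p.1 : FractionalIdeal (𝓞 F)⁰ F)

variable {γ}

theorem kerIdx_kerRep (g : G) (v : (expDom F).ker) :
    kerIdx F (γ.kerRep g v) = γ.embRep g (kerIdx F v) := by
  ext φ
  rw [γ.embRep_apply]
  have h : (γ.kerRep g v).1.1 φ = v.1.1 (φ.comp (γ.fld g : F →+* F)) := rfl
  rw [kerIdx_spec, kerIdx_spec] at h
  exact Int.cast_injective (mul_right_cancel₀ Complex.two_pi_I_ne_zero h)

variable [MulAction G (Places S)]

theorem perm_inl (hT : PlaceAction S γ) (g : G) (n : Places S →₀ ℤ) (φ : F →+* ℂ) :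
    GRep.perm (Places S) g n (Sum.inl (InfinitePlace.mk φ)) =
      n (Sum.inl (InfinitePlace.mk (φ.comp (γ.fld g : F →+* F)))) := by
  rw [GRep.perm_apply_apply, hT.inl, inv_inv]

theorem conjSum_embRep (hT : PlaceAction S γ) (g : G) (k : (F →+* ℂ) →₀ ℤ) :
    conjSum S (γ.embRep g k) = GRep.perm (Places S) g (conjSum S k) := by
  refine places_ext (fun φ => ?_) fun p => ?_
  · rw [perm_inl hT, conjSum_inl, conjSum_inl, γ.embRep_apply, γ.embRep_apply]
    rfl
  · obtain ⟨q, hq, -⟩ := hT.inr g⁻¹ p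
    rw [GRep.perm_apply_apply, hq, conjSum_inr, conjSum_inr]

theorem idl_dom_congr (g : G) {x y : Additive (picDom F)} (h : idl x = idl y) :
    idl (γ.dom g x) = idl (γ.dom g y) :=
  Units.ext (ideal_ext_of_ringEquiv (γ.fld g) fun a => by rw [γ.mem_idl, γ.mem_idl, h])

variable (F) in
/-- The ideal of an oriented Arakelov divisor, as a homomorphism. -/
noncomputable def idlHom : Additive (picDom F) →+ Additive (IdealGroup F) where
  toFun x := Additive.ofMul (idl x)
  map_zero' := by rw [idl_zero]; rfl
  map_add' x y := by rw [idl_add]; rfl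

theorem fin_single_inl (w : InfinitePlace F) (m : ℤ) :
    fin S (Finsupp.single (Sum.inl w) m) = 0 := by
  ext p
  rw [fin_apply]; simp

theorem fin_single_inr (p : {v // v ∈ S}) (m : ℤ) :
    fin S (Finsupp.single (Sum.inr p) m) = Finsupp.single p m := by
  classical
  ext q
  rw [fin_apply]; simp [Finsupp.single_apply]

theorem idl_dom_placeDiv (hT : PlaceAction S γ) (g : G) (n : Places S →₀ ℤ) :
    idl (γ.dom g (placeDiv S n)) = (sIdl S (fin S (GRep.perm (Places S) g n))).toMul := by
  have key : ((idlHom F).comp (γ.dom g)).comp (placeDiv S) =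
      ((sIdl S).comp (fin S)).comp (GRep.perm (Places S) g) := by
    refine Finsupp.addHom_ext fun t m => ?_
    rw [← mul_one m, ← smul_eq_mul, ← Finsupp.smul_single, map_zsmul, map_zsmul]
    congr 1
    change Additive.ofMul (idl (γ.dom g (placeDiv S _))) =
      sIdl S (fin S (Finsupp.mapDomain _ (Finsupp.single t 1)))
    rw [Finsupp.mapDomain_single]
    rcases t with w | p
    · have h : idl (placeDiv S (Finsupp.single (Sum.inl w) 1)) = idl (0 : Additive (picDom F)) := by
        rw [idl_placeDiv, fin_single_inl, map_zero, idl_zero]; rfl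
      rw [idl_dom_congr g h, map_zero, idl_zero]
      rw [← InfinitePlace.mk_embedding w, hT.inl, fin_single_inl, map_zero]; rfl
    · obtain ⟨q, hq, h⟩ := hT.inr g p
      rw [hq, fin_single_inr, sIdl_single, one_smul]
      refine congrArg Additive.ofMul (Units.ext (ideal_ext_of_ringEquiv (γ.fld g) fun a => ?_))
      rw [γ.mem_idl, h, idl_placeDiv, fin_single_inr, sIdl_single, one_smul]
      rfl
  exact congrArg Additive.toMul (DFunLike.congr_fun key n)

theorem placeDiv_perm (hT : PlaceAction S γ) (g : G) (n : Places S →₀ ℤ) :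
    placeDiv S (GRep.perm (Places S) g n) = γ.dom g (placeDiv S n) := by
  refine eq_placeDiv (idl_dom_placeDiv hT g n) ?_
  obtain ⟨c, hc, h⟩ := hasSign_placeDiv n
  exact ⟨c, hc, fun φ => by rw [γ.cpt_dom, h, sgn, sgn, perm_inl hT]⟩

theorem placeComp_perm (h : Stable S γ) (hT : PlaceAction S γ) (g : G) (n : Places S →₀ ℤ) :
    placeComp S (GRep.perm (Places S) g n) = h.sc g (placeComp S n) :=
  congrArg (QuotientAddGroup.mk' (sExp S)) (Subtype.ext (placeDiv_perm hT g n))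

end ArClass

end

section

open NumberField IsDedekindDomain
open scoped nonZeroDivisors

theorem GRep.finite_of_surjective {A B : Type} [AddCommGroup A] [AddCommGroup B]
    [Module.Finite ℤ A] (f : A →+ B) (hf : Function.Surjective f) : Module.Finite ℤ B :=
  Module.Finite.of_surjective f.toIntLinearMap hf

namespace ArClass

variable {F : Type} [Field F] [NumberField F] {S : Set (HeightOneSpectrum (𝓞 F))}

theorem finite_sComp (hS : S.Finite) : Module.Finite ℤ (SComp (F := F) S) := by
  have := hS.to_subtype
  exact GRep.finite_of_surjective (placeComp (F := F) S) (placeComp_surjective hS)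

theorem finite_sUnit (hS : S.Finite) : Module.Finite ℤ (Additive (S.unit F)) := by
  have := finite_sComp hS
  exact GRep.finite_of_exact (L := logLattice F) (N := SComp (F := F) S) (latUnit S) (unitDiv S)
    fun x hx => (exact_latUnit S x).1 hx

variable (F) in
theorem finite_ker_expDom : Module.Finite ℤ (expDom F).ker :=
  Module.Finite.of_injective (kerIncl F).toIntLinearMap
    (AddSubgroup.inclusion_injective ker_expDom_le)

theorem exists_eq_mul_principal {I J : IdealGroup F}
    (h : ClassGroup.mk (K := F) I = ClassGroup.mk (K := F) J) :
    ∃ a : Fˣ, I = J * toPrincipalIdeal (𝓞 F) F a := by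
  have h1 : ClassGroup.mk (K := F) (I / J) = 1 := by rw [map_div, h, div_self']
  rw [ClassGroup.mk_eq_one_iff] at h1
  obtain ⟨a, ha⟩ := h1.1
  have ha0 : a ≠ 0 := by
    rintro rfl
    have : ((I / J : IdealGroup F) : FractionalIdeal (𝓞 F)⁰ F) = 0 :=
      FractionalIdeal.coeToSubmodule_injective (by beta_reduce; rw [ha]; simp)
    exact (I / J).ne_zero this
  refine ⟨Units.mk0 a ha0, ?_⟩
  rw [← div_eq_iff_eq_mul']
  refine Units.ext (FractionalIdeal.coeToSubmodule_injective ?_)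
  beta_reduce
  rw [ha, coe_toPrincipalIdeal, FractionalIdeal.coe_spanSingleton, Units.val_mk0]

instance finite_compGroup : Finite (CompGroup F) := by
  classical
  have hr : ∀ c : ClassGroup (𝓞 F), ∃ I : IdealGroup F, ClassGroup.mk (K := F) I = c := fun c => by
    obtain ⟨I, rfl⟩ := ClassGroup.mk0_surjective c
    exact ⟨FractionalIdeal.mk0 F I, ClassGroup.mk_mk0 F I⟩
  choose r hr using hr
  let ε : ((F →+* ℂ) → Bool) → (F →+* ℂ) → ℝ := fun b φ => if b φ then 1 else -1
  let f : ClassGroup (𝓞 F) × ((F →+* ℂ) → Bool) → CompGroup F := fun q =>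
    if h : ∃ x : Additive (picDom F), idl x = r q.1 ∧ HasSign x (ε q.2) then h.choose else 0
  refine Finite.of_surjective f fun y => ?_
  obtain ⟨x, rfl⟩ := QuotientAddGroup.mk_surjective y
  obtain ⟨a, ha⟩ := exists_eq_mul_principal (hr (ClassGroup.mk (K := F) (idl x))).symm
  set z := x - prin F (Additive.ofMul a) with hz
  have hiz : idl z = r (ClassGroup.mk (K := F) (idl x)) := by
    rw [hz, idl_sub, idl_prin]
    exact div_eq_of_eq_mul' (by rw [mul_comm]; exact ha)
  obtain ⟨η, h1, h2, h3⟩ := exists_sign z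
  have hη : ε (fun φ => decide (η φ = 1)) = η := by
    funext φ
    rcases h1 φ with h | h
    · simp [ε, h]
    · simp only [ε, h]; norm_num
  have hex : ∃ x : Additive (picDom F), idl x = idl z ∧ HasSign x η :=
    exists_dom_of_idl _ _ h1 h2
  have hex' := hex
  rw [← hη, hiz] at hex'
  refine ⟨(ClassGroup.mk (K := F) (idl x), fun φ => decide (η φ = 1)), ?_⟩
  have hf : f (ClassGroup.mk (K := F) (idl x), fun φ => decide (η φ = 1)) =
      (hex'.choose : CompGroup F) := dif_pos hex'
  rw [hf]
  have hs := hex'.choose_spec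
  have hs2 : HasSign hex'.choose η :=
    hη.subst (motive := fun e => HasSign hex'.choose e) hs.2
  obtain ⟨v, hv⟩ := hs2.sub_mem h3 (hiz.trans hs.1.symm)
  refine QuotientAddGroup.eq_iff_sub_mem.2 ?_
  have : hex'.choose - x = expDom F (-v) + prin F (-Additive.ofMul a) := by
    rw [map_neg, map_neg, hv, hz]; abel
  rw [this]
  exact AddSubgroup.mem_sup.2 ⟨_, ⟨_, rfl⟩, _, ⟨_, rfl⟩, rfl⟩

theorem finite_sClassGroup (S : Set (HeightOneSpectrum (𝓞 F))) [IsDedekindDomain (S.integer F)] :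
    Finite (Additive (ClassGroup (S.integer F))) :=
  Finite.of_surjective _ (clsMap_surjective S)

end ArClass

end

section

open NumberField IsDedekindDomain
open scoped nonZeroDivisors

namespace ArClass

variable {F : Type} [Field F] [NumberField F] {G : Type} [Group G]
  {S : Set (HeightOneSpectrum (𝓞 F))} {γ : GalAction F G}

theorem add_eq_of_exact {A : Type*} [AddCommGroup A] {a b c d e h i j : A}
    (h₁ : a + c + e = b + d + h) (h₂ : a + j = i + d) : b + h + j = i + c + e := by
  rw [← sub_eq_zero] at *
  calc b + h + j - (i + c + e) = (a + j - (i + d)) - (a + c + e - (b + d + h)) := by abel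
    _ = 0 := by rw [h₁, h₂, sub_zero]

/-- The relation between the logarithmic lattice, the places and the class groups. -/
theorem cls_lat_add_cls [MulAction G (Places S)] [IsDedekindDomain (S.integer F)]
    (hS : S.Finite) (h : Stable S γ) (hT : PlaceAction S γ)
    {ρU : G →* AddMonoid.End (Additive (S.unit F))}
    (hU : ∀ g u, (((ρU g u).toMul : S.unit F) : Fˣ) = Units.map (γ.fld g : F →* F)
      ((u.toMul : S.unit F) : Fˣ))
    {ρC : G →* AddMonoid.End (Additive (ClassGroup (S.integer F)))}
    (hC : ∀ (g : G) (I J : (Ideal (S.integer F))⁰),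
      ((fun x : S.integer F => (x : F)) ''
          ((J : Ideal (S.integer F)) : Set (S.integer F)) =
        γ.fld g '' ((fun x : S.integer F => (x : F)) ''
          ((I : Ideal (S.integer F)) : Set (S.integer F)))) →
      ρC g (Additive.ofMul (ClassGroup.mk0 I)) = Additive.ofMul (ClassGroup.mk0 J)) :
    GRep.cls γ.lat + GRep.cls ρC + GRep.cls (GRep.perm (G := G) (Places S)) =
      GRep.cls γ.embRep + GRep.cls ρU + GRep.cls (A := CompGroup F) γ.cg := by
  have := hS.to_subtype
  have := finite_sComp (F := F) hS
  have := finite_sUnit (F := F) hS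
  have := finite_ker_expDom F
  have := finite_sClassGroup S
  have h1 := GRep.cls_exact_six (D := SComp (F := F) S) (E := CompGroup F) γ.kerRep γ.lat ρU h.sc γ.cg ρC (kerIncl F) (latUnit S)
    (unitDiv S) (compMap S) (clsMap S) (AddSubgroup.inclusion_injective ker_expDom_le)
    (clsMap_surjective S) (exact_kerIncl S) (exact_latUnit S) (exact_unitDiv S)
    (exact_compMap S) kerIncl_kerRep (latUnit_lat hU) (unitDiv_rep h hU) (compMap_sc h)
    (clsMap_cg h hC)
  have h2 := GRep.cls_exact_four (D := SComp (F := F) S) γ.kerRep γ.embRep (GRep.perm (G := G) (Places S)) h.sc (kerIdx F)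
    (conjSum S) (placeComp S) kerIdx_injective (placeComp_surjective hS) exact_kerIdx
    exact_conjSum kerIdx_kerRep (conjSum_embRep hT) (placeComp_perm h hT)
  exact add_eq_of_exact h1 h2

/-- The class of the dual of the oriented Arakelov class group, in terms of the places, the
`S`-units and the `S`-class group. -/
theorem cls_arTilde_eq [MulAction G (Places S)] [IsDedekindDomain (S.integer F)]
    (hS : S.Finite) (h : Stable S γ) (hT : PlaceAction S γ)
    {ρ : G →* AddMonoid.End (ArTilde F)}
    (hρ : ∀ g φ x, pull (ρ g φ) x = pull φ (γ.dom g⁻¹ x))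
    {ρU : G →* AddMonoid.End (Additive (S.unit F))}
    (hU : ∀ g u, (((ρU g u).toMul : S.unit F) : Fˣ) = Units.map (γ.fld g : F →* F)
      ((u.toMul : S.unit F) : Fˣ))
    {ρC : G →* AddMonoid.End (Additive (ClassGroup (S.integer F)))}
    (hC : ∀ (g : G) (I J : (Ideal (S.integer F))⁰),
      ((fun x : S.integer F => (x : F)) ''
          ((J : Ideal (S.integer F)) : Set (S.integer F)) =
        γ.fld g '' ((fun x : S.integer F => (x : F)) ''
          ((I : Ideal (S.integer F)) : Set (S.integer F)))) →
      ρC g (Additive.ofMul (ClassGroup.mk0 I)) = Additive.ofMul (ClassGroup.mk0 J))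
    (σ : G0 (MonoidAlgebra ℤ G) →+ G0 (MonoidAlgebra ℤ G))
    (hσlat : ∀ (M : Type) [AddCommGroup M] [Module (MonoidAlgebra ℤ G) M]
        [Module.Finite (MonoidAlgebra ℤ G) M] [Module.Projective ℤ M]
        [Module (MonoidAlgebra ℤ G) (M →ₗ[ℤ] ℤ)],
      (∀ (g : G) (φ : M →ₗ[ℤ] ℤ) (x : M),
        ((MonoidAlgebra.single g (1 : ℤ) : MonoidAlgebra ℤ G) • φ) x =
          φ ((MonoidAlgebra.single g⁻¹ (1 : ℤ) : MonoidAlgebra ℤ G) • x)) →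
      σ (G0.cls (MonoidAlgebra ℤ G) M) = G0.cls (MonoidAlgebra ℤ G) (M →ₗ[ℤ] ℤ))
    (hσtor : ∀ (N : Type) [AddCommGroup N] [Module (MonoidAlgebra ℤ G) N]
        [Module (MonoidAlgebra ℤ G) (N →ₗ[ℤ] QmodZ)], Finite N →
      (∀ (g : G) (φ : N →ₗ[ℤ] QmodZ) (x : N),
        ((MonoidAlgebra.single g (1 : ℤ) : MonoidAlgebra ℤ G) • φ) x =
          φ ((MonoidAlgebra.single g⁻¹ (1 : ℤ) : MonoidAlgebra ℤ G) • x)) →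
      σ (G0.cls (MonoidAlgebra ℤ G) N) = - G0.cls (MonoidAlgebra ℤ G) (N →ₗ[ℤ] QmodZ)) :
    GRep.cls ρ = GRep.cls γ.embRep - GRep.cls (GRep.perm (G := G) (Places S)) +
      σ (GRep.cls ρU) - σ (GRep.cls ρC) := by
  have := hS.to_subtype
  have key := congrArg σ (cls_lat_add_cls hS h hT hU hC)
  have hM : σ (GRep.cls γ.embRep) = GRep.cls γ.embRep := by
    letI := γ.emb
    exact (GRep.map_cls_of_free σ hσlat _).trans (GRep.cls_dual_perm _)
  have hP : σ (GRep.cls (GRep.perm (G := G) (Places S))) =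
      GRep.cls (GRep.perm (G := G) (Places S)) :=
    (GRep.map_cls_of_free σ hσlat _).trans (GRep.cls_dual_perm _)
  have hπ : σ (GRep.cls (A := CompGroup F) γ.cg) =
      - GRep.cls (GRep.dual (A := CompGroup F) γ.cg RmodZ) :=
    GRep.map_cls_of_finite (A := CompGroup F) σ hσtor _
  have hΛ : σ (GRep.cls γ.lat) = GRep.cls (GRep.dual γ.lat ℤ) :=
    GRep.map_cls_of_free σ hσlat _
  rw [map_add, map_add, map_add, map_add, hM, hP, hπ, hΛ] at key
  rw [cls_arTilde γ ρ hρ]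
  have h3 : GRep.cls (GRep.dual γ.lat ℤ) =
      (GRep.cls (GRep.dual γ.lat ℤ) + σ (GRep.cls ρC) +
        GRep.cls (GRep.perm (G := G) (Places S))) - σ (GRep.cls ρC) -
        GRep.cls (GRep.perm (G := G) (Places S)) := by abel
  rw [h3, key]
  abel

/-- A field extension whose automorphism group is `G` gives free orbits on embeddings. -/
theorem cls_embRep {K : Type} [Field K] [NumberField K] [Algebra K F] [IsGalois K F] [Finite G]
    (iso : G ≃* (F ≃ₐ[K] F)) (γ : GalAction F G) (hγ : ∀ g a, γ.fld g a = iso g a) :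
    GRep.cls γ.embRep =
      Module.finrank ℚ K • G0.cls (MonoidAlgebra ℤ G) (MonoidAlgebra ℤ G) := by
  letI := γ.emb
  let ε : Fin (Module.finrank ℚ K) ≃ (K →+* ℂ) :=
    (Fintype.equivFinOfCardEq (Embeddings.card K ℂ)).symm
  let f : Fin (Module.finrank ℚ K) × G → (F →+* ℂ) := fun q =>
    q.2 • ComplexEmbedding.lift F (ε q.1)
  have hf : ∀ q, (f q).comp (algebraMap K F) = ε q.1 := fun q => by
    rw [← ComplexEmbedding.lift_comp_algebraMap (K := F) (ε q.1)]
    ext x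
    change ComplexEmbedding.lift F (ε q.1) (γ.fld q.2⁻¹ (algebraMap K F x)) = _
    rw [hγ, AlgEquiv.commutes]
    rfl
  have hbij : Function.Bijective f := by
    constructor
    · rintro ⟨i, g⟩ ⟨j, h⟩ hij
      have hi : i = j := ε.injective (by rw [← hf (i, g), hij, hf])
      subst hi
      have hgh : g⁻¹ = h⁻¹ := iso.injective (AlgEquiv.ext fun a => by
        rw [← hγ, ← hγ]
        exact (ComplexEmbedding.lift F (ε i)).injective (DFunLike.congr_fun hij a))
      rw [inv_injective hgh]
    · intro φ
      obtain ⟨s, hs⟩ := ComplexEmbedding.exists_comp_symm_eq_of_comp_eq (k := K)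
        (ComplexEmbedding.lift F (φ.comp (algebraMap K F))) φ
        (ComplexEmbedding.lift_comp_algebraMap F _)
      refine ⟨(ε.symm (φ.comp (algebraMap K F)), iso.symm s), Eq.trans ?_ hs⟩
      ext a
      change ComplexEmbedding.lift F (ε (ε.symm _)) (γ.fld (iso.symm s)⁻¹ a) = _
      rw [Equiv.apply_symm_apply, hγ, map_inv, MulEquiv.apply_symm_apply]
      rfl
  exact GRep.cls_perm_of_equiv (Equiv.ofBijective f hbij) fun i g h => mul_smul g h _

end ArClass

end

section

open NumberField IsDedekindDomain
open scoped nonZeroDivisors TensorProduct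

namespace ArClass

variable {F : Type} [Field F] [NumberField F] {G : Type} [Group G]
  {S : Set (HeightOneSpectrum (𝓞 F))}

theorem mem_primeIdl (p : HeightOneSpectrum (𝓞 F)) (a : F) :
    a ∈ (primeIdl p : FractionalIdeal (𝓞 F)⁰ F) ↔
      a ∈ algebraMap (𝓞 F) F '' (p.asIdeal : Set (𝓞 F)) :=
  FractionalIdeal.mem_coeIdeal _

theorem eq_of_image_eq {p q : HeightOneSpectrum (𝓞 F)}
    (h : algebraMap (𝓞 F) F '' (p.asIdeal : Set (𝓞 F)) =
      algebraMap (𝓞 F) F '' (q.asIdeal : Set (𝓞 F))) : p = q :=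
  HeightOneSpectrum.ext (SetLike.coe_injective
    (Set.image_injective.2 (IsFractionRing.injective (𝓞 F) F) h))

theorem eq_of_primeIdl_eq (e : F ≃+* F) {p q : HeightOneSpectrum (𝓞 F)}
    (h : ∀ a, e a ∈ (primeIdl p : FractionalIdeal (𝓞 F)⁰ F) ↔
      e a ∈ (primeIdl q : FractionalIdeal (𝓞 F)⁰ F)) : p = q := by
  refine eq_of_image_eq (Set.ext fun a => ?_)
  rw [← mem_primeIdl, ← mem_primeIdl]
  simpa using h (e.symm a)

/-- The preimage of a prime under an automorphism. -/
theorem exists_prime_comap (e : F ≃+* F) (v : HeightOneSpectrum (𝓞 F)) :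
    ∃ w : HeightOneSpectrum (𝓞 F), ∀ a, RingOfIntegers.mapRingEquiv e a ∈ v.asIdeal ↔
      a ∈ w.asIdeal := by
  refine ⟨⟨v.asIdeal.comap (RingOfIntegers.mapRingEquiv e), inferInstance, fun h => v.ne_bot ?_⟩,
    fun a => Iff.rfl⟩
  refine (Submodule.eq_bot_iff _).2 fun x hx => ?_
  have : (RingOfIntegers.mapRingEquiv e).symm x ∈
      v.asIdeal.comap (RingOfIntegers.mapRingEquiv e) := by
    rw [Ideal.mem_comap, RingEquiv.apply_symm_apply]; exact hx
  rw [h] at this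
  simpa using this

theorem mem_primeIdl_of_comap {e : F ≃+* F} {v w : HeightOneSpectrum (𝓞 F)}
    (h : ∀ a, RingOfIntegers.mapRingEquiv e a ∈ v.asIdeal ↔ a ∈ w.asIdeal) (a : F) :
    e a ∈ (primeIdl v : FractionalIdeal (𝓞 F)⁰ F) ↔
      a ∈ (primeIdl w : FractionalIdeal (𝓞 F)⁰ F) := by
  rw [mem_primeIdl, mem_primeIdl]
  constructor
  · rintro ⟨x, hx, hxa⟩
    refine ⟨(RingOfIntegers.mapRingEquiv e).symm x, ?_, ?_⟩
    · rw [SetLike.mem_coe, ← h, RingEquiv.apply_symm_apply]; exact hx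
    · change e.symm (algebraMap (𝓞 F) F x) = a
      rw [hxa, RingEquiv.symm_apply_apply]
  · rintro ⟨x, hx, rfl⟩
    exact ⟨RingOfIntegers.mapRingEquiv e x, (h x).2 hx, rfl⟩

theorem PlaceAction.stable {γ : GalAction F G} [MulAction G (Places S)] (hT : PlaceAction S γ) :
    Stable S γ := by
  intro g x hx v hv
  obtain ⟨w, hw⟩ := exists_prime_comap (γ.fld g) v
  have hwS : w ∉ S := fun hwS => by
    obtain ⟨q, -, hq⟩ := hT.inr g ⟨w, hwS⟩
    have : q.1 = v := eq_of_primeIdl_eq (γ.fld g) fun a =>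
      (hq a).trans (mem_primeIdl_of_comap hw a).symm
    exact hv (this ▸ q.2)
  obtain ⟨n, d, hnd⟩ := w.exists_primeCompl_mul_eq_of_integer x (hx w hwS)
  have h1 := congrArg (γ.fld g) hnd
  rw [map_mul] at h1
  have h2 : v.valuation F (γ.fld g (algebraMap (𝓞 F) F d)) = 1 := by
    change v.valuation F (algebraMap (𝓞 F) F (RingOfIntegers.mapRingEquiv (γ.fld g) d)) = 1
    refine le_antisymm (v.valuation_le_one _) (not_lt.1 fun hlt => d.2 ?_)
    rwa [HeightOneSpectrum.valuation_lt_one_iff_mem, hw] at hlt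
  have h3 : v.valuation F (γ.fld g (algebraMap (𝓞 F) F n)) ≤ 1 :=
    v.valuation_le_one (RingOfIntegers.mapRingEquiv (γ.fld g) n)
  rw [← h1, map_mul, h2, mul_one] at h3
  exact h3

variable {K : Type} [Field K] [Algebra K F]

/-- The action on places given by a compatible map on the finite places. -/
@[reducible] def placeMulAction (iso : G ≃* (F ≃ₐ[K] F)) (act : G → {v // v ∈ S} → {v // v ∈ S})
    (hact : ∀ (g : G) (v : {v // v ∈ S}),
      algebraMap (𝓞 F) F '' ((act g v : HeightOneSpectrum (𝓞 F)).asIdeal : Set (𝓞 F)) =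
        iso g '' (algebraMap (𝓞 F) F '' ((v : HeightOneSpectrum (𝓞 F)).asIdeal : Set (𝓞 F)))) :
    MulAction G (Places S) where
  smul g := Sum.map (fun w => iso g • w) (act g)
  one_smul := by
    rintro (w | p)
    · refine congrArg Sum.inl ?_
      beta_reduce
      rw [map_one, one_smul]
    · refine congrArg Sum.inr (Subtype.ext (eq_of_image_eq ?_))
      rw [hact, map_one]
      exact Set.image_id _
  mul_smul g h := by
    rintro (w | p)
    · refine congrArg Sum.inl ?_
      beta_reduce
      rw [map_mul, mul_smul]
    · refine congrArg Sum.inr (Subtype.ext (eq_of_image_eq ?_))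
      rw [hact, hact, hact, map_mul]
      exact Set.image_comp (iso g) (iso h) _

theorem placeAction_of_act (γ : GalAction F G) (iso : G ≃* (F ≃ₐ[K] F))
    (hγ : ∀ g a, γ.fld g a = iso g a) (act : G → {v // v ∈ S} → {v // v ∈ S})
    (hact : ∀ (g : G) (v : {v // v ∈ S}),
      algebraMap (𝓞 F) F '' ((act g v : HeightOneSpectrum (𝓞 F)).asIdeal : Set (𝓞 F)) =
        iso g '' (algebraMap (𝓞 F) F '' ((v : HeightOneSpectrum (𝓞 F)).asIdeal : Set (𝓞 F)))) :
    letI := placeMulAction iso act hact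
    PlaceAction S γ := by
  letI := placeMulAction iso act hact
  refine ⟨fun g φ => congrArg Sum.inl ?_, fun g p => ⟨act g p, rfl, fun a => ?_⟩⟩
  · change iso g • InfinitePlace.mk φ = _
    rw [InfinitePlace.smul_mk]
    congr 1
    ext a
    simp only [RingHom.comp_apply]
    refine congrArg φ ?_
    refine Eq.trans ?_ (hγ g⁻¹ a).symm
    rw [map_inv]
    rfl
  · rw [mem_primeIdl, mem_primeIdl, hact, hγ]
    exact (iso g).injective.mem_set_image

theorem exists_galAction_of_pic [CharZero K] (iso : G ≃* (F ≃ₐ[K] F)) (ρT : G → PicTilde F → PicTilde F)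
    (hρT : ∀ (g : G) (x : picDom F), ∃ y : picDom F,
      ((((((y : IdealGroup F × (FReal F)ˣ).1 : FractionalIdeal (𝓞 F)⁰ F) :
          Submodule (𝓞 F) F) : Set F)) =
        (iso g) '' (((((x : IdealGroup F × (FReal F)ˣ).1 : FractionalIdeal (𝓞 F)⁰ F) :
          Submodule (𝓞 F) F) : Set F))) ∧
      (((y : IdealGroup F × (FReal F)ˣ).2 : FReal F) =
        galFReal K (iso g) ((x : IdealGroup F × (FReal F)ˣ).2 : FReal F)) ∧
      ρT g (PicTilde.mk F x) = PicTilde.mk F y) :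
    ∃ γ : GalAction F G, (∀ g a, γ.fld g a = iso g a) ∧
      ∀ g (x : Additive (picDom F)),
        ρT g (PicTilde.mk F x.toMul) = PicTilde.mk F (γ.dom g x).toMul := by
  let s : G →* (F ≃+* F) :=
    { toFun g := (iso g).toRingEquiv
      map_one' := by rw [map_one]; rfl
      map_mul' g h := by rw [map_mul]; rfl }
  have key : ∀ g (x : Additive (picDom F)), ∃ y : Additive (picDom F),
      ((∀ a, s g a ∈ (idl y : FractionalIdeal (𝓞 F)⁰ F) ↔
        a ∈ (idl x : FractionalIdeal (𝓞 F)⁰ F)) ∧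
      ∀ φ, cpt y φ = cpt x (φ.comp (s g : F →+* F))) ∧
      ρT g (PicTilde.mk F x.toMul) = PicTilde.mk F y.toMul := fun g x => by
    obtain ⟨y, h1, h2, h3⟩ := hρT g x.toMul
    refine ⟨Additive.ofMul y, ⟨fun a => ?_, fun φ => ?_⟩, h3⟩
    · refine (Set.ext_iff.1 h1 (iso g a)).trans ?_
      exact (iso g).injective.mem_set_image
    · refine (congrFun (congrArg (ev F) h2) φ).trans ?_
      exact ev_galFReal (iso g) _ φ
  obtain ⟨γ, hγ⟩ := exists_galAction s fun g x => (key g x).imp fun y h => h.1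
  refine ⟨γ, fun g a => by rw [hγ]; rfl, fun g x => ?_⟩
  obtain ⟨y, ⟨h1, h2⟩, h3⟩ := key g x
  have : γ.dom g x = y := gal_dom_ext (s g) (fun a => by
    rw [h1, ← γ.mem_idl g x a, hγ]) fun φ => by rw [h2, γ.cpt_dom, hγ]
  rw [h3, this]

end ArClass

end

/-!
STATEMENT 8: Let F/K be a finite Galois extension of number fields with Galois group G,
let d be the degree of K over ℚ, and let S be a finite G-stable set of places of F
containing all archimedean places.  Then
[Ãr_F] = d·[ℤ[G]] − [ℤ[S]] + σ[O×_{F,S}] − σ[Cl_{F,S}] in G₀(ℤ[G]).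
-/
theorem stmt8
    (K F : Type) [Field K] [NumberField K] [Field F] [NumberField F] [Algebra K F]
    [IsGalois K F] (G : Type) [Group G] (iso : G ≃* (F ≃ₐ[K] F))
    -- the Galois action of G on the oriented Arakelov class group, characterized on classes
    -- of oriented Arakelov divisors (I, b) via the action on the underlying ideals and on F_ℝ
    (ρT : G → PicTilde F → PicTilde F)
    (hρT : ∀ (g : G) (x : picDom F), ∃ y : picDom F,
      ((((((y : IdealGroup F × (FReal F)ˣ).1 : FractionalIdeal (𝓞 F)⁰ F) :
          Submodule (𝓞 F) F) : Set F)) =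
        (iso g) '' (((((x : IdealGroup F × (FReal F)ˣ).1 : FractionalIdeal (𝓞 F)⁰ F) :
          Submodule (𝓞 F) F) : Set F))) ∧
      (((y : IdealGroup F × (FReal F)ˣ).2 : FReal F) =
        galFReal K (iso g) ((x : IdealGroup F × (FReal F)ˣ).2 : FReal F)) ∧
      ρT g (PicTilde.mk F x) = PicTilde.mk F y)
    -- the ℤ[G]-module structure on the Pontryagin dual (G acting via g ↦ g⁻¹)
    [mAT : Module (MonoidAlgebra ℤ G) (ArTilde F)]
    (hmAT : ∀ (g : G) (φ : ArTilde F) (z : PicTilde F),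
      ((MonoidAlgebra.single g (1 : ℤ) : MonoidAlgebra ℤ G) • φ) (Additive.ofMul z) =
        φ (Additive.ofMul (ρT g⁻¹ z)))
    -- a finite G-stable set S of places of F containing all archimedean places,
    -- given by its set Sf of non-archimedean places (the archimedean ones are always included)
    (Sf : Set (IsDedekindDomain.HeightOneSpectrum (𝓞 F))) (hSffin : Sf.Finite)
    [IsDedekindDomain (Sf.integer F)]
    -- the G-action on the finite places in S (G-stability of S)
    (act : G → {v // v ∈ Sf} → {v // v ∈ Sf})
    (hact : ∀ (g : G) (v : {v // v ∈ Sf}),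
      algebraMap (𝓞 F) F ''
          (((act g v : IsDedekindDomain.HeightOneSpectrum (𝓞 F))).asIdeal : Set (𝓞 F)) =
        iso g '' (algebraMap (𝓞 F) F ''
          ((v : IsDedekindDomain.HeightOneSpectrum (𝓞 F)).asIdeal : Set (𝓞 F))))
    -- the permutation module ℤ[S]
    [mS : Module (MonoidAlgebra ℤ G)
      ((NumberField.InfinitePlace F ⊕ {v // v ∈ Sf}) →₀ ℤ)]
    (hmS : ∀ (g : G) (x : (NumberField.InfinitePlace F ⊕ {v // v ∈ Sf}) →₀ ℤ),
      (MonoidAlgebra.single g (1 : ℤ) : MonoidAlgebra ℤ G) • x =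
        Finsupp.mapDomain (Sum.map (fun w => iso g • w) (act g)) x)
    -- the ℤ[G]-module of S-units O_{F,S}^×
    [mU : Module (MonoidAlgebra ℤ G) (Additive (Sf.unit F))]
    (hmU : ∀ (g : G) (u v : Sf.unit F), ((v : Fˣ) : F) = iso g ((u : Fˣ) : F) →
      (MonoidAlgebra.single g (1 : ℤ) : MonoidAlgebra ℤ G) • Additive.ofMul u =
        Additive.ofMul v)
    -- the ℤ[G]-module Cl_{F,S}, the class group of the ring of S-integers
    [mCl : Module (MonoidAlgebra ℤ G) (Additive (ClassGroup (Sf.integer F)))]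
    (hmCl : ∀ (g : G) (I J : (Ideal (Sf.integer F))⁰),
      ((fun x : Sf.integer F => (x : F)) ''
          ((J : Ideal (Sf.integer F)) : Set (Sf.integer F)) =
        iso g '' ((fun x : Sf.integer F => (x : F)) ''
          ((I : Ideal (Sf.integer F)) : Set (Sf.integer F)))) →
      (MonoidAlgebra.single g (1 : ℤ) : MonoidAlgebra ℤ G) •
          Additive.ofMul (ClassGroup.mk0 I) = Additive.ofMul (ClassGroup.mk0 J))
    -- σ : the duality endomorphism of G₀(ℤ[G]) induced by M ↦ Hom_ℤ(M,ℤ) on lattices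
    -- (with G acting via the involution g ↦ g⁻¹); on a finite module N it satisfies
    -- σ[N] = −[Hom_ℤ(N, ℚ/ℤ)]
    (σ : G0 (MonoidAlgebra ℤ G) →+ G0 (MonoidAlgebra ℤ G))
    (hσlat : ∀ (M : Type) [AddCommGroup M] [Module (MonoidAlgebra ℤ G) M]
        [Module.Finite (MonoidAlgebra ℤ G) M] [Module.Projective ℤ M]
        [Module (MonoidAlgebra ℤ G) (M →ₗ[ℤ] ℤ)],
      (∀ (g : G) (φ : M →ₗ[ℤ] ℤ) (x : M),
        ((MonoidAlgebra.single g (1 : ℤ) : MonoidAlgebra ℤ G) • φ) x =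
          φ ((MonoidAlgebra.single g⁻¹ (1 : ℤ) : MonoidAlgebra ℤ G) • x)) →
      σ (G0.cls (MonoidAlgebra ℤ G) M) = G0.cls (MonoidAlgebra ℤ G) (M →ₗ[ℤ] ℤ))
    (hσtor : ∀ (N : Type) [AddCommGroup N] [Module (MonoidAlgebra ℤ G) N]
        [Module (MonoidAlgebra ℤ G) (N →ₗ[ℤ] QmodZ)], Finite N →
      (∀ (g : G) (φ : N →ₗ[ℤ] QmodZ) (x : N),
        ((MonoidAlgebra.single g (1 : ℤ) : MonoidAlgebra ℤ G) • φ) x =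
          φ ((MonoidAlgebra.single g⁻¹ (1 : ℤ) : MonoidAlgebra ℤ G) • x)) →
      σ (G0.cls (MonoidAlgebra ℤ G) N) = - G0.cls (MonoidAlgebra ℤ G) (N →ₗ[ℤ] QmodZ))
 :
    G0.cls (MonoidAlgebra ℤ G) (ArTilde F) =
      (Module.finrank ℚ K) • G0.cls (MonoidAlgebra ℤ G) (MonoidAlgebra ℤ G) -
        G0.cls (MonoidAlgebra ℤ G) ((NumberField.InfinitePlace F ⊕ {v // v ∈ Sf}) →₀ ℤ) + σ (G0.cls (MonoidAlgebra ℤ G) (Additive (Sf.unit F))) - σ (G0.cls (MonoidAlgebra ℤ G) (Additive (ClassGroup (Sf.integer F)))) := by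
  obtain ⟨γ, hγ, hdom⟩ := ArClass.exists_galAction_of_pic iso ρT hρT
  have hG : Finite G := Finite.of_equiv _ iso.symm.toEquiv
  letI := ArClass.placeMulAction iso act hact
  have hT : ArClass.PlaceAction Sf γ := ArClass.placeAction_of_act γ iso hγ act hact
  have h := hT.stable
  have hP : G0.cls (MonoidAlgebra ℤ G) ((InfinitePlace F ⊕ {v // v ∈ Sf}) →₀ ℤ) =
      GRep.cls (GRep.perm (G := G) (ArClass.Places (F := F) Sf)) :=
    GRep.cls_eq (GRep.perm (G := G) (ArClass.Places (F := F) Sf)) hmS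
  rw [hP, ← GRep.cls_ofModule (G := G) (ArTilde F),
    ← GRep.cls_ofModule (G := G) (Additive (Sf.unit F)),
    ← GRep.cls_ofModule (G := G) (Additive (ClassGroup (Sf.integer F))),
    ← ArClass.cls_embRep iso γ hγ]
  refine ArClass.cls_arTilde_eq hSffin h hT (fun g φ x => ?_) (fun g u => ?_)
    (fun g I J hIJ => ?_) σ hσlat hσtor
  · rw [ArClass.pull_apply, ArClass.pull_apply, ← hdom]
    exact hmAT g φ _
  · have hmem : Units.map (γ.fld g : F →* F) ((u.toMul : Sf.unit F) : Fˣ) ∈ Sf.unit F := by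
      refine (ArClass.prin_mem_sDom Sf).1 ?_
      rw [← γ.dom_prin]
      exact h.dom_mem_sDom g _ ((ArClass.prin_mem_sDom Sf).2 u.toMul.2)
    exact congrArg (fun w : Additive (Sf.unit F) => ((w.toMul : Sf.unit F) : Fˣ))
      (hmU g u.toMul ⟨_, hmem⟩ (hγ g _))
  · refine hmCl g I J (hIJ.trans ?_)
    exact Set.image_congr fun a _ => hγ g a
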